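/- arXiv:2604.10771 — 5 statements merged into one kernel-verified Lean document; each statement's English description precedes it below -/
import Mathlib

section
/- Let X be a Banach space over 𝕜 (𝕜 = ℝ or ℂ) with the Daugavet property, and let Y ⊆ X be a proper closed subspace of finite codimension n ≥ 1. Then λ(Y, X) ≤ 1 + √n. -/
open MeasureTheory NormedSpace

noncomputable section

variable {𝕜 : Type*} [RCLike 𝕜] {F : Type*} [NormedAddCommGroup F] [NormedSpace 𝕜 F]

/-- `P` is a bounded linear projection from `F` onto the subspace `E`. -/
def IsProjectionOnto (E : Submodule 𝕜 F) (P : F →L[𝕜] F) : Prop :=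
  (∀ x, P x ∈ E) ∧ ∀ e ∈ E, P e = e

/-- The relative projection constant of `E` in `F`. -/
def projConst (E : Submodule 𝕜 F) : ℝ :=
  sInf {c : ℝ | ∃ P : F →L[𝕜] F, IsProjectionOnto E P ∧ ‖P‖ = c}

/-- The Daugavet property: every finite-rank bounded operator `T` satisfies
`‖Id + T‖ = 1 + ‖T‖`. -/
def DaugavetProperty (𝕜 X : Type*) [RCLike 𝕜] [NormedAddCommGroup X] [NormedSpace 𝕜 X] : Prop :=
  ∀ T : X →L[𝕜] X, FiniteDimensional 𝕜 (LinearMap.range (T : X →ₗ[𝕜] X)) →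
    ‖ContinuousLinearMap.id 𝕜 X + T‖ = 1 + ‖T‖

open Matrix in
/-- Matrix determinant lemma for a rank-one perturbation of an invertible matrix. -/
theorem det_add_vecMulVec_of_isUnit {ι R : Type*} [Fintype ι] [DecidableEq ι] [CommRing R]
    {A : Matrix ι ι R} (hA : IsUnit A.det) (u v : ι → R) :
    (A + vecMulVec u v).det = A.det * (1 + v ⬝ᵥ A⁻¹ *ᵥ u) := by
  rw [vecMulVec_eq Unit, det_add_replicateCol_mul_replicateRow hA, det_unique (n := Unit),
    Matrix.mul_assoc]
  rfl

theorem exists_le_add_of_pow_mul_le {n : ℕ} (hn : 1 ≤ n) {η : ℝ} (hη : 0 < η) :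
    ∃ t δ : ℝ, 0 < t ∧ t < 1 ∧ 0 < δ ∧ ∀ q : ℝ, 0 ≤ q →
      (1 - t) ^ n * (1 + t / (1 - t) * q) ≤ 1 + δ → q ≤ n + η := by
  obtain ⟨m, rfl⟩ : ∃ m, n = m + 1 := ⟨n - 1, by omega⟩
  have hm : (0 : ℝ) ≤ m := m.cast_nonneg
  set D : ℝ := 2 + (m + 1) * (m + 1 + η)
  have hDpos : 0 < D := by positivity
  obtain ⟨t, ht⟩ : ∃ t, t = η / D := ⟨_, rfl⟩
  have ht0 : 0 < t := by rw [ht]; positivity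
  have htD : t * D = η := by rw [ht]; field_simp
  have ht1 : t < 1 := by
    rw [ht, div_lt_one hDpos]; nlinarith [mul_nonneg hm hη.le]
  have hmt : m * t < 1 := by
    rw [ht, ← mul_div_assoc, div_lt_one hDpos]; nlinarith [mul_nonneg hm hη.le]
  refine ⟨t, t ^ 2, ht0, ht1, by positivity, fun q hq h => ?_⟩
  have h1t : 0 < 1 - t := by linarith
  have hpow : 1 - m * t ≤ (1 - t) ^ m := by
    have := one_add_mul_le_pow (a := -t) (by linarith) m
    simpa [sub_eq_add_neg] using this
  have heq : (1 - t) ^ (m + 1) * (1 + t / (1 - t) * q) = (1 - t) ^ m * (1 - t + t * q) := by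
    field_simp
    ring
  rw [heq] at h
  have h2 : (1 - m * t) * (1 - t + t * q) ≤ 1 + t ^ 2 :=
    (mul_le_mul_of_nonneg_right hpow (by positivity)).trans h
  have h3 : q * (1 - m * t) ≤ m + 1 + t := by
    refine le_of_mul_le_mul_left ?_ ht0
    nlinarith [mul_nonneg hm (sq_nonneg t)]
  have h4 : m + 1 + t ≤ (m + 1 + η) * (1 - m * t) := by
    nlinarith [mul_nonneg hm ht0.le, mul_pos ht0 hη]
  push_cast
  exact le_of_mul_le_mul_right (h3.trans h4) (by linarith)

open Matrix in
/-- Approximate Kiefer–Wolfowitz theorem: among the convex combinations of the rank-one matrices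
`u u*` with `u` in a bounded set `K`, one with nearly maximal determinant has an inverse
whose quadratic form is nearly bounded by the dimension on `K`. -/
theorem exists_mem_convexHull_quadraticForm_inv_le {ι : Type*} [Fintype ι] [DecidableEq ι]
    [Nonempty ι] {K : Set (ι → 𝕜)} {C : ℝ} (hC : ∀ u ∈ K, ∀ i, ‖u i‖ ≤ C)
    (hbasis : ∀ i, Pi.single i 1 ∈ K) {η : ℝ} (hη : 0 < η) :
    ∃ M ∈ convexHull ℝ ((fun u : ι → 𝕜 => vecMulVec u (star u)) '' K), IsUnit M.det ∧
      ∀ z ∈ K, 0 ≤ RCLike.re (star z ⬝ᵥ M⁻¹ *ᵥ z) →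
        RCLike.re (star z ⬝ᵥ M⁻¹ *ᵥ z) ≤ Fintype.card ι + η := by
  set S := convexHull ℝ ((fun u : ι → 𝕜 => vecMulVec u (star u)) '' K)
  have hn : 1 ≤ Fintype.card ι := Fintype.card_pos
  obtain ⟨t, δ, ht0, ht1, hδ, hq⟩ := exists_le_add_of_pow_mul_le hn hη
  have hSbound : ∀ M ∈ S, ∀ i j, ‖M i j‖ ≤ C * C := by
    intro M hM i j
    have hconv : Convex ℝ {M : Matrix ι ι 𝕜 | ‖M i j‖ ≤ C * C} := by
      intro A hA B hB a b ha hb hab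
      simp only [Set.mem_ofPred_eq] at hA hB ⊢
      calc ‖(a • A + b • B) i j‖ ≤ ‖a • A i j‖ + ‖b • B i j‖ := norm_add_le _ _
        _ = a * ‖A i j‖ + b * ‖B i j‖ := by
          rw [norm_smul, norm_smul, Real.norm_of_nonneg ha, Real.norm_of_nonneg hb]
        _ ≤ a * (C * C) + b * (C * C) := by gcongr
        _ = C * C := by rw [← add_mul, hab, one_mul]
    refine convexHull_min ?_ hconv hM
    rintro _ ⟨u, hu, rfl⟩
    simp only [Set.mem_ofPred_eq, vecMulVec_apply, Pi.star_apply, norm_mul, norm_star]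
    exact mul_le_mul (hC u hu i) (hC u hu j) (norm_nonneg _) ((norm_nonneg _).trans (hC u hu i))
  set V : Set ℝ := (fun M : Matrix ι ι 𝕜 => ‖M.det‖) '' S
  have hVbdd : BddAbove V := by
    refine ⟨(Fintype.card ι).factorial • (C * C) ^ Fintype.card ι, ?_⟩
    rintro _ ⟨M, hM, rfl⟩
    exact Matrix.det_le (abv := NormedField.toAbsoluteValue 𝕜) (hSbound M hM)
  have hVpos : ∃ d ∈ V, 0 < d := by
    refine ⟨_, ⟨∑ i : ι, (Fintype.card ι : ℝ)⁻¹ • vecMulVec (Pi.single i (1 : 𝕜))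
      (star (Pi.single i (1 : 𝕜))), ?_, rfl⟩, ?_⟩
    · refine mem_convexHull_of_exists_fintype (fun _ => (Fintype.card ι : ℝ)⁻¹) _
        (fun _ => by positivity) ?_ (fun i => ⟨_, hbasis i, rfl⟩) rfl
      simp
    · have : ∑ i : ι, (Fintype.card ι : ℝ)⁻¹ • vecMulVec (Pi.single i (1 : 𝕜))
          (star (Pi.single i (1 : 𝕜))) = (Fintype.card ι : 𝕜)⁻¹ • (1 : Matrix ι ι 𝕜) := by
        ext a b
        simp [Matrix.sum_apply, vecMulVec_apply, Matrix.one_apply, Pi.single_apply,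
          RCLike.real_smul_eq_coe_mul, eq_comm (a := b)]
      simp only [this, det_smul]
      simp [Fintype.card_pos, pow_pos]
  obtain ⟨d₀, hd₀, hd₀pos⟩ := hVpos
  have hsup : 0 < sSup V := hd₀pos.trans_le (le_csSup hVbdd hd₀)
  obtain ⟨_, ⟨M, hM, rfl⟩, hMlt⟩ := exists_lt_of_lt_csSup ⟨d₀, hd₀⟩
    (show sSup V / (1 + δ) < sSup V from div_lt_self hsup (by linarith))
  have hMpos : 0 < ‖M.det‖ := lt_trans (by positivity) hMlt
  have hunit : IsUnit M.det := isUnit_iff_ne_zero.2 (norm_pos_iff.1 hMpos)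
  refine ⟨M, hM, hunit, fun z hz hnonneg => hq _ hnonneg ?_⟩
  set q := star z ⬝ᵥ M⁻¹ *ᵥ z with hqdef
  have h1t : 0 < 1 - t := by linarith
  have hmem : (1 - t) • M + t • vecMulVec z (star z) ∈ S :=
    convex_convexHull ℝ _ hM (subset_convexHull ℝ _ ⟨z, hz, rfl⟩) h1t.le ht0.le (by ring)
  have hfactor : (1 - t) • M + t • vecMulVec z (star z) =
      ((1 - t : ℝ) : 𝕜) • (M + vecMulVec (((t / (1 - t) : ℝ) : 𝕜) • z) (star z)) := by
    ext a b
    have h1t' : ((1 - t : ℝ) : 𝕜) ≠ 0 := RCLike.ofReal_ne_zero.2 h1t.ne'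
    simp only [Matrix.add_apply, Matrix.smul_apply, vecMulVec_apply, Pi.smul_apply, smul_eq_mul,
      RCLike.real_smul_eq_coe_mul, RCLike.ofReal_div]
    field_simp
  have hdet := le_csSup hVbdd ⟨_, hmem, rfl⟩
  simp only at hdet
  rw [hfactor, det_smul, det_add_vecMulVec_of_isUnit hunit, mulVec_smul, dotProduct_smul,
    ← hqdef, norm_mul, norm_mul, norm_pow, RCLike.norm_ofReal, abs_of_pos h1t] at hdet
  have hre : 1 + t / (1 - t) * RCLike.re q ≤
      ‖1 + ((t / (1 - t) : ℝ) : 𝕜) • q‖ := by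
    refine le_trans (le_of_eq ?_) (RCLike.re_le_norm _)
    simp only [smul_eq_mul, map_add, RCLike.one_re, RCLike.re_ofReal_mul]
  rw [div_lt_iff₀ (by linarith)] at hMlt
  refine le_of_mul_le_mul_left ?_ hMpos
  calc ‖M.det‖ * ((1 - t) ^ Fintype.card ι * (1 + t / (1 - t) * RCLike.re q))
      = (1 - t) ^ Fintype.card ι * (‖M.det‖ * (1 + t / (1 - t) * RCLike.re q)) := by ring
    _ ≤ (1 - t) ^ Fintype.card ι * (‖M.det‖ * ‖1 + ((t / (1 - t) : ℝ) : 𝕜) • q‖) := by gcongr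
    _ ≤ ‖M.det‖ * (1 + δ) := hdet.trans hMlt.le

open Matrix in
theorem exists_decomposition_of_bounded {ι : Type*} [Fintype ι] [DecidableEq ι] [Nonempty ι]
    {K : Set (ι → 𝕜)} {C : ℝ} (hC : ∀ u ∈ K, ∀ i, ‖u i‖ ≤ C)
    (hbasis : ∀ i, Pi.single i 1 ∈ K) {η : ℝ} (hη : 0 < η) :
    ∃ (κ : Type) (_ : Fintype κ) (u : κ → ι → 𝕜) (g : κ → (ι → 𝕜) →ₗ[𝕜] 𝕜),
      (∀ k, u k ∈ K) ∧ (∀ z, ∑ k, g k z • u k = z) ∧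
        ∀ z ∈ K, ∑ k, ‖g k z‖ ≤ √(Fintype.card ι + η) := by
  obtain ⟨M, hM, hunit, hbound⟩ :=
    exists_mem_convexHull_quadraticForm_inv_le hC hbasis hη
  obtain ⟨κ, _, w, v, hw0, hw1, hv, hsum⟩ := mem_convexHull_iff_exists_fintype.1 hM
  choose u hu huv using hv
  have hMmul : ∀ y, ∑ k, ((w k : 𝕜) * (star (u k) ⬝ᵥ y)) • u k = M *ᵥ y := by
    intro y
    rw [← hsum, sum_mulVec]
    refine Finset.sum_congr rfl fun k _ => ?_
    rw [← huv k]
    ext i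
    simp only [smul_mulVec, vecMulVec_mulVec, Pi.smul_apply, smul_eq_mul,
      RCLike.real_smul_eq_coe_mul, MulOpposite.smul_eq_mul_unop, MulOpposite.unop_op]
    ring
  have hform : ∀ y, ∑ k, w k * ‖star (u k) ⬝ᵥ y‖ ^ 2 = RCLike.re (star (M *ᵥ y) ⬝ᵥ y) := by
    intro y
    rw [← hMmul, star_sum, sum_dotProduct, map_sum]
    refine Finset.sum_congr rfl fun k _ => ?_
    rw [star_smul, smul_dotProduct, smul_eq_mul, star_mul', RCLike.star_def, RCLike.conj_ofReal,
      mul_assoc, RCLike.re_ofReal_mul, RCLike.conj_mul]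
    norm_cast
  have hinv : ∀ z, M *ᵥ (M⁻¹ *ᵥ z) = z := by
    intro z
    rw [mulVec_mulVec, mul_nonsing_inv _ hunit, one_mulVec]
  refine ⟨κ, inferInstance, u,
    fun k => (w k : 𝕜) • (dotProductBilin 𝕜 𝕜 (star (u k)) ∘ₗ M⁻¹.mulVecLin), hu, ?_, ?_⟩
  · intro z
    exact (hMmul (M⁻¹ *ᵥ z)).trans (hinv z)
  · intro z hz
    have hf := hform (M⁻¹ *ᵥ z)
    rw [hinv] at hf
    have hle := hbound z hz (hf ▸ Finset.sum_nonneg fun k _ => mul_nonneg (hw0 k) (sq_nonneg _))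
    refine Real.le_sqrt_of_sq_le (le_trans ?_ hle)
    rw [← hf]
    have hcs := Finset.sum_sq_le_sum_mul_sum_of_sq_le_mul Finset.univ
      (r := fun k => w k * ‖star (u k) ⬝ᵥ (M⁻¹ *ᵥ z)‖) (f := w)
      (g := fun k => w k * ‖star (u k) ⬝ᵥ (M⁻¹ *ᵥ z)‖ ^ 2)
      (fun k _ => hw0 k) (fun k _ => mul_nonneg (hw0 k) (sq_nonneg _)) (fun k _ => le_of_eq (by ring))
    rw [hw1, one_mul] at hcs
    refine le_trans (le_of_eq ?_) hcs
    congr 1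
    refine Finset.sum_congr rfl fun k _ => ?_
    change ‖(w k : 𝕜) * (star (u k) ⬝ᵥ (M⁻¹ *ᵥ z))‖ = _
    rw [norm_mul, RCLike.norm_ofReal, abs_of_nonneg (hw0 k)]

/-- The identity of a nontrivial finite-dimensional normed space factors through `ℓ₁(κ)`, `κ`
finite, with constant arbitrarily close to the square root of the dimension. -/
theorem exists_decomposition_of_finiteDimensional (Z : Type*) [NormedAddCommGroup Z]
    [NormedSpace 𝕜 Z] [FiniteDimensional 𝕜 Z] (hZ : 1 ≤ Module.finrank 𝕜 Z)
    {η : ℝ} (hη : 0 < η) :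
    ∃ (κ : Type) (_ : Fintype κ) (u : κ → Z) (g : κ → Z →ₗ[𝕜] 𝕜),
      (∀ k, ‖u k‖ ≤ 1) ∧ (∀ z, ∑ k, g k z • u k = z) ∧
        ∀ z, ∑ k, ‖g k z‖ ≤ √(Module.finrank 𝕜 Z + η) * ‖z‖ := by
  classical
  have : Nonempty (Fin (Module.finrank 𝕜 Z)) := ⟨⟨0, hZ⟩⟩
  let b₀ := Module.finBasis 𝕜 Z
  have hb₀ : ∀ i, (‖b₀ i‖ : 𝕜) ≠ 0 := fun i => by simpa using b₀.ne_zero i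
  let b := b₀.isUnitSMul (w := fun i => (‖b₀ i‖ : 𝕜)⁻¹) fun i => (inv_ne_zero (hb₀ i)).isUnit
  have hb : ∀ i, ‖b i‖ ≤ 1 := fun i => by
    have : ‖b₀ i‖ ≠ 0 := by simpa using hb₀ i
    simp [b, Module.Basis.isUnitSMul_apply, norm_smul, this]
  let e := b.equivFun.toContinuousLinearEquiv
  obtain ⟨κ, _, u, g, hu, hgu, hg⟩ := exists_decomposition_of_bounded
    (K := {v | ‖e.symm v‖ ≤ 1}) (C := ‖(e : Z →L[𝕜] Fin (Module.finrank 𝕜 Z) → 𝕜)‖) (fun v hv i => by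
      refine (norm_le_pi_norm v i).trans ?_
      have := (e : Z →L[𝕜] Fin (Module.finrank 𝕜 Z) → 𝕜).le_opNorm (e.symm v)
      simp only [ContinuousLinearEquiv.coe_coe, ContinuousLinearEquiv.apply_symm_apply] at this
      exact this.trans (mul_le_of_le_one_right (norm_nonneg _) hv))
    (fun i => by
      have : e.symm (Pi.single i 1) = b i := by
        rw [ContinuousLinearEquiv.symm_apply_eq]
        ext j
        simp [e, Module.Basis.equivFun_self, Pi.single_apply, eq_comm]
      simpa [this] using hb i) hη
  have hball : ∀ z : Z, ‖z‖ ≤ 1 →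
      ∑ k, ‖g k (e z)‖ ≤ √(Module.finrank 𝕜 Z + η) := fun z hz => by
    simpa using hg (e z) (by simpa using hz)
  refine ⟨κ, inferInstance, fun k => e.symm (u k), fun k => g k ∘ₗ (e : Z →ₗ[𝕜] _), hu, ?_, ?_⟩
  · intro z
    apply e.injective
    simpa using hgu (e z)
  · intro z
    rcases eq_or_ne z 0 with rfl | hz
    · simp
    have hz' : 0 < ‖z‖ := norm_pos_iff.2 hz
    have h := hball ((‖z‖ : 𝕜)⁻¹ • z) (by simp [norm_smul, hz'.ne'])
    simp only [map_smul, norm_smul, norm_inv, RCLike.norm_ofReal, abs_norm,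
      ← Finset.mul_sum] at h
    rwa [inv_mul_le_iff₀ hz', mul_comm] at h

/-- Every closed subspace of finite codimension `n ≥ 1` in a normed space has relative projection
constant at most `1 + √n`. -/
theorem projConst_le_one_add_sqrt_finrank {E : Submodule 𝕜 F} (hE : IsClosed (E : Set F))
    [FiniteDimensional 𝕜 (F ⧸ E)] (hcodim : 1 ≤ Module.finrank 𝕜 (F ⧸ E)) :
    projConst E ≤ 1 + √(Module.finrank 𝕜 (F ⧸ E)) := by
  have : IsClosed (E : Set F) := hE
  set n := Module.finrank 𝕜 (F ⧸ E)
  have key : ∀ ε : ℝ, 0 < ε → projConst E ≤ 1 + (1 + ε) * √(n + ε) := by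
    intro ε hε
    obtain ⟨κ, _, u, g, hu, hgu, hg⟩ :=
      exists_decomposition_of_finiteDimensional (𝕜 := 𝕜) (F ⧸ E) hcodim hε
    choose x hxu hxnorm using fun k => Submodule.Quotient.norm_mk_lt (u k) hε
    have hx : ∀ k, ‖x k‖ ≤ 1 + ε := fun k => by linarith [hxnorm k, hu k]
    let Q₀ : F →ₗ[𝕜] F := ∑ k, (g k ∘ₗ E.mkQ).smulRight (x k)
    have hQ₀ : ∀ y, Q₀ y = ∑ k, g k (E.mkQ y) • x k := fun y => by simp [Q₀]
    have hQbound : ∀ y, ‖Q₀ y‖ ≤ ((1 + ε) * √(n + ε)) * ‖y‖ := by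
      intro y
      calc ‖Q₀ y‖ ≤ ∑ k, ‖g k (E.mkQ y) • x k‖ := by rw [hQ₀]; exact norm_sum_le _ _
        _ ≤ ∑ k, ‖g k (E.mkQ y)‖ * (1 + ε) := by
          refine Finset.sum_le_sum fun k _ => ?_
          rw [norm_smul]
          exact mul_le_mul_of_nonneg_left (hx k) (norm_nonneg _)
        _ = (∑ k, ‖g k (E.mkQ y)‖) * (1 + ε) := by rw [Finset.sum_mul]
        _ ≤ (√(n + ε) * ‖E.mkQ y‖) * (1 + ε) := by gcongr; exact hg _
        _ ≤ (√(n + ε) * ‖y‖) * (1 + ε) := by gcongr; exact Submodule.Quotient.norm_mk_le E y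
        _ = _ := by ring
    let Q : F →L[𝕜] F := Q₀.mkContinuous _ hQbound
    have hQnorm : ‖Q‖ ≤ (1 + ε) * √(n + ε) :=
      LinearMap.mkContinuous_norm_le _ (by positivity) _
    have hmkQ : ∀ y, E.mkQ (Q y) = E.mkQ y := fun y => by
      change E.mkQ (Q₀ y) = _
      rw [hQ₀, map_sum]
      simp only [map_smul]
      exact (Finset.sum_congr rfl fun k _ => by rw [← hxu k]; rfl).trans (hgu (E.mkQ y))
    have hproj : IsProjectionOnto E (ContinuousLinearMap.id 𝕜 F - Q) := by
      refine ⟨fun y => ?_, fun y hy => ?_⟩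
      · rw [← Submodule.ker_mkQ E, LinearMap.mem_ker]
        simp [-Submodule.mkQ_apply, map_sub, hmkQ]
      · have h0 : E.mkQ y = 0 := by simpa using hy
        have : Q y = 0 := by
          change Q₀ y = 0
          simp only [hQ₀, h0, map_zero, zero_smul, Finset.sum_const_zero]
        simp [this]
    calc projConst E ≤ ‖ContinuousLinearMap.id 𝕜 F - Q‖ :=
          csInf_le ⟨0, by rintro _ ⟨P, _, rfl⟩; exact norm_nonneg P⟩ ⟨_, hproj, rfl⟩
      _ ≤ ‖ContinuousLinearMap.id 𝕜 F‖ + ‖Q‖ := norm_sub_le _ _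
      _ ≤ 1 + (1 + ε) * √(n + ε) := add_le_add ContinuousLinearMap.norm_id_le hQnorm
  have hlim : Filter.Tendsto (fun ε : ℝ => 1 + (1 + ε) * √(n + ε)) (nhdsWithin 0 (Set.Ioi 0))
      (nhds (1 + √n)) := by
    have hcont : Continuous fun ε : ℝ => 1 + (1 + ε) * √(n + ε) := by fun_prop
    simpa using (hcont.tendsto 0).mono_left nhdsWithin_le_nhds
  exact ge_of_tendsto hlim (eventually_mem_nhdsWithin.mono key)

/-- In a Daugavet space, every proper closed subspace of finite codimension `n ≥ 1`
has relative projection constant at most `1 + √n`. -/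
theorem daugavet_finite_codim_upper_bound
    (X : Type*) [NormedAddCommGroup X] [NormedSpace 𝕜 X] [CompleteSpace X]
    (hX : DaugavetProperty 𝕜 X)
    (Y : Submodule 𝕜 X) (hclosed : IsClosed (Y : Set X)) (hproper : Y ≠ ⊤)
    (n : ℕ) (hn : 1 ≤ n) [FiniteDimensional 𝕜 (X ⧸ Y)]
    (hcodim : Module.finrank 𝕜 (X ⧸ Y) = n) :
    projConst Y ≤ 1 + Real.sqrt n := by
  subst hcodim
  exact projConst_le_one_add_sqrt_finrank hclosed hn
end
end

section
/- Let V ⊆ ℓ₁^N be a duplication-stable subspace of dimension n ≥ 2, and let 𝒱 ⊆ L¹[0,1] be its piecewise-constant copy. Then there is a unique minimal projection from L¹[0,1] onto 𝒱, namely P₀ = J_N P_V J_N^{-1} A_N, where P_V is the unique minimal projection from ℓ₁^N onto V and A_N : L¹[0,1] → L¹[0,1], A_N f = Σ_{j=1}^N (∫_{I_j} f(t) dt)·ν_j, is the conditional-expectation projection onto Z_N = span{ν_1,…,ν_N}. -/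
open MeasureTheory NormedSpace

noncomputable section

/-- The measure defining the real space `L¹[0,1]`: Lebesgue measure restricted to `[0,1]`. -/
def mu01 : Measure ℝ := volume.restrict (Set.Icc (0 : ℝ) 1)

/-- The duplication operator `D_m : ℓ₁^N → ℓ₁^{Nm}`, repeating each coordinate value
`x_j / m` in `m` consecutive slots (auxiliary unbundled version). -/
def dupAux (N m : ℕ) : (Fin N → ℝ) →ₗ[ℝ] (Fin (N * m) → ℝ) :=
  LinearMap.pi fun i => (m : ℝ)⁻¹ • LinearMap.proj
    (⟨i.1 / m, by
      rcases Nat.eq_zero_or_pos m with hm | hm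
      · exact absurd i.2 (by simp [hm])
      · exact (Nat.div_lt_iff_lt_mul hm).mpr i.2⟩ : Fin N)

/-- The duplication operator `D_m : ℓ₁^N → ℓ₁^{Nm}`. -/
def dup (N m : ℕ) : PiLp 1 (fun _ : Fin N => ℝ) →ₗ[ℝ] PiLp 1 (fun _ : Fin (N * m) => ℝ) :=
  (WithLp.linearEquiv 1 ℝ (Fin (N * m) → ℝ)).symm.toLinearMap ∘ₗ
    dupAux N m ∘ₗ (WithLp.linearEquiv 1 ℝ (Fin N → ℝ)).toLinearMap

variable {𝕜 : Type*} [RCLike 𝕜] {F : Type*} [NormedAddCommGroup F] [NormedSpace 𝕜 F]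

/-- `V ⊆ ℓ₁^N` is duplication-stable if, for every `m ≥ 1`, the duplicate `D_m(V)` has the
same relative projection constant as `V` and admits a unique minimal projection. -/
def DuplicationStable (N : ℕ) (V : Submodule ℝ (PiLp 1 fun _ : Fin N => ℝ)) : Prop :=
  ∀ m : ℕ, 1 ≤ m →
    projConst (V.map (dup N m)) = projConst V ∧
    ∃! P : PiLp 1 (fun _ : Fin (N * m) => ℝ) →L[ℝ] PiLp 1 (fun _ : Fin (N * m) => ℝ),
      IsProjectionOnto (V.map (dup N m)) P ∧ ‖P‖ = projConst (V.map (dup N m))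

/-- `ν_j = N · χ_{I_j} ∈ L¹[0,1]`, where `I_j = [j/N, (j+1)/N)` (0-indexed `j`). -/
def nu (N : ℕ) (j : Fin N) : Lp ℝ 1 mu01 :=
  indicatorConstLp 1 (measurableSet_Ico
      (a := ((j : ℕ) : ℝ) / N) (b := (((j : ℕ) : ℝ) + 1) / N))
    (ne_of_lt (lt_of_le_of_lt (Measure.restrict_apply_le _ _) measure_Ico_lt_top))
    (N : ℝ)

/-- The isometric embedding `J_N : ℓ₁^N → L¹[0,1]`, `J_N(e_j) = ν_j`; the piecewise-constant
copy of `V ⊆ ℓ₁^N` is `𝒱 = J_N(V)`. -/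
def JN (N : ℕ) : PiLp 1 (fun _ : Fin N => ℝ) →ₗ[ℝ] Lp ℝ 1 mu01 where
  toFun x := ∑ j : Fin N, x j • nu N j
  map_add' x y := by
    simp [PiLp.add_apply, add_smul, Finset.sum_add_distrib]
  map_smul' c x := by
    simp [PiLp.smul_apply, smul_smul, Finset.smul_sum]

namespace PiecewiseCopy

open Filter Topology Set

/-- The cell `I_j = [j/N, (j+1)/N)`. -/
abbrev cell (N j : ℕ) : Set ℝ := Ico ((j : ℝ) / N) (((j : ℝ) + 1) / N)

instance : IsFiniteMeasure mu01 := by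
  unfold mu01
  infer_instance

theorem mem_cell_iff {N j : ℕ} (hN : 0 < N) {t : ℝ} (ht : 0 ≤ t) :
    t ∈ cell N j ↔ ⌊t * N⌋₊ = j := by
  have hN' : (0 : ℝ) < N := by exact_mod_cast hN
  rw [Nat.floor_eq_iff (by positivity), mem_Ico, div_le_iff₀ hN', lt_div_iff₀ hN']

theorem nonneg_of_mem_cell {N j : ℕ} {t : ℝ} (ht : t ∈ cell N j) : 0 ≤ t :=
  le_trans (by positivity) ht.1

theorem pairwise_disjoint_cell {N : ℕ} (hN : 0 < N) :
    Pairwise (Function.onFun Disjoint fun j : Fin N => cell N j) := by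
  intro i j hij
  refine Set.disjoint_left.2 fun t hi hj => hij (Fin.ext ?_)
  have ht := nonneg_of_mem_cell hi
  rw [← (mem_cell_iff hN ht).1 hi, ← (mem_cell_iff hN ht).1 hj]

theorem mu01_real_cell {N : ℕ} (hN : 0 < N) (j : Fin N) :
    mu01.real (cell N j) = (N : ℝ)⁻¹ := by
  have hN' : (0 : ℝ) < N := by exact_mod_cast hN
  have hj : ((j : ℕ) : ℝ) + 1 ≤ N := by exact_mod_cast j.2
  have hsub : cell N j ⊆ Icc (0 : ℝ) 1 := fun t ht =>
    ⟨nonneg_of_mem_cell ht, ht.2.le.trans (by rwa [div_le_one hN'])⟩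
  rw [mu01, measureReal_restrict_apply measurableSet_Ico, inter_eq_left.2 hsub,
    Real.volume_real_Ico_of_le (by gcongr; linarith)]
  field_simp
  ring

theorem ae_mem_Ico : ∀ᵐ t ∂mu01, t ∈ Ico (0 : ℝ) 1 := by
  have h1 : ∀ᵐ t ∂mu01, t ∈ Icc (0 : ℝ) 1 := ae_restrict_mem measurableSet_Icc
  have h2 : ∀ᵐ t ∂mu01, t ≠ 1 := ae_restrict_of_ae (Measure.ae_ne volume 1)
  filter_upwards [h1, h2] with t ht hne
  exact ⟨ht.1, lt_of_le_of_ne ht.2 hne⟩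

theorem floor_lt_of_mem_Ico {N : ℕ} (hN : 0 < N) {t : ℝ} (ht : t ∈ Ico (0 : ℝ) 1) :
    ⌊t * N⌋₊ < N := by
  have hN' : (0 : ℝ) < N := by exact_mod_cast hN
  rw [Nat.floor_lt (mul_nonneg ht.1 hN'.le)]
  nlinarith [ht.2]

/-- A function in the range of `J_N` is constant on each cell. -/
theorem JN_coeFn {N : ℕ} (hN : 0 < N) (x : PiLp 1 fun _ : Fin N => ℝ) :
    ∀ᵐ t : ℝ ∂mu01, ∀ h : ⌊t * N⌋₊ < N, JN N x t = N * x ⟨⌊t * N⌋₊, h⟩ := by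
  have hsum : JN N x =ᵐ[mu01] ∑ j : Fin N, x j • ⇑(nu N j) :=
    (Lp.coeFn_finsetSum _ _).trans <| by
      have : ∀ j : Fin N, ⇑(x j • nu N j) =ᵐ[mu01] x j • ⇑(nu N j) := fun j => Lp.coeFn_smul _ _
      filter_upwards [ae_all_iff.2 this] with t ht
      simp [ht]
  have hnu : ∀ j : Fin N, nu N j =ᵐ[mu01] (cell N j).indicator fun _ => (N : ℝ) :=
    fun j => indicatorConstLp_coeFn
  filter_upwards [hsum, ae_all_iff.2 hnu, ae_mem_Ico] with t ht hν h01 hlt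
  rw [ht, Finset.sum_apply, Finset.sum_eq_single ⟨⌊t * N⌋₊, hlt⟩]
  · rw [Pi.smul_apply, hν, indicator_of_mem ((mem_cell_iff hN h01.1).2 rfl), smul_eq_mul, mul_comm]
  · intro j _ hj
    rw [Pi.smul_apply, hν, indicator_of_notMem, smul_zero]
    exact fun hmem => hj (Fin.ext ((mem_cell_iff hN h01.1).1 hmem).symm)
  · simp

theorem dup_apply (N m : ℕ) (x : PiLp 1 fun _ : Fin N => ℝ) (i : Fin (N * m)) {j : Fin N}
    (hj : (j : ℕ) = i / m) : dup N m x i = (m : ℝ)⁻¹ * x j := by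
  obtain ⟨j, hj'⟩ := j
  subst hj
  rfl

theorem JN_dup {N m : ℕ} (hN : 0 < N) (hm : 0 < m) (x : PiLp 1 fun _ : Fin N => ℝ) :
    JN (N * m) (dup N m x) = JN N x := by
  apply Lp.ext
  filter_upwards [JN_coeFn hN x, JN_coeFn (Nat.mul_pos hN hm) (dup N m x), ae_mem_Ico]
    with t h1 h2 h01
  have hm' : (m : ℝ) ≠ 0 := by exact_mod_cast hm.ne'
  rw [h1 (floor_lt_of_mem_Ico hN h01), h2 (floor_lt_of_mem_Ico (Nat.mul_pos hN hm) h01),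
    dup_apply N m x _ (j := ⟨⌊t * N⌋₊, floor_lt_of_mem_Ico hN h01⟩)]
  · push_cast
    field_simp
  · rw [← Nat.floor_div_natCast]
    push_cast
    rw [← mul_assoc, mul_div_cancel_right₀ _ hm']

theorem norm_nu_le {N : ℕ} (hN : 0 < N) (j : Fin N) : ‖nu N j‖ ≤ 1 := by
  have hN' : (N : ℝ) ≠ 0 := by exact_mod_cast hN.ne'
  refine norm_indicatorConstLp_le.trans (le_of_eq ?_)
  rw [mu01_real_cell hN]
  simp [hN']

theorem norm_JN_le {N : ℕ} (hN : 0 < N) (x : PiLp 1 fun _ : Fin N => ℝ) : ‖JN N x‖ ≤ ‖x‖ := by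
  rw [PiLp.norm_eq_of_L1]
  refine norm_sum_le_of_le (Finset.univ : Finset (Fin N)) (f := fun j => x j • nu N j) fun j _ => ?_
  rw [norm_smul]
  exact mul_le_of_le_one_right (norm_nonneg _) (norm_nu_le hN j)

/-- `J_N` as a continuous linear map. -/
def JNL {N : ℕ} (hN : 0 < N) : PiLp 1 (fun _ : Fin N => ℝ) →L[ℝ] Lp ℝ 1 mu01 :=
  (JN N).mkContinuous 1 fun x => by simpa using norm_JN_le hN x

theorem norm_JNL_le {N : ℕ} (hN : 0 < N) : ‖JNL hN‖ ≤ 1 :=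
  LinearMap.mkContinuous_norm_le _ zero_le_one _

theorem integrable_coe (f : Lp ℝ 1 mu01) : Integrable f mu01 := L1.integrable_coeFn f

/-- The cell integrals of an `L¹` function, as a linear map. -/
def cellIntegral (N : ℕ) : Lp ℝ 1 mu01 →ₗ[ℝ] PiLp 1 (fun _ : Fin N => ℝ) where
  toFun f := (WithLp.equiv 1 (Fin N → ℝ)).symm fun j => ∫ t in cell N j, f t ∂mu01
  map_add' f g := by
    ext j
    have : ∫ t in cell N j, (f + g) t ∂mu01 = ∫ t in cell N j, (f t + g t) ∂mu01 :=
      integral_congr_ae (ae_restrict_of_ae (Lp.coeFn_add f g))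
    exact this.trans
      (integral_add (integrable_coe f).integrableOn (integrable_coe g).integrableOn)
  map_smul' c f := by
    ext j
    have : ∫ t in cell N j, (c • f) t ∂mu01 = ∫ t in cell N j, c * f t ∂mu01 :=
      integral_congr_ae (ae_restrict_of_ae (Lp.coeFn_smul c f))
    exact this.trans (integral_const_mul c _)

theorem norm_cellIntegral_le {N : ℕ} (hN : 0 < N) (f : Lp ℝ 1 mu01) :
    ‖cellIntegral N f‖ ≤ ‖f‖ := by
  rw [PiLp.norm_eq_of_L1, L1.norm_eq_integral_norm]
  calc ∑ j : Fin N, ‖∫ t in cell N j, f t ∂mu01‖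
      ≤ ∑ j : Fin N, ∫ t in cell N j, ‖f t‖ ∂mu01 :=
        Finset.sum_le_sum fun j _ => norm_integral_le_integral_norm _
    _ = ∫ t in ⋃ j : Fin N, cell N j, ‖f t‖ ∂mu01 :=
        (integral_iUnion_fintype (fun _ => measurableSet_Ico) (pairwise_disjoint_cell hN)
          fun _ => (integrable_coe f).norm.integrableOn).symm
    _ ≤ ∫ t, ‖f t‖ ∂mu01 :=
        setIntegral_le_integral (integrable_coe f).norm (Eventually.of_forall fun _ => norm_nonneg _)

/-- The cell integrals of an `L¹` function, as a continuous linear map. -/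
def cellIntegralL {N : ℕ} (hN : 0 < N) : Lp ℝ 1 mu01 →L[ℝ] PiLp 1 (fun _ : Fin N => ℝ) :=
  (cellIntegral N).mkContinuous 1 fun f => by simpa using norm_cellIntegral_le hN f

theorem norm_cellIntegralL_le {N : ℕ} (hN : 0 < N) : ‖cellIntegralL hN‖ ≤ 1 :=
  LinearMap.mkContinuous_norm_le _ zero_le_one _

theorem cellIntegral_nu {N : ℕ} (hN : 0 < N) (i j : Fin N) :
    cellIntegral N (nu N j) i = if i = j then 1 else 0 := by
  have hN' : (N : ℝ) ≠ 0 := by exact_mod_cast hN.ne'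
  change ∫ t in cell N i, nu N j t ∂mu01 = _
  rw [nu, setIntegral_indicatorConstLp measurableSet_Ico]
  change mu01.real (cell N j ∩ cell N i) • (N : ℝ) = _
  split_ifs with h
  · subst h
    rw [inter_self, mu01_real_cell hN]
    simp [hN']
  · rw [(pairwise_disjoint_cell hN (Ne.symm h)).inter_eq]
    simp

theorem cellIntegralL_JNL {N : ℕ} (hN : 0 < N) (x : PiLp 1 fun _ : Fin N => ℝ) :
    cellIntegralL hN (JNL hN x) = x := by
  change cellIntegral N (∑ j : Fin N, x j • nu N j) = x
  ext i
  simp [cellIntegral_nu hN]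

theorem projConst_le {F : Type*} [NormedAddCommGroup F] [NormedSpace ℝ F] {E : Submodule ℝ F}
    {P : F →L[ℝ] F} (hP : IsProjectionOnto E P) : projConst E ≤ ‖P‖ :=
  csInf_le ⟨0, by rintro _ ⟨Q, -, rfl⟩; exact norm_nonneg Q⟩ ⟨P, hP, rfl⟩

/-- Compressing a projection along a section `J` with left inverse `K`. -/
theorem IsProjectionOnto.compress {F G : Type*} [NormedAddCommGroup F] [NormedSpace ℝ F]
    [NormedAddCommGroup G] [NormedSpace ℝ G] {J : F →L[ℝ] G} {K : G →L[ℝ] F}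
    (hKJ : ∀ x, K (J x) = x) {E : Submodule ℝ F} {P : G →L[ℝ] G}
    (hP : IsProjectionOnto (E.map J.toLinearMap) P) : IsProjectionOnto E (K ∘L P ∘L J) := by
  refine ⟨fun x => ?_, fun e he => ?_⟩
  · obtain ⟨e, he, h⟩ := hP.1 (J x)
    change K (P (J x)) ∈ E
    rw [← h]
    exact (hKJ e).symm ▸ he
  · change K (P (J e)) = e
    rw [hP.2 (J e) ⟨e, he, rfl⟩, hKJ]

/-- Extending a projection along a section `J` with left inverse `K`. -/
theorem IsProjectionOnto.extend {F G : Type*} [NormedAddCommGroup F] [NormedSpace ℝ F]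
    [NormedAddCommGroup G] [NormedSpace ℝ G] {J : F →L[ℝ] G} {K : G →L[ℝ] F}
    (hKJ : ∀ x, K (J x) = x) {E : Submodule ℝ F} {P : F →L[ℝ] F}
    (hP : IsProjectionOnto E P) : IsProjectionOnto (E.map J.toLinearMap) (J ∘L P ∘L K) := by
  refine ⟨fun x => ⟨P (K x), hP.1 _, rfl⟩, ?_⟩
  rintro _ ⟨e, he, rfl⟩
  change J (P (K (J e))) = J e
  rw [hKJ, hP.2 e he]

theorem norm_comp_comp_le {F G : Type*} [NormedAddCommGroup F] [NormedSpace ℝ F]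
    [NormedAddCommGroup G] [NormedSpace ℝ G] {A : F →L[ℝ] G} {B : G →L[ℝ] F}
    (hA : ‖A‖ ≤ 1) (hB : ‖B‖ ≤ 1) (P : F →L[ℝ] F) : ‖A ∘L P ∘L B‖ ≤ ‖P‖ :=
  calc ‖A ∘L P ∘L B‖ ≤ ‖A‖ * (‖P‖ * ‖B‖) :=
        (A.opNorm_comp_le _).trans (by gcongr; exact P.opNorm_comp_le B)
    _ ≤ 1 * (‖P‖ * 1) := by gcongr
    _ = ‖P‖ := by ring

/-- The relative projection constant is unchanged by `J_N`. -/
theorem projConst_map_JN {N : ℕ} (hN : 0 < N) {V : Submodule ℝ (PiLp 1 fun _ : Fin N => ℝ)}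
    {PV : PiLp 1 (fun _ : Fin N => ℝ) →L[ℝ] PiLp 1 (fun _ : Fin N => ℝ)}
    (hPV : IsProjectionOnto V PV) (hPVnorm : ‖PV‖ = projConst V) :
    projConst (V.map (JN N)) = projConst V := by
  have hP₀ := IsProjectionOnto.extend (J := JNL hN) (cellIntegralL_JNL hN) hPV
  apply le_antisymm
  · rw [← hPVnorm]
    exact (projConst_le hP₀).trans
      (norm_comp_comp_le (norm_JNL_le hN) (norm_cellIntegralL_le hN) PV)
  · refine le_csInf ⟨_, _, hP₀, rfl⟩ ?_
    rintro _ ⟨P, hP, rfl⟩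
    exact (projConst_le (IsProjectionOnto.compress (J := JNL hN) (cellIntegralL_JNL hN) hP)).trans
      (norm_comp_comp_le (norm_cellIntegralL_le hN) (norm_JNL_le hN) P)

/-- Two minimal projections onto the piecewise-constant copy agree on functions constant on
the cells of any refinement. -/
theorem minimal_apply_JN_eq {N : ℕ} (hN : 0 < N) {V : Submodule ℝ (PiLp 1 fun _ : Fin N => ℝ)}
    (hV : DuplicationStable N V) {P Q : Lp ℝ 1 mu01 →L[ℝ] Lp ℝ 1 mu01}
    (hP : IsProjectionOnto (V.map (JN N)) P) (hPn : ‖P‖ = projConst V)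
    (hQ : IsProjectionOnto (V.map (JN N)) Q) (hQn : ‖Q‖ = projConst V)
    {m : ℕ} (hm : 0 < m) (y : PiLp 1 fun _ : Fin (N * m) => ℝ) :
    P (JN (N * m) y) = Q (JN (N * m) y) := by
  have hNm := Nat.mul_pos hN hm
  have hmap : V.map (JN N) = (V.map (dup N m)).map (JNL hNm).toLinearMap := by
    rw [← Submodule.map_comp]
    congr 1
    ext1 x
    exact (JN_dup hN hm x).symm
  obtain ⟨hconst, huniq⟩ := hV m hm
  have key : ∀ R : Lp ℝ 1 mu01 →L[ℝ] Lp ℝ 1 mu01, IsProjectionOnto (V.map (JN N)) R →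
      ‖R‖ = projConst V → IsProjectionOnto (V.map (dup N m)) (cellIntegralL hNm ∘L R ∘L JNL hNm) ∧
        ‖cellIntegralL hNm ∘L R ∘L JNL hNm‖ = projConst (V.map (dup N m)) := by
    intro R hR hRn
    have h := IsProjectionOnto.compress (cellIntegralL_JNL hNm) (hmap ▸ hR)
    refine ⟨h, le_antisymm ?_ (projConst_le h)⟩
    rw [hconst, ← hRn]
    exact norm_comp_comp_le (norm_cellIntegralL_le hNm) (norm_JNL_le hNm) R
  have heq := DFunLike.congr_fun (huniq.unique (key P hP hPn) (key Q hQ hQn)) y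
  have lift : ∀ R : Lp ℝ 1 mu01 →L[ℝ] Lp ℝ 1 mu01, IsProjectionOnto (V.map (JN N)) R →
      JNL hNm ((cellIntegralL hNm ∘L R ∘L JNL hNm) y) = R (JN (N * m) y) := by
    intro R hR
    have hmem := hR.1 (JNL hNm y)
    rw [hmap] at hmem
    obtain ⟨e, -, he⟩ := hmem
    change JNL hNm (cellIntegralL hNm (R (JNL hNm y))) = R (JNL hNm y)
    rw [← he]
    exact congrArg _ (cellIntegralL_JNL hNm e)
  rw [← lift P hP, ← lift Q hQ, heq]

/-- A continuous linear map on `L¹` of a finite measure on `ℝ` vanishes as soon as it kills the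
constants and the indicators of rational left half-lines. -/
theorem eq_zero_of_indicator_Iio {E : Type*} [NormedAddCommGroup E] [NormedSpace ℝ E]
    {μ : Measure ℝ} [IsFiniteMeasure μ] {T : Lp ℝ 1 μ →L[ℝ] E}
    (huniv : T (indicatorConstLp 1 MeasurableSet.univ (measure_ne_top μ _) 1) = 0)
    (hIio : ∀ a : ℚ,
      T (indicatorConstLp 1 (measurableSet_Iio (a := (a : ℝ))) (measure_ne_top μ _) 1) = 0) :
    T = 0 := by
  have hset : ∀ (s : Set ℝ) (hs : MeasurableSet s),
      T (indicatorConstLp 1 hs (measure_ne_top μ s) 1) = 0 := by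
    refine MeasurableSpace.induction_on_inter
      ((BorelSpace.measurable_eq (α := ℝ)).trans Real.borel_eq_generateFrom_Iio_rat)
      Real.isPiSystem_Iio_rat ?_ ?_ ?_ ?_
    · rw [indicatorConstLp_empty, map_zero]
    · intro s hs
      simp only [mem_iUnion, mem_singleton_iff] at hs
      obtain ⟨a, rfl⟩ := hs
      exact hIio a
    · intro s hs h
      have hunion := indicatorConstLp_disjoint_union (p := 1) hs hs.compl (measure_ne_top μ _)
        (measure_ne_top μ _) disjoint_compl_right (1 : ℝ)
      simp only [union_compl_self] at hunion
      rwa [hunion, map_add, h, zero_add] at huniv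
    · intro f hf hfm h
      have hacc : ∀ n, MeasurableSet (accumulate f n) := fun n => by
        rw [accumulate_def]
        exact .biUnion (to_countable _) fun i _ => hfm i
      have hzero : ∀ n, T (indicatorConstLp 1 (hacc n) (measure_ne_top μ _) 1) = 0 := by
        intro n
        induction n with
        | zero => simpa only [accumulate_zero_nat] using h 0
        | succ n ih =>
          simp only [accumulate_succ]
          rw [indicatorConstLp_disjoint_union (hacc n) (hfm _) (measure_ne_top μ _)
            (measure_ne_top μ _) (disjoint_accumulate hf n.lt_succ_self), map_add, ih, h, add_zero]
      have hlim : Tendsto (fun n => indicatorConstLp 1 (hacc n) (measure_ne_top μ _) (1 : ℝ)) atTop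
          (𝓝 (indicatorConstLp 1 (.iUnion hfm) (measure_ne_top μ _) 1)) := by
        refine tendsto_indicatorConstLp_set ENNReal.one_ne_top ?_
        have hsymm : ∀ n, μ (symmDiff (accumulate f n) (⋃ i, f i)) =
            μ (⋃ i, f i) - μ (accumulate f n) := fun n => by
          rw [symmDiff_of_le (accumulate_subset_iUnion n),
            measure_sdiff (accumulate_subset_iUnion n) (hacc n).nullMeasurableSet
              (measure_ne_top μ _)]
        simp only [hsymm]
        rw [← tsub_self (μ (⋃ i, f i))]
        exact ENNReal.Tendsto.sub tendsto_const_nhds tendsto_measure_iUnion_accumulate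
          (.inl (measure_ne_top μ _))
      exact tendsto_nhds_unique ((T.continuous.tendsto _).comp hlim)
        (by simp [Function.comp_def, hzero])
  ext1 f
  refine Lp.induction ENNReal.one_ne_top (fun f => T f = 0) ?_ ?_ ?_ f
  · intro c s hs hμs
    have hc : Lp.simpleFunc.indicatorConst 1 hs hμs.ne c =
        c • indicatorConstLp 1 hs (measure_ne_top μ s) (1 : ℝ) := by
      rw [Lp.simpleFunc.coe_indicatorConst]
      apply Lp.ext
      filter_upwards [indicatorConstLp_coeFn (p := 1) (hs := hs) (hμs := hμs.ne) (c := c),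
        indicatorConstLp_coeFn (p := 1) (hs := hs) (hμs := measure_ne_top μ s) (c := (1 : ℝ)),
        Lp.coeFn_smul c (indicatorConstLp 1 hs (measure_ne_top μ s) (1 : ℝ))] with t h1 h2 h3
      rw [h1, h3, Pi.smul_apply, h2]
      by_cases ht : t ∈ s <;> simp [ht]
    rw [hc, map_smul, hset, smul_zero]
  · intro f g _ _ _ hf hg
    rw [map_add, hf, hg, add_zero]
  · exact isClosed_eq T.continuous continuous_const

/-- Indicators of rational left half-lines are piecewise constant on some refinement. -/
theorem exists_JN_eq_indicator_Iio {N : ℕ} (hN : 0 < N) {a : ℚ} (ha : 0 ≤ a) :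
    ∃ m : ℕ, 0 < m ∧ ∃ y : PiLp 1 fun _ : Fin (N * m) => ℝ,
      JN (N * m) y =
        indicatorConstLp 1 (measurableSet_Iio (a := (a : ℝ))) (measure_ne_top mu01 _) 1 := by
  have hNm := Nat.mul_pos hN a.den_pos
  have hNm' : (0 : ℝ) < (N * a.den : ℕ) := by exact_mod_cast hNm
  refine ⟨a.den, a.den_pos, (WithLp.equiv 1 (Fin (N * a.den) → ℝ)).symm fun i =>
    if (i : ℕ) < a.num.toNat * N then ((N * a.den : ℕ) : ℝ)⁻¹ else 0, ?_⟩
  apply Lp.ext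
  filter_upwards [JN_coeFn hNm ((WithLp.equiv 1 (Fin (N * a.den) → ℝ)).symm fun i =>
    if (i : ℕ) < a.num.toNat * N then ((N * a.den : ℕ) : ℝ)⁻¹ else 0),
    indicatorConstLp_coeFn (p := 1) (hs := measurableSet_Iio (a := (a : ℝ)))
      (hμs := measure_ne_top mu01 _) (c := (1 : ℝ)), ae_mem_Ico] with t h1 h2 h01
  rw [h1 (floor_lt_of_mem_Ico hNm h01), h2]
  have hnum : (a.num.toNat : ℝ) = a * a.den := by
    have h : ((a.num.toNat : ℤ) : ℚ) = a * a.den := by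
      rw [Int.toNat_of_nonneg (Rat.num_nonneg.2 ha), Rat.mul_den_eq_num]
    exact_mod_cast congrArg (Rat.cast : ℚ → ℝ) h
  have hiff : ⌊t * (N * a.den : ℕ)⌋₊ < a.num.toNat * N ↔ t ∈ Iio (a : ℝ) := by
    rw [Nat.floor_lt (mul_nonneg h01.1 hNm'.le), mem_Iio,
      ← mul_lt_mul_iff_left₀ (b := t) (c := (a : ℝ)) hNm']
    push_cast
    rw [hnum, mul_right_comm, mul_assoc (a : ℝ) N]
  simp only [WithLp.equiv_symm_apply, indicator_apply, ← hiff]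
  split_ifs
  · exact mul_inv_cancel₀ hNm'.ne'
  · exact mul_zero _

/-- A continuous linear map that kills all functions constant on the cells of refinements
vanishes. -/
theorem eq_zero_of_apply_JN {E : Type*} [NormedAddCommGroup E] [NormedSpace ℝ E] {N : ℕ}
    (hN : 0 < N) {T : Lp ℝ 1 mu01 →L[ℝ] E}
    (hT : ∀ m : ℕ, 0 < m → ∀ y : PiLp 1 fun _ : Fin (N * m) => ℝ, T (JN (N * m) y) = 0) :
    T = 0 := by
  have hpos : ∀ a : ℚ, 0 ≤ a →
      T (indicatorConstLp 1 (measurableSet_Iio (a := (a : ℝ))) (measure_ne_top mu01 _) 1) = 0 := by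
    intro a ha
    obtain ⟨m, hm, y, hy⟩ := exists_JN_eq_indicator_Iio hN ha
    rw [← hy, hT m hm]
  refine eq_zero_of_indicator_Iio ?_ fun a => ?_
  · convert hpos 1 zero_le_one using 2
    apply Lp.ext
    filter_upwards [indicatorConstLp_coeFn (p := 1) (hs := MeasurableSet.univ)
        (hμs := measure_ne_top mu01 _) (c := (1 : ℝ)),
      indicatorConstLp_coeFn (p := 1) (hs := measurableSet_Iio (a := ((1 : ℚ) : ℝ)))
        (hμs := measure_ne_top mu01 _) (c := (1 : ℝ)), ae_mem_Ico] with t h1 h2 h01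
    rw [h1, h2]
    simp [h01.2]
  · rcases le_or_gt 0 a with ha | ha
    · exact hpos a ha
    · convert map_zero T
      apply Lp.ext
      filter_upwards [indicatorConstLp_coeFn (p := 1) (hs := measurableSet_Iio (a := (a : ℝ)))
        (hμs := measure_ne_top mu01 _) (c := (1 : ℝ)), ae_mem_Ico,
        Lp.coeFn_zero ℝ 1 mu01] with t h1 h01 h0
      have : (a : ℝ) < 0 := by exact_mod_cast ha
      rw [h1, h0, indicator_of_notMem (by simpa using this.le.trans h01.1)]
      rfl

end PiecewiseCopy

/-- If `V ⊆ ℓ₁^N` is duplication-stable of dimension `n ≥ 2`, `𝒱 = J_N(V) ⊆ L¹[0,1]` its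
piecewise-constant copy, and `P_V` the (unique) minimal projection from `ℓ₁^N` onto `V`,
then there is a unique minimal projection from `L¹[0,1]` onto `𝒱`, and it is
`P₀ = J_N ∘ P_V ∘ J_N⁻¹ ∘ A_N`, i.e. `P₀ f = J_N (P_V ((∫_{I_j} f)_j))`. -/
theorem piecewise_copy_unique_minimal_projection
    (N n : ℕ) (hn : 2 ≤ n)
    (V : Submodule ℝ (PiLp 1 fun _ : Fin N => ℝ))
    (hdim : Module.finrank ℝ V = n)
    (hV : DuplicationStable N V)
    (PV : PiLp 1 (fun _ : Fin N => ℝ) →L[ℝ] PiLp 1 (fun _ : Fin N => ℝ))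
    (hPV : IsProjectionOnto V PV) (hPVnorm : ‖PV‖ = projConst V) :
    (∃! P : Lp ℝ 1 mu01 →L[ℝ] Lp ℝ 1 mu01,
      IsProjectionOnto (V.map (JN N)) P ∧ ‖P‖ = projConst (V.map (JN N))) ∧
    (∀ P : Lp ℝ 1 mu01 →L[ℝ] Lp ℝ 1 mu01,
      IsProjectionOnto (V.map (JN N)) P → ‖P‖ = projConst (V.map (JN N)) →
      ∀ f : Lp ℝ 1 mu01,
        P f = JN N (PV ((WithLp.equiv 1 (Fin N → ℝ)).symm fun j =>
          ∫ t in Set.Ico (((j : ℕ) : ℝ) / N) ((((j : ℕ) : ℝ) + 1) / N), f t ∂mu01))) := by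
  have hN : 0 < N := by
    rcases Nat.eq_zero_or_pos N with rfl | h
    · have hsub : Subsingleton V := inferInstance
      rw [Module.finrank_zero_of_subsingleton] at hdim
      omega
    · exact h
  have hconst := PiecewiseCopy.projConst_map_JN hN hPV hPVnorm
  set P₀ := PiecewiseCopy.JNL hN ∘L PV ∘L PiecewiseCopy.cellIntegralL hN
  have hP₀ : IsProjectionOnto (V.map (JN N)) P₀ :=
    PiecewiseCopy.IsProjectionOnto.extend (PiecewiseCopy.cellIntegralL_JNL hN) hPV
  have hP₀n : ‖P₀‖ = projConst V :=
    le_antisymm (hPVnorm ▸ PiecewiseCopy.norm_comp_comp_le (PiecewiseCopy.norm_JNL_le hN)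
      (PiecewiseCopy.norm_cellIntegralL_le hN) PV) (hconst ▸ PiecewiseCopy.projConst_le hP₀)
  have huniq : ∀ P : Lp ℝ 1 mu01 →L[ℝ] Lp ℝ 1 mu01, IsProjectionOnto (V.map (JN N)) P →
      ‖P‖ = projConst (V.map (JN N)) → P = P₀ := fun P hP hPn =>
    sub_eq_zero.1 <| PiecewiseCopy.eq_zero_of_apply_JN hN fun m hm y => sub_eq_zero.2 <|
      PiecewiseCopy.minimal_apply_JN_eq hN hV hP (hPn.trans hconst) hP₀ hP₀n hm y
  refine ⟨⟨P₀, ⟨hP₀, hP₀n.trans hconst.symm⟩, fun P hP => huniq P hP.1 hP.2⟩, ?_⟩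
  intro P hP hPn f
  rw [huniq P hP hPn]
  rfl
end
end

section
/- For every real number Λ with 2 < Λ ≤ (3 + √2)/2, there exists a closed subspace Y of codimension 2 in the real Banach space C[0,1] such that λ(Y, C[0,1]) = Λ and the infimum defining λ(Y, C[0,1]) is not attained, i.e. there is no minimal projection from C[0,1] onto Y. -/
open MeasureTheory NormedSpace

noncomputable section

variable {𝕜 : Type*} [RCLike 𝕜] {F : Type*} [NormedAddCommGroup F] [NormedSpace 𝕜 F]

/-- The open quarter `(i/4, (i+1)/4)` of the unit interval. -/
def quarter (i : Fin 4) : Set unitInterval :=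
  Subtype.val ⁻¹' Set.Ioo ((i : ℝ) / 4) (((i : ℝ) + 1) / 4)

lemma isOpen_quarter (i : Fin 4) : IsOpen (quarter i) :=
  isOpen_Ioo.preimage continuous_subtype_val

lemma volume_real_quarter (i : Fin 4) : volume.real (quarter i) = 1 / 4 := by
  have hi : ((i : ℕ) : ℝ) ≤ 3 := by exact_mod_cast Nat.le_of_lt_succ i.2
  have hsub : Set.Ioo ((i : ℝ) / 4) (((i : ℝ) + 1) / 4) ⊆ unitInterval := fun x hx =>
    ⟨by have := hx.1; have : (0 : ℝ) ≤ (i : ℕ) := by positivity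
        linarith, by have := hx.2; linarith⟩
  have h : volume (quarter i) = volume (Set.Ioo ((i : ℝ) / 4) (((i : ℝ) + 1) / 4)) := by
    rw [quarter, unitInterval.volume_def,
      (MeasurableEmbedding.subtype_coe measurableSet_Icc).comap_preimage,
      Subtype.range_coe_subtype]
    congr 1
    exact Set.inter_eq_left.2 hsub
  rw [measureReal_def, h, Real.volume_Ioo]
  rw [show ((i : ℝ) + 1) / 4 - (i : ℝ) / 4 = 1 / 4 by ring]
  norm_num

lemma disjoint_quarter {i j : Fin 4} (h : i ≠ j) : Disjoint (quarter i) (quarter j) := by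
  rw [Set.disjoint_left]
  rintro t ⟨h1, h2⟩ ⟨h3, h4⟩
  apply h
  have a : ((i : ℕ) : ℝ) < (j : ℕ) + 1 := by linarith
  have b : ((j : ℕ) : ℝ) < (i : ℕ) + 1 := by linarith
  norm_cast at a b
  omega

lemma integrable_continuousMap (g : C(unitInterval, ℝ)) (s : Set unitInterval) :
    IntegrableOn g s :=
  (g.continuous.integrable_of_hasCompactSupport
    (HasCompactSupport.of_compactSpace g)).integrableOn

lemma setIntegral_quarter_le (i : Fin 4) {g : C(unitInterval, ℝ)} {c : ℝ} (h : ∀ t, g t ≤ c) :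
    4 * ∫ t in quarter i, g t ≤ c := by
  have := setIntegral_mono (μ := volume) (s := quarter i) (integrable_continuousMap g _)
    (integrable_continuousMap (ContinuousMap.const _ c) _) h
  simp [volume_real_quarter] at this
  linarith

/-- The mean value over the `i`-th quarter, as a functional on `C[0,1]`. -/
def quarterMean (i : Fin 4) : C(unitInterval, ℝ) →L[ℝ] ℝ :=
  LinearMap.mkContinuous
    { toFun := fun g => 4 * ∫ t in quarter i, g t
      map_add' := fun g h => by
        simp only [ContinuousMap.add_apply]
        rw [integral_add (integrable_continuousMap g _) (integrable_continuousMap h _), mul_add]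
      map_smul' := fun c g => by
        simp only [ContinuousMap.smul_apply, smul_eq_mul, RingHom.id_apply]
        rw [integral_const_mul]; ring }
    1 (fun g => by
      simp only [LinearMap.coe_mk, AddHom.coe_mk, one_mul, Real.norm_eq_abs]
      refine abs_le'.2 ⟨setIntegral_quarter_le i fun t => ?_, ?_⟩
      · exact (le_abs_self _).trans (g.norm_coe_le_norm t)
      · have := setIntegral_quarter_le i (g := -g) (c := ‖g‖)
          fun t => (neg_le_abs _).trans (g.norm_coe_le_norm t)
        simpa [integral_neg] using this)

lemma quarterMean_apply (i : Fin 4) (g : C(unitInterval, ℝ)) :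
    quarterMean i g = 4 * ∫ t in quarter i, g t := rfl

lemma abs_quarterMean_le (i : Fin 4) (g : C(unitInterval, ℝ)) : |quarterMean i g| ≤ ‖g‖ := by
  have := (quarterMean i).le_of_opNorm_le
    (LinearMap.mkContinuous_norm_le _ zero_le_one _) g
  simpa using this

lemma quarterMean_le (i : Fin 4) {g : C(unitInterval, ℝ)} {c : ℝ} (h : ∀ t, g t ≤ c) :
    quarterMean i g ≤ c := setIntegral_quarter_le i h

instance isOpenPosMeasure_unitInterval : (volume : Measure unitInterval).IsOpenPosMeasure where
  open_pos U hU hne := by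
    obtain ⟨V, hV, rfl⟩ := isOpen_induced_iff.1 hU
    obtain ⟨x, hx⟩ := hne
    have hxcl : (x : ℝ) ∈ closure (Set.Ioo (0 : ℝ) 1) := by
      rw [closure_Ioo zero_ne_one]
      exact x.2
    have hne' := mem_closure_iff.1 hxcl V hV hx
    rw [unitInterval.volume_def,
      (MeasurableEmbedding.subtype_coe measurableSet_Icc).comap_preimage,
      Subtype.range_coe_subtype]
    have hpos := (hV.inter isOpen_Ioo).measure_pos volume hne'
    exact (hpos.trans_le (measure_mono
      (Set.inter_subset_inter_right V Set.Ioo_subset_Icc_self))).ne'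

lemma eqOn_closure_quarter_of_quarterMean_eq (i : Fin 4) {g : C(unitInterval, ℝ)} {c : ℝ}
    (h : ∀ t, g t ≤ c) (hc : quarterMean i g = c) :
    ∀ t ∈ closure (quarter i), g t = c := by
  have h0 : ∫ t in quarter i, (c - g t) = 0 := by
    rw [integral_sub (integrable_const c) (integrable_continuousMap g _)]
    rw [quarterMean_apply] at hc
    simp [volume_real_quarter]
    linarith
  rw [integral_eq_zero_iff_of_nonneg (fun t => sub_nonneg.2 (h t))
    ((integrable_const c).sub (integrable_continuousMap g _))] at h0
  have h1 := Measure.eqOn_open_of_ae_eq h0 (isOpen_quarter i)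
    (continuous_const.sub g.continuous).continuousOn continuousOn_const
  have h2 := h1.closure (continuous_const.sub g.continuous) continuous_const
  intro t ht
  have := h2 ht
  simp at this
  linarith

lemma tendsto_quarterMean (i : Fin 4) {g : ℕ → C(unitInterval, ℝ)} {C l : ℝ}
    (hb : ∀ n t, |g n t| ≤ C)
    (hl : ∀ᵐ t, t ∈ quarter i → Filter.Tendsto (fun n => g n t) Filter.atTop (nhds l)) :
    Filter.Tendsto (fun n => quarterMean i (g n)) Filter.atTop (nhds l) := by
  have := tendsto_integral_of_dominated_convergence (μ := volume.restrict (quarter i))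
    (F := fun n t => g n t) (f := fun _ => l) (fun _ => C)
    (fun n => (g n).continuous.aestronglyMeasurable)
    (integrable_const _) (fun n => .of_forall fun t => hb n t)
    ((ae_restrict_iff' (isOpen_quarter i).measurableSet).2 hl)
  have := this.const_mul 4
  simpa [volume_real_quarter, quarterMean_apply] using this

lemma exists_bump (t : unitInterval) (h : C(unitInterval, ℝ)) {ε : ℝ} (hε : 0 < ε) :
    ∃ b : C(unitInterval, ℝ), (∀ s, 0 ≤ b s ∧ b s ≤ 1) ∧ b t = 1 ∧
      ∀ i, |quarterMean i (h * b)| ≤ ε := by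
  let b : ℕ → C(unitInterval, ℝ) := fun n => ⟨fun s => (1 - |(s : ℝ) - t|) ^ n, by fun_prop⟩
  have h01 : ∀ s : unitInterval, 0 ≤ 1 - |(s : ℝ) - t| ∧ 1 - |(s : ℝ) - t| ≤ 1 := fun s => by
    have := s.2.1; have := s.2.2; have := t.2.1; have := t.2.2
    refine ⟨sub_nonneg.2 (abs_le.2 ⟨by linarith, by linarith⟩), ?_⟩
    linarith [abs_nonneg ((s : ℝ) - t)]
  have hb : ∀ n s, 0 ≤ b n s ∧ b n s ≤ 1 := fun n s =>
    ⟨pow_nonneg (h01 s).1 n, pow_le_one₀ (h01 s).1 (h01 s).2⟩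
  have key : ∀ i, ∀ᶠ n in Filter.atTop, |quarterMean i (h * b n)| ≤ ε := by
    intro i
    have := tendsto_quarterMean i (g := fun n => h * b n) (C := ‖h‖) (l := 0) ?_ ?_
    · have := this.abs
      rw [abs_zero] at this
      exact this.eventually (ge_mem_nhds hε)
    · intro n s
      rw [ContinuousMap.mul_apply, abs_mul, abs_of_nonneg (hb n s).1]
      exact (mul_le_of_le_one_right (abs_nonneg _) (hb n s).2).trans (h.norm_coe_le_norm s)
    · filter_upwards [measure_eq_zero_iff_ae_notMem.1 (measure_singleton (μ := volume) t)]
        with s hs _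
      have : Filter.Tendsto (fun n => b n s) Filter.atTop (nhds 0) := by
        refine tendsto_pow_atTop_nhds_zero_of_lt_one (h01 s).1 ?_
        have : 0 < |(s : ℝ) - t| := abs_pos.2 (sub_ne_zero.2 fun e => hs (Subtype.ext e))
        linarith
      simpa using this.const_mul (h s)
  obtain ⟨n, hn⟩ := (Filter.eventually_all.2 key).exists
  exact ⟨b n, hb n, by simp [b], hn⟩

lemma exists_quarter_bump (i : Fin 4) {η : ℝ} (h0 : 0 < η) (h1 : η < 1) :
    ∃ φ : C(unitInterval, ℝ), (∀ t, 0 ≤ φ t ∧ φ t ≤ 1) ∧ (∀ t ∉ quarter i, φ t = 0) ∧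
      quarterMean i φ = η := by
  let p : unitInterval → ℝ := fun t => max 0 ((t - (i : ℝ) / 4) * (((i : ℝ) + 1) / 4 - t))
  have hp : ∀ t, 0 ≤ p t := fun t => le_max_left _ _
  let g : ℕ → C(unitInterval, ℝ) := fun n => ⟨fun t => min 1 (n * p t), by fun_prop⟩
  have hg : ∀ n t, 0 ≤ g n t ∧ g n t ≤ 1 := fun n t =>
    ⟨le_min zero_le_one (mul_nonneg n.cast_nonneg (hp t)), min_le_left _ _⟩
  have hl := tendsto_quarterMean i (g := g) (C := 1) (l := 1)
    (fun n t => by rw [abs_of_nonneg (hg n t).1]; exact (hg n t).2)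
    (.of_forall fun t ht => by
      have hpt : 0 < p t :=
        lt_max_of_lt_right (mul_pos (sub_pos.2 ht.1) (sub_pos.2 ht.2))
      obtain ⟨N, hN⟩ := exists_nat_ge (1 / p t)
      refine tendsto_const_nhds.congr' ?_
      filter_upwards [Filter.eventually_ge_atTop N] with n hn
      refine (min_eq_left ?_).symm
      rw [← div_le_iff₀ hpt]
      exact hN.trans (by exact_mod_cast hn))
  obtain ⟨n, hn⟩ := (hl.eventually (lt_mem_nhds h1)).exists
  have hr : η / quarterMean i (g n) ≤ 1 := (div_le_one (h0.trans hn)).2 hn.le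
  have hr0 : 0 ≤ η / quarterMean i (g n) := (div_pos h0 (h0.trans hn)).le
  refine ⟨(η / quarterMean i (g n)) • g n, fun t => ⟨?_, ?_⟩, fun t ht => ?_, ?_⟩
  · exact mul_nonneg hr0 (hg n t).1
  · exact mul_le_one₀ hr (hg n t).1 (hg n t).2
  · have : p t = 0 := by
      refine max_eq_left (not_lt.1 fun hpos => ht ?_)
      rcases mul_pos_iff.1 hpos with h | h
      · exact ⟨sub_pos.1 h.1, sub_pos.1 h.2⟩
      · linarith [h.1, h.2]
    simp [g, this]
  · rw [map_smul, smul_eq_mul, div_mul_cancel₀ _ (h0.trans hn).ne']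

lemma exists_quarter_partition {η : ℝ} (h0 : 0 < η) (h1 : η < 1) :
    ∃ φ : Fin 4 → C(unitInterval, ℝ), (∀ i t, 0 ≤ φ i t) ∧ (∀ t, ∑ i, φ i t ≤ 1) ∧
      ∀ i j, quarterMean i (φ j) = if i = j then η else 0 := by
  choose φ hφ hz hm using fun i => exists_quarter_bump i h0 h1
  refine ⟨φ, fun i t => (hφ i t).1, fun t => ?_, fun i j => ?_⟩
  · by_cases ht : ∃ i, t ∈ quarter i
    · obtain ⟨i, hi⟩ := ht
      rw [Finset.sum_eq_single i (fun j _ hj => hz j t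
        (Set.disjoint_left.1 (disjoint_quarter hj.symm) hi)) (by simp)]
      exact (hφ i t).2
    · push Not at ht
      simp [fun i => hz i t (ht i)]
  · split_ifs with h
    · rw [h, hm]
    · rw [quarterMean_apply, setIntegral_eq_zero_of_forall_eq_zero, mul_zero]
      exact fun t ht => hz j t (Set.disjoint_left.1 (disjoint_quarter h) ht)

/-- The functional `g ↦ E₀ g + β (E₂ g + E₃ g)`, where `Eᵢ` is the mean over the `i`-th quarter. -/
def firstFunctional (β : ℝ) : C(unitInterval, ℝ) →L[ℝ] ℝ :=
  quarterMean 0 + β • (quarterMean 2 + quarterMean 3)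

/-- The functional `g ↦ E₁ g + β (E₂ g - E₃ g)`, where `Eᵢ` is the mean over the `i`-th quarter. -/
def secondFunctional (β : ℝ) : C(unitInterval, ℝ) →L[ℝ] ℝ :=
  quarterMean 1 + β • (quarterMean 2 - quarterMean 3)

/-- The octagonal norm `|a| + |b| + β (|a + b| + |a - b|)` on the plane. -/
def octNorm (β a b : ℝ) : ℝ := |a| + |b| + β * (|a + b| + |a - b|)

/-- The coefficients of `a • firstFunctional β + b • secondFunctional β` with respect to the
means over the four quarters. -/
def octCoeff (β a b : ℝ) : Fin 4 → ℝ := ![a, b, β * (a + b), β * (a - b)]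

lemma functional_comb_eq_sum (β a b : ℝ) (g : C(unitInterval, ℝ)) :
    a * firstFunctional β g + b * secondFunctional β g =
      ∑ i, octCoeff β a b i * quarterMean i g := by
  simp [firstFunctional, secondFunctional, octCoeff, Fin.sum_univ_four]
  ring

lemma sum_abs_octCoeff {β : ℝ} (hβ : 0 ≤ β) (a b : ℝ) :
    ∑ i, |octCoeff β a b i| = octNorm β a b := by
  simp [octCoeff, Fin.sum_univ_four, octNorm, abs_mul, abs_of_nonneg hβ]
  ring

lemma abs_functional_comb_le {β : ℝ} (hβ : 0 ≤ β) (a b : ℝ) (g : C(unitInterval, ℝ)) :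
    |a * firstFunctional β g + b * secondFunctional β g| ≤ octNorm β a b * ‖g‖ := by
  rw [functional_comb_eq_sum, ← sum_abs_octCoeff hβ, Finset.sum_mul]
  refine (Finset.abs_sum_le_sum_abs _ _).trans (Finset.sum_le_sum fun i _ => ?_)
  rw [abs_mul]
  exact mul_le_mul_of_nonneg_left (abs_quarterMean_le i g) (abs_nonneg _)

lemma abs_coe_sign_le_one (x : ℝ) : |(SignType.sign x : ℝ)| ≤ 1 := by
  rcases lt_trichotomy x 0 with h | h | h <;> simp [h]

/-- A quantitative Daugavet equation for rank-two perturbations of the identity of `C[0,1]`. -/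
lemma one_add_octNorm_le_norm {β : ℝ} (hβ : 0 ≤ β) {f₁ f₂ : C(unitInterval, ℝ)}
    {P : C(unitInterval, ℝ) →L[ℝ] C(unitInterval, ℝ)}
    (hP : ∀ g, P g = g - firstFunctional β g • f₁ - secondFunctional β g • f₂)
    (t : unitInterval) : 1 + octNorm β (f₁ t) (f₂ t) ≤ ‖P‖ := by
  have key : ∀ ε : ℝ, 0 < ε → ε < 1 → 1 + (1 - 2 * ε) * octNorm β (f₁ t) (f₂ t) ≤ ‖P‖ := by
    intro ε h0 h1
    obtain ⟨φ, hφ0, hφ1, hφ⟩ := exists_quarter_partition (η := 1 - ε) (by linarith) (by linarith)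
    set c := octCoeff β (f₁ t) (f₂ t) with hc
    let g : C(unitInterval, ℝ) := ∑ i, (SignType.sign (c i) : ℝ) • φ i
    have hg : ∀ s, |g s| ≤ 1 := fun s => by
      simp only [g, ContinuousMap.coe_sum, Finset.sum_apply, ContinuousMap.smul_apply, smul_eq_mul]
      refine (Finset.abs_sum_le_sum_abs _ _).trans ((Finset.sum_le_sum fun i _ => ?_).trans (hφ1 s))
      rw [abs_mul, abs_of_nonneg (hφ0 i s)]
      exact mul_le_of_le_one_left (hφ0 i s) (abs_coe_sign_le_one _)
    have hEg : ∀ i, quarterMean i g = SignType.sign (c i) * (1 - ε) := fun i => by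
      simp [g, hφ]
    obtain ⟨b, hb, hbt, hEb⟩ := exists_bump t (g + 1) h0
    let h : C(unitInterval, ℝ) := g - (g + 1) * b
    have hh : ‖h‖ ≤ 1 := by
      refine (ContinuousMap.norm_le _ zero_le_one).2 fun s => ?_
      have h2 := abs_le.1 (hg s)
      have h3 := hb s
      simp only [h, ContinuousMap.sub_apply, ContinuousMap.mul_apply, ContinuousMap.add_apply,
        ContinuousMap.one_apply, Real.norm_eq_abs]
      exact abs_le.2 ⟨by nlinarith, by nlinarith⟩
    have hPh : P h t = -1 - ∑ i, c i * quarterMean i h := by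
      rw [hc, ← functional_comb_eq_sum, hP]
      simp [h, hbt]
      ring
    have hsum : (1 - 2 * ε) * ∑ i, |c i| ≤ ∑ i, c i * quarterMean i h := by
      rw [Finset.mul_sum]
      refine Finset.sum_le_sum fun i _ => ?_
      have h4 : quarterMean i h = SignType.sign (c i) * (1 - ε) - quarterMean i ((g + 1) * b) := by
        rw [map_sub, hEg]
      have h5 : c i * quarterMean i ((g + 1) * b) ≤ |c i| * ε := by
        refine (le_abs_self _).trans ?_
        rw [abs_mul]
        exact mul_le_mul_of_nonneg_left (hEb i) (abs_nonneg _)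
      rw [h4, mul_sub, ← mul_assoc, self_mul_sign]
      linarith
    rw [sum_abs_octCoeff hβ] at hsum
    have h6 : |P h t| ≤ ‖P‖ :=
      ((P h).norm_coe_le_norm t).trans (P.le_of_opNorm_le_of_le le_rfl hh |>.trans (by simp))
    have := (abs_le.1 h6).1
    linarith
  have hlim : Filter.Tendsto (fun ε : ℝ => 1 + (1 - 2 * ε) * octNorm β (f₁ t) (f₂ t))
      (nhdsWithin 0 (Set.Ioi 0)) (nhds (1 + octNorm β (f₁ t) (f₂ t))) := by
    refine tendsto_nhdsWithin_of_tendsto_nhds ?_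
    have : Continuous fun ε : ℝ => 1 + (1 - 2 * ε) * octNorm β (f₁ t) (f₂ t) := by fun_prop
    simpa using this.tendsto 0
  refine le_of_tendsto hlim ?_
  filter_upwards [Ioo_mem_nhdsGT (zero_lt_one' ℝ)] with ε hε
  exact key ε hε.1 hε.2

lemma functional_dual {β : ℝ} (f₁ f₂ : C(unitInterval, ℝ)) :
    firstFunctional β f₁ + secondFunctional β f₂ =
      quarterMean 0 f₁ + quarterMean 1 f₂ +
        β * (quarterMean 2 (f₁ + f₂) + quarterMean 3 (f₁ - f₂)) := by
  simp [firstFunctional, secondFunctional]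
  ring

lemma octNorm_ge_left {β : ℝ} (hβ : 0 ≤ β) (a b : ℝ) : (1 + 2 * β) * a ≤ octNorm β a b := by
  have h1 : 2 * a ≤ |a + b| + |a - b| := by linarith [le_abs_self (a + b), le_abs_self (a - b)]
  have := mul_le_mul_of_nonneg_left h1 hβ
  unfold octNorm
  linarith [le_abs_self a, abs_nonneg b]

lemma octNorm_ge_right {β : ℝ} (hβ : 0 ≤ β) (a b : ℝ) : (1 + 2 * β) * b ≤ octNorm β a b := by
  have h1 : 2 * b ≤ |a + b| + |a - b| := by linarith [le_abs_self (a + b), neg_le_abs (a - b)]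
  have := mul_le_mul_of_nonneg_left h1 hβ
  unfold octNorm
  linarith [le_abs_self b, abs_nonneg a]

lemma octNorm_ge_add {β : ℝ} (hβ : 0 ≤ β) (a b : ℝ) : (1 + β) * (a + b) ≤ octNorm β a b := by
  have h1 : a + b ≤ |a + b| + |a - b| := by linarith [le_abs_self (a + b), abs_nonneg (a - b)]
  have := mul_le_mul_of_nonneg_left h1 hβ
  unfold octNorm
  linarith [le_abs_self a, le_abs_self b]

lemma octNorm_ge_sub {β : ℝ} (hβ : 0 ≤ β) (a b : ℝ) : (1 + β) * (a - b) ≤ octNorm β a b := by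
  have h1 : a - b ≤ |a + b| + |a - b| := by linarith [le_abs_self (a - b), abs_nonneg (a + b)]
  have := mul_le_mul_of_nonneg_left h1 hβ
  unfold octNorm
  linarith [le_abs_self a, neg_le_abs b]

lemma mem_closure_quarter (i : Fin 4) {t : unitInterval}
    (ht : (t : ℝ) = 1 / 4) (hi : i = 0 ∨ i = 1) : t ∈ closure (quarter i) := by
  rcases hi with rfl | rfl
  · have : quarter 0 = Set.Ioo 0 t := by
      ext s
      rw [Set.mem_Ioo, ← Subtype.coe_lt_coe, ← Subtype.coe_lt_coe, ht]
      norm_num [quarter]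
    rw [this, closure_Ioo (by rintro rfl; simp at ht)]
    exact ⟨t.2.1, le_rfl⟩
  · let u : unitInterval := ⟨1 / 2, by norm_num, by norm_num⟩
    have hu : (u : ℝ) = 1 / 2 := rfl
    have : quarter 1 = Set.Ioo t u := by
      ext s
      rw [Set.mem_Ioo, ← Subtype.coe_lt_coe, ← Subtype.coe_lt_coe, ht, hu]
      norm_num [quarter]
    have htu : t < u := by rw [← Subtype.coe_lt_coe, ht, hu]; norm_num
    rw [this, closure_Ioo htu.ne]
    exact ⟨le_rfl, htu.le⟩

/-- A continuous biorthogonal pair for the two functionals exceeds `l` somewhere in the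
octagonal norm; the optimal pair of step functions is discontinuous at `1/4`. -/
lemma lt_of_forall_octNorm_le {β l L : ℝ} (hβ : 0 < β)
    (hl : l * (1 + 2 * β + 2 * β ^ 2) = (1 + β) * (1 + 2 * β)) {f₁ f₂ : C(unitInterval, ℝ)}
    (h1 : firstFunctional β f₁ = 1) (h2 : secondFunctional β f₂ = 1)
    (hL : ∀ t, octNorm β (f₁ t) (f₂ t) ≤ L) : l < L := by
  have hd : 0 < 1 + 2 * β := by positivity
  have hs : 0 < 1 + β := by positivity
  have hf₁ : ∀ t, f₁ t ≤ L / (1 + 2 * β) := fun t =>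
    (le_div_iff₀' hd).2 ((octNorm_ge_left hβ.le _ _).trans (hL t))
  have hf₂ : ∀ t, f₂ t ≤ L / (1 + 2 * β) := fun t =>
    (le_div_iff₀' hd).2 ((octNorm_ge_right hβ.le _ _).trans (hL t))
  have e0 := quarterMean_le 0 hf₁
  have e1 := quarterMean_le 1 hf₂
  have e2 := quarterMean_le 2 (g := f₁ + f₂) (c := L / (1 + β)) fun t =>
    (le_div_iff₀' hs).2 ((octNorm_ge_add hβ.le _ _).trans (hL t))
  have e3 := quarterMean_le 3 (g := f₁ - f₂) (c := L / (1 + β)) fun t =>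
    (le_div_iff₀' hs).2 ((octNorm_ge_sub hβ.le _ _).trans (hL t))
  have hsum := functional_dual (β := β) f₁ f₂
  rw [h1, h2] at hsum
  have e23 := mul_le_mul_of_nonneg_left (add_le_add e2 e3) hβ.le
  have hk : 0 < 1 + 2 * β + 2 * β ^ 2 := by positivity
  have hid : L / (1 + 2 * β) + β * (L / (1 + β)) =
      L * (1 + 2 * β + 2 * β ^ 2) / ((1 + β) * (1 + 2 * β)) := by
    field_simp
    ring
  have hlpos : 0 < l := by
    refine pos_of_mul_pos_left (b := 1 + 2 * β + 2 * β ^ 2) ?_ hk.le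
    rw [hl]; positivity
  have hle : l ≤ L := by
    have : 1 ≤ L * (1 + 2 * β + 2 * β ^ 2) / ((1 + β) * (1 + 2 * β)) := by
      rw [← hid]; linarith
    rw [one_le_div (by positivity), ← hl] at this
    exact le_of_mul_le_mul_right this hk
  refine lt_of_le_of_ne hle ?_
  rintro rfl
  have hid1 : l / (1 + 2 * β) + β * (l / (1 + β)) = 1 := by
    rw [hid, hl, div_self (by positivity)]
  let t : unitInterval := ⟨1 / 4, by norm_num, by norm_num⟩
  have ht : (t : ℝ) = 1 / 4 := rfl
  have a0 := eqOn_closure_quarter_of_quarterMean_eq 0 hf₁ (by linarith) t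
    (mem_closure_quarter 0 ht (.inl rfl))
  have a1 := eqOn_closure_quarter_of_quarterMean_eq 1 hf₂ (by linarith) t
    (mem_closure_quarter 1 ht (.inr rfl))
  have h3 := octNorm_ge_add hβ.le (f₁ t) (f₂ t)
  have h4 := hL t
  rw [a0, a1] at h3 h4
  have h5 := h3.trans h4
  have h6 : (1 + β) * (l / (1 + 2 * β) + l / (1 + 2 * β)) = l + l / (1 + 2 * β) := by
    field_simp
    ring
  have : 0 < l / (1 + 2 * β) := by positivity
  linarith

/-- Biorthogonal continuous pairs come arbitrarily close to the bound `l`. -/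
lemma exists_biorthogonal {β l η : ℝ} (hβ : 0 < β)
    (hl : l * (1 + 2 * β + 2 * β ^ 2) = (1 + β) * (1 + 2 * β)) (h0 : 0 < η) (h1 : η < 1) :
    ∃ f₁ f₂ : C(unitInterval, ℝ),
      firstFunctional β f₁ = 1 ∧ firstFunctional β f₂ = 0 ∧
      secondFunctional β f₁ = 0 ∧ secondFunctional β f₂ = 1 ∧
      ∀ t, octNorm β (f₁ t) (f₂ t) ≤ l / η := by
  obtain ⟨φ, hφ0, hφ1, hφ⟩ := exists_quarter_partition h0 h1
  have hk : 0 < 1 + 2 * β + 2 * β ^ 2 := by positivity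
  have hlpos : 0 < l := by
    refine pos_of_mul_pos_left (b := 1 + 2 * β + 2 * β ^ 2) ?_ hk.le
    rw [hl]; positivity
  obtain ⟨c, hc⟩ : ∃ c, c = l / (1 + 2 * β) := ⟨_, rfl⟩
  obtain ⟨d, hd⟩ : ∃ d, d = l / (2 * (1 + β)) := ⟨_, rfl⟩
  have hc' : c * (1 + 2 * β) = l := by rw [hc]; field_simp
  have hd' : d * (2 * (1 + β)) = l := by rw [hd]; field_simp
  have hc0 : 0 < c := by rw [hc]; positivity
  have hd0 : 0 < d := by rw [hd]; positivity
  have hcd : c + 2 * β * d = 1 := by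
    rw [hc, hd]
    field_simp
    linarith
  refine ⟨η⁻¹ • (c • φ 0 + d • φ 2 + d • φ 3), η⁻¹ • (c • φ 1 + d • φ 2 - d • φ 3),
    ?_, ?_, ?_, ?_, fun t => ?_⟩
  · simp [firstFunctional, hφ]
    field_simp
    linarith
  · simp [firstFunctional, hφ]
  · simp [secondFunctional, hφ]
  · simp [secondFunctional, hφ]
    field_simp
    linarith
  · have hs := hφ1 t
    rw [Fin.sum_univ_four] at hs
    have p0 := hφ0 0 t
    have p1 := hφ0 1 t
    have p2 := hφ0 2 t
    have p3 := hφ0 3 t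
    simp only [ContinuousMap.smul_apply, ContinuousMap.add_apply, ContinuousMap.sub_apply,
      smul_eq_mul]
    generalize φ 0 t = x at *
    generalize φ 1 t = y at *
    generalize φ 2 t = z at *
    generalize φ 3 t = w at *
    have hη : 0 < η⁻¹ := inv_pos.2 h0
    unfold octNorm
    rw [← mul_add, ← mul_sub, abs_mul, abs_mul, abs_mul, abs_mul, abs_of_pos hη]
    have cx := mul_nonneg hc0.le p0
    have cy := mul_nonneg hc0.le p1
    have dz := mul_nonneg hd0.le p2
    have dw := mul_nonneg hd0.le p3
    have b1 : |c * x + d * z + d * w| ≤ c * x + d * z + d * w := (abs_of_nonneg (by linarith)).le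
    have b2 : |c * y + d * z - d * w| ≤ c * y + d * z + d * w :=
      abs_le.2 ⟨by linarith, by linarith⟩
    have b3 : |c * x + d * z + d * w + (c * y + d * z - d * w)| ≤ c * x + c * y + 2 * (d * z) :=
      abs_le.2 ⟨by linarith, by linarith⟩
    have b4 : |c * x + d * z + d * w - (c * y + d * z - d * w)| ≤ c * x + c * y + 2 * (d * w) :=
      abs_le.2 ⟨by linarith, by linarith⟩
    have b5 := mul_le_mul_of_nonneg_left (add_le_add b3 b4) hβ.le
    have b6 : c * x + d * z + d * w + (c * y + d * z + d * w) +
        β * (c * x + c * y + 2 * (d * z) + (c * x + c * y + 2 * (d * w))) =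
        c * (1 + 2 * β) * (x + y) + d * (2 * (1 + β)) * (z + w) := by ring
    rw [hc', hd'] at b6
    have b7 : l * (x + y) + l * (z + w) ≤ l := by nlinarith
    have b8 := mul_le_mul_of_nonneg_left (by linarith :
      |c * x + d * z + d * w| + |c * y + d * z - d * w| +
        β * (|c * x + d * z + d * w + (c * y + d * z - d * w)| +
          |c * x + d * z + d * w - (c * y + d * z - d * w)|) ≤ l) hη.le
    rw [div_eq_inv_mul]
    linarith

/-- The two functionals, bundled as a map to the plane. -/
def functionalPair (β : ℝ) : C(unitInterval, ℝ) →L[ℝ] ℝ × ℝ :=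
  (firstFunctional β).prod (secondFunctional β)

lemma mem_ker_functionalPair {β : ℝ} {g : C(unitInterval, ℝ)} :
    g ∈ (functionalPair β).ker ↔ firstFunctional β g = 0 ∧ secondFunctional β g = 0 := by
  simp [functionalPair]

lemma exists_param {Λ : ℝ} (h1 : 2 < Λ) (h2 : Λ ≤ (3 + Real.sqrt 2) / 2) :
    ∃ β : ℝ, 0 < β ∧ (Λ - 1) * (1 + 2 * β + 2 * β ^ 2) = (1 + β) * (1 + 2 * β) := by
  have hs : Real.sqrt 2 ^ 2 = 2 := Real.sq_sqrt (by norm_num)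
  have hs0 := Real.sqrt_nonneg 2
  have hs2 : Real.sqrt 2 < 3 / 2 := by nlinarith
  obtain ⟨δ, hδ⟩ : ∃ δ, δ = Λ - 2 := ⟨_, rfl⟩
  have hδ0 : 0 < δ := by linarith
  have hδ1 : δ ≤ (Real.sqrt 2 - 1) / 2 := by linarith
  have hdisc : 0 ≤ discrim (2 * δ) (2 * δ - 1) δ := by
    have h3 : 2 * Real.sqrt 2 * δ ≤ 1 - 2 * δ := by nlinarith
    have h4 : (2 * Real.sqrt 2 * δ) ^ 2 ≤ (1 - 2 * δ) ^ 2 := pow_le_pow_left₀ (by positivity) h3 2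
    unfold discrim
    nlinarith
  obtain ⟨β, hβ⟩ := exists_quadratic_eq_zero (mul_pos two_pos hδ0).ne'
    ⟨_, (Real.mul_self_sqrt hdisc).symm⟩
  refine ⟨β, ?_, ?_⟩
  · have : 0 < β * (1 - 2 * δ) := by nlinarith [mul_nonneg hδ0.le (mul_self_nonneg β)]
    exact pos_of_mul_pos_left this (by linarith)
  · rw [show Λ - 1 = 1 + δ by linarith]
    linarith

lemma lt_norm_of_isProjectionOnto {β l : ℝ} (hβ : 0 < β)
    (hl : l * (1 + 2 * β + 2 * β ^ 2) = (1 + β) * (1 + 2 * β))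
    {P : C(unitInterval, ℝ) →L[ℝ] C(unitInterval, ℝ)}
    (hP : IsProjectionOnto (functionalPair β).ker P) : 1 + l < ‖P‖ := by
  obtain ⟨u₁, u₂, h11, h12, h21, h22, -⟩ := exists_biorthogonal hβ hl one_half_pos one_half_lt_one
  have hmem : ∀ g, firstFunctional β (P g) = 0 ∧ secondFunctional β (P g) = 0 := fun g =>
    mem_ker_functionalPair.1 (hP.1 g)
  have hform : ∀ g, P g = g - firstFunctional β g • (u₁ - P u₁)
      - secondFunctional β g • (u₂ - P u₂) := fun g => by
    have := hP.2 (g - firstFunctional β g • u₁ - secondFunctional β g • u₂)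
      (mem_ker_functionalPair.2 (by simp [h11, h12, h21, h22]))
    simp only [map_sub, map_smul] at this
    rw [smul_sub, smul_sub, ← sub_eq_zero]
    rw [← sub_eq_zero] at this
    rw [← this]
    abel
  have := lt_of_forall_octNorm_le (L := ‖P‖ - 1) hβ hl (f₁ := u₁ - P u₁) (f₂ := u₂ - P u₂)
    (by simp [h11, hmem]) (by simp [h22, hmem])
    (fun t => by linarith [one_add_octNorm_le_norm hβ.le hform t])
  linarith

lemma exists_isProjectionOnto_norm_le {β l η : ℝ} (hβ : 0 < β)
    (hl : l * (1 + 2 * β + 2 * β ^ 2) = (1 + β) * (1 + 2 * β)) (h0 : 0 < η) (h1 : η < 1) :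
    ∃ P : C(unitInterval, ℝ) →L[ℝ] C(unitInterval, ℝ),
      IsProjectionOnto (functionalPair β).ker P ∧ ‖P‖ ≤ 1 + l / η := by
  obtain ⟨f₁, f₂, h11, h12, h21, h22, hN⟩ := exists_biorthogonal hβ hl h0 h1
  have hN0 : 0 ≤ l / η := by
    refine le_trans ?_ (hN 0)
    unfold octNorm
    positivity
  refine ⟨ContinuousLinearMap.id ℝ _ - (firstFunctional β).smulRight f₁ -
    (secondFunctional β).smulRight f₂, ⟨fun g => ?_, fun g hg => ?_⟩, ?_⟩
  · exact mem_ker_functionalPair.2 (by simp [h11, h12, h21, h22])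
  · obtain ⟨e1, e2⟩ := mem_ker_functionalPair.1 hg
    simp [e1, e2]
  · refine ContinuousLinearMap.opNorm_le_bound _ (by linarith) fun g => ?_
    refine (ContinuousMap.norm_le _ (by positivity)).2 fun t => ?_
    have b1 := g.norm_coe_le_norm t
    have b2 := abs_functional_comb_le hβ.le (f₁ t) (f₂ t) g
    have b3 := mul_le_mul_of_nonneg_right (hN t) (norm_nonneg g)
    have b4 := abs_sub (g t) (f₁ t * firstFunctional β g + f₂ t * secondFunctional β g)
    simp only [sub_apply, ContinuousLinearMap.smulRight_apply,
      ContinuousLinearMap.id_apply, ContinuousMap.sub_apply, ContinuousMap.smul_apply, smul_eq_mul,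
      Real.norm_eq_abs] at b1 ⊢
    rw [sub_sub, mul_comm _ (f₁ t), mul_comm _ (f₂ t)]
    linarith

lemma finrank_quotient_ker_functionalPair {β l : ℝ} (hβ : 0 < β)
    (hl : l * (1 + 2 * β + 2 * β ^ 2) = (1 + β) * (1 + 2 * β)) :
    Module.finrank ℝ (C(unitInterval, ℝ) ⧸ (functionalPair β).ker) = 2 := by
  obtain ⟨u₁, u₂, h11, h12, h21, h22, -⟩ := exists_biorthogonal hβ hl one_half_pos one_half_lt_one
  have hsurj : Function.Surjective (functionalPair β : C(unitInterval, ℝ) →ₗ[ℝ] ℝ × ℝ) :=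
    fun x => ⟨x.1 • u₁ + x.2 • u₂, by
      ext <;> simp [functionalPair, h11, h12, h21, h22]⟩
  rw [(LinearMap.quotKerEquivOfSurjective _ hsurj).finrank_eq]
  simp

lemma projConst_ker_functionalPair {β l : ℝ} (hβ : 0 < β)
    (hl : l * (1 + 2 * β + 2 * β ^ 2) = (1 + β) * (1 + 2 * β)) :
    projConst (functionalPair β).ker = 1 + l := by
  have hbdd : BddBelow {c : ℝ | ∃ P : C(unitInterval, ℝ) →L[ℝ] C(unitInterval, ℝ),
      IsProjectionOnto (functionalPair β).ker P ∧ ‖P‖ = c} :=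
    ⟨0, by rintro _ ⟨P, -, rfl⟩; exact norm_nonneg P⟩
  refine le_antisymm ?_ ?_
  · have hlim : Filter.Tendsto (fun η : ℝ => 1 + l / η) (nhdsWithin 1 (Set.Iio 1))
        (nhds (1 + l)) := by
      refine tendsto_nhdsWithin_of_tendsto_nhds ?_
      have : ContinuousAt (fun η : ℝ => 1 + l / η) 1 := by fun_prop (disch := norm_num)
      simpa [ContinuousAt] using this
    refine ge_of_tendsto hlim ?_
    filter_upwards [Ioo_mem_nhdsLT (zero_lt_one' ℝ)] with η hη
    obtain ⟨P, hP, hn⟩ := exists_isProjectionOnto_norm_le hβ hl hη.1 hη.2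
    exact (csInf_le hbdd ⟨P, hP, rfl⟩).trans hn
  · obtain ⟨P, hP, -⟩ := exists_isProjectionOnto_norm_le hβ hl one_half_pos one_half_lt_one
    refine le_csInf ⟨_, P, hP, rfl⟩ ?_
    rintro _ ⟨P, hP, rfl⟩
    exact (lt_norm_of_isProjectionOnto hβ hl hP).le

/-- For every `Λ` with `2 < Λ ≤ (3 + √2)/2` there is a codimension-2 closed subspace `Y`
of the real space `C[0,1]` with `λ(Y, C[0,1]) = Λ` for which no minimal projection exists. -/
theorem exists_codim_two_subspace_projConst_not_attained
    (Λ : ℝ) (h1 : 2 < Λ) (h2 : Λ ≤ (3 + Real.sqrt 2) / 2) :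
    ∃ Y : Submodule ℝ C(unitInterval, ℝ),
      IsClosed (Y : Set C(unitInterval, ℝ)) ∧
      Module.finrank ℝ (C(unitInterval, ℝ) ⧸ Y) = 2 ∧
      projConst (𝕜 := ℝ) (F := C(unitInterval, ℝ)) Y = Λ ∧
      ¬∃ P : C(unitInterval, ℝ) →L[ℝ] C(unitInterval, ℝ),
        IsProjectionOnto (𝕜 := ℝ) (F := C(unitInterval, ℝ)) Y P ∧
        ‖P‖ = projConst (𝕜 := ℝ) (F := C(unitInterval, ℝ)) Y := by
  obtain ⟨β, hβ, hl⟩ := exists_param h1 h2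
  refine ⟨(functionalPair β).ker, (functionalPair β).isClosed_ker,
    finrank_quotient_ker_functionalPair hβ hl, ?_, ?_⟩
  · rw [projConst_ker_functionalPair hβ hl]
    ring
  · rintro ⟨P, hP, hn⟩
    rw [projConst_ker_functionalPair hβ hl] at hn
    exact (lt_norm_of_isProjectionOnto hβ hl hP).ne' hn
end
end

section
/- Let n ≥ 4 be an even integer and let β_n := 2^{-n} Σ_{ω ∈ {-1,1}^n} |Σ_{j=1}^n ω_j| = n 2^{-n} (n choose n/2). Then for every real number Λ with 2 < Λ ≤ 1 + β_n, there exists a closed subspace Y of codimension n in the real Banach space C[0,1] such that λ(Y, C[0,1]) = Λ and the infimum defining λ(Y, C[0,1]) is not attained, i.e. there is no minimal projection from C[0,1] onto Y. -/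
open MeasureTheory NormedSpace

noncomputable section

variable {𝕜 : Type*} [RCLike 𝕜] {F : Type*} [NormedAddCommGroup F] [NormedSpace 𝕜 F]

section Moments

variable {X K ι : Type*} [TopologicalSpace X] [Fintype K]

/-- The vector-valued functional `x ↦ ∑ k, L k x • w k • v k`. -/
def momentMap (w : K → ℝ) (v : K → ι → ℝ) (L : K → C(X, ℝ) →L[ℝ] ℝ) :
    C(X, ℝ) →L[ℝ] (ι → ℝ) :=
  ∑ k, (L k).smulRight (w k • v k)

/-- Continuous bumps avoiding a given point which are biorthogonal, up to a factor `r < 1`,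
to the functionals `L`. -/
def HasBumps (L : K → C(X, ℝ) →L[ℝ] ℝ) : Prop :=
  ∀ t : X, ∀ r : ℝ, 0 < r → r < 1 → ∃ ψ : K → C(X, ℝ),
    (∀ k s, 0 ≤ ψ k s) ∧ (∀ s, ∑ k, ψ k s ≤ 1) ∧ (∀ k, ψ k t = 0) ∧
    (∀ k, L k (ψ k) = r) ∧ ∀ k l, k ≠ l → L l (ψ k) = 0

variable {w : K → ℝ} {v : K → ι → ℝ} {L : K → C(X, ℝ) →L[ℝ] ℝ}

lemma momentMap_apply (x : C(X, ℝ)) (i : ι) :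
    momentMap w v L x i = ∑ k, w k * L k x * v k i := by
  simp only [momentMap, _root_.sum_apply, ContinuousLinearMap.smulRight_apply,
    Finset.sum_apply, Pi.smul_apply, smul_eq_mul]
  exact Finset.sum_congr rfl fun k _ => by ring

variable [Fintype ι]

/-- The norm-like functional `a ↦ ∑ k, w k * |⟨a, v k⟩|`. -/
def weightedNorm (w : K → ℝ) (v : K → ι → ℝ) (a : ι → ℝ) : ℝ :=
  ∑ k, w k * |a ⬝ᵥ v k|

lemma weightedNorm_nonneg (hw : ∀ k, 0 ≤ w k) (a : ι → ℝ) : 0 ≤ weightedNorm w v a :=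
  Finset.sum_nonneg fun k _ => mul_nonneg (hw k) (abs_nonneg _)

lemma weightedNorm_smul (c : ℝ) (a : ι → ℝ) :
    weightedNorm w v (c • a) = |c| * weightedNorm w v a := by
  simp only [weightedNorm, smul_dotProduct, smul_eq_mul, abs_mul, Finset.mul_sum]
  exact Finset.sum_congr rfl fun k _ => by ring

lemma sum_momentMap_mul (a : ι → ℝ) (x : C(X, ℝ)) :
    ∑ i, momentMap w v L x i * a i = ∑ k, w k * L k x * (a ⬝ᵥ v k) := by
  simp only [momentMap_apply, Finset.sum_mul, dotProduct, Finset.mul_sum]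
  rw [Finset.sum_comm]
  exact Finset.sum_congr rfl fun k _ => Finset.sum_congr rfl fun i _ => by ring

lemma one_add_weightedNorm_le_norm [CompactSpace X] (hw : ∀ k, 0 ≤ w k)
    (hL1 : ∀ k, L k 1 = 1) (hb : HasBumps L) {P : C(X, ℝ) →L[ℝ] C(X, ℝ)} {f : ι → C(X, ℝ)}
    (hP : ∀ x, P x = x - ∑ i, momentMap w v L x i • f i) (t : X) :
    1 + weightedNorm w v (fun i => f i t) ≤ ‖P‖ := by
  set a : ι → ℝ := fun i => f i t
  set m := weightedNorm w v a
  have hm : 0 ≤ m := weightedNorm_nonneg hw a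
  have key : ∀ r : ℝ, 0 < r → r < 1 → 1 + m - 2 * (1 - r) * m ≤ ‖P‖ := by
    intro r hr0 hr1
    obtain ⟨ψ, hψ0, hψ1, hψt, hLψ, hLψ'⟩ := hb t r hr0 hr1
    let s : K → ℝ := fun k => if 0 ≤ a ⬝ᵥ v k then -1 else 1
    let x : C(X, ℝ) := 1 - ∑ k, (1 - s k) • ψ k
    have hx : ∀ u, x u = 1 - ∑ k, (1 - s k) * ψ k u := fun u => by
      simp [x, ContinuousMap.sum_apply]
    have hxn : ‖x‖ ≤ 1 := by
      rw [ContinuousMap.norm_le _ zero_le_one]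
      intro u
      rw [hx, Real.norm_eq_abs, abs_le]
      have h1 : 0 ≤ ∑ k, (1 - s k) * ψ k u := Finset.sum_nonneg fun k _ =>
        mul_nonneg (by simp only [s]; split_ifs <;> norm_num) (hψ0 k u)
      have h2 : ∑ k, (1 - s k) * ψ k u ≤ ∑ k, 2 * ψ k u := Finset.sum_le_sum fun k _ =>
        mul_le_mul_of_nonneg_right (by simp only [s]; split_ifs <;> norm_num) (hψ0 k u)
      rw [← Finset.mul_sum] at h2
      constructor <;> linarith [hψ1 u]
    have hLx : ∀ k, L k x = 1 - (1 - s k) * r := by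
      intro k
      simp only [x, map_sub, map_sum, map_smul, hL1, smul_eq_mul]
      rw [Finset.sum_eq_single k (fun l _ hl => by rw [hLψ' l k hl, mul_zero]) (by simp), hLψ]
    have hPx : P x t = 1 - ∑ k, w k * L k x * (a ⬝ᵥ v k) := by
      rw [← sum_momentMap_mul, hP]
      simp [ContinuousMap.sum_apply, hx, hψt, a]
    have h1 : ∑ k, w k * L k x * (a ⬝ᵥ v k) ≤ -m + 2 * (1 - r) * m := by
      have : -m + 2 * (1 - r) * m = ∑ k, (-1 + 2 * (1 - r)) * (w k * |a ⬝ᵥ v k|) := by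
        rw [← Finset.mul_sum]
        change _ = (-1 + 2 * (1 - r)) * m
        ring
      rw [this]
      refine Finset.sum_le_sum fun k _ => ?_
      rw [hLx, mul_assoc, mul_left_comm (-1 + 2 * (1 - r))]
      refine mul_le_mul_of_nonneg_left ?_ (hw k)
      by_cases h : 0 ≤ a ⬝ᵥ v k
      · simp only [s, h, if_true, abs_of_nonneg h]
        nlinarith
      · simp only [s, h, if_false, abs_of_neg (not_le.mp h)]
        nlinarith [not_le.mp h]
    have h2 : P x t ≤ ‖P‖ := calc
      P x t ≤ ‖P x‖ := (P x).apply_le_norm t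
      _ ≤ ‖P‖ * ‖x‖ := P.le_opNorm x
      _ ≤ ‖P‖ := (mul_le_mul_of_nonneg_left hxn P.opNorm_nonneg).trans_eq (mul_one _)
    linarith
  refine le_of_forall_pos_lt_add fun ε hε => ?_
  have hd : 0 < 2 * m + ε + 1 := by linarith
  have hq : ε / (2 * m + ε + 1) < 1 := by rw [div_lt_one hd]; linarith
  have hq0 : 0 < ε / (2 * m + ε + 1) := div_pos hε hd
  have := key (1 - ε / (2 * m + ε + 1)) (by linarith) (by linarith)
  have h3 : 2 * (ε / (2 * m + ε + 1)) * m < ε := by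
    rw [mul_comm 2, mul_assoc, div_mul_eq_mul_div, div_lt_iff₀ hd]
    nlinarith
  linarith

variable [DecidableEq ι]

lemma exists_isProjectionOnto_ker_momentMap [CompactSpace X] (hw : ∀ k, 0 ≤ w k)
    (hL : ∀ k x, |L k x| ≤ ‖x‖) (f : ι → C(X, ℝ))
    (hf : ∀ i, momentMap w v L (f i) = Pi.single i 1) {c : ℝ} (hc : 0 ≤ c)
    (hfc : ∀ t, weightedNorm w v (fun i => f i t) ≤ c) :
    ∃ P : C(X, ℝ) →L[ℝ] C(X, ℝ),
      IsProjectionOnto (LinearMap.ker (momentMap w v L).toLinearMap) P ∧ ‖P‖ ≤ 1 + c := by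
  let P : C(X, ℝ) →L[ℝ] C(X, ℝ) := ContinuousLinearMap.id ℝ _ -
    ∑ i, ((ContinuousLinearMap.proj i).comp (momentMap w v L)).smulRight (f i)
  have hP : ∀ x, P x = x - ∑ i, momentMap w v L x i • f i := fun x => by
    simp [P]
  refine ⟨P, ⟨fun x => ?_, fun e he => ?_⟩, ?_⟩
  · have : ∑ i, momentMap w v L x i • (Pi.single i 1 : ι → ℝ) = momentMap w v L x := by
      ext j
      simp [Finset.sum_apply, Pi.single_apply]
    simp [hP, map_sub, map_sum, map_smul, hf, this]
  · have he' : momentMap w v L e = 0 := he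
    simp [hP, he']
  · refine P.opNorm_le_bound (by linarith) fun x => ?_
    rw [ContinuousMap.norm_le _ (by positivity)]
    intro t
    have h1 : P x t = x t - ∑ k, w k * L k x * ((fun i => f i t) ⬝ᵥ v k) := by
      rw [← sum_momentMap_mul, hP]
      simp [ContinuousMap.sum_apply]
    rw [h1, Real.norm_eq_abs]
    have h2 : |x t| ≤ ‖x‖ := x.norm_coe_le_norm t
    have h3 : |∑ k, w k * L k x * ((fun i => f i t) ⬝ᵥ v k)| ≤ c * ‖x‖ := by
      calc |∑ k, w k * L k x * ((fun i => f i t) ⬝ᵥ v k)|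
          ≤ ∑ k, |w k * L k x * ((fun i => f i t) ⬝ᵥ v k)| := Finset.abs_sum_le_sum_abs _ _
        _ ≤ ∑ k, w k * |(fun i => f i t) ⬝ᵥ v k| * ‖x‖ := by
            refine Finset.sum_le_sum fun k _ => ?_
            rw [abs_mul, abs_mul, abs_of_nonneg (hw k), mul_right_comm]
            exact mul_le_mul_of_nonneg_left (hL k x) (mul_nonneg (hw k) (abs_nonneg _))
        _ ≤ c * ‖x‖ := by
            rw [← Finset.sum_mul]
            exact mul_le_mul_of_nonneg_right (hfc t) (norm_nonneg _)
    have := abs_sub (x t) (∑ k, w k * L k x * ((fun i => f i t) ⬝ᵥ v k))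
    linarith

lemma IsProjectionOnto.exists_eq_sub_sum [CompactSpace X] {P : C(X, ℝ) →L[ℝ] C(X, ℝ)}
    (hP : IsProjectionOnto (LinearMap.ker (momentMap w v L).toLinearMap) P)
    (hsurj : Function.Surjective (momentMap w v L)) :
    ∃ f : ι → C(X, ℝ), (∀ i, momentMap w v L (f i) = Pi.single i 1) ∧
      ∀ x, P x = x - ∑ i, momentMap w v L x i • f i := by
  choose g hg using fun i => hsurj (Pi.single i 1)
  have hPker : ∀ x, momentMap w v L (P x) = 0 := hP.1
  refine ⟨fun i => g i - P (g i), fun i => by simp [hg, hPker], fun x => ?_⟩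
  have hsum : ∑ i, momentMap w v L x i • (Pi.single i 1 : ι → ℝ) = momentMap w v L x := by
    ext j
    simp [Finset.sum_apply, Pi.single_apply]
  have := hP.2 (x - ∑ i, momentMap w v L x i • g i) (by
    simp [map_sub, map_sum, map_smul, hg, hsum])
  simp only [map_sub, map_sum, map_smul] at this
  simp only [smul_sub, Finset.sum_sub_distrib]
  rw [← sub_eq_zero] at this ⊢
  rw [← this]
  abel

lemma sum_mul_momentMap_trace {f : ι → C(X, ℝ)}
    (hf : ∀ i, momentMap w v L (f i) = Pi.single i 1) :
    ∑ k, w k * L k (∑ i, v k i • f i) = Fintype.card ι := by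
  have h : ∀ i, ∑ k, w k * L k (f i) * v k i = 1 := fun i => by
    rw [← momentMap_apply, hf, Pi.single_eq_same]
  calc ∑ k, w k * L k (∑ i, v k i • f i) = ∑ k, ∑ i, w k * L k (f i) * v k i := by
        refine Finset.sum_congr rfl fun k _ => ?_
        simp only [map_sum, map_smul, smul_eq_mul, Finset.mul_sum]
        exact Finset.sum_congr rfl fun i _ => by ring
    _ = ∑ i, (1 : ℝ) := by
        rw [Finset.sum_comm]
        exact Finset.sum_congr rfl fun i _ => h i
    _ = Fintype.card ι := by simp

variable {φ : K → ι → ℝ} {lam : ℝ}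

lemma sum_mul_dotProduct_eq
    (hφ : ∀ i, ∑ k, (w k * φ k i) • v k = Pi.single i lam⁻¹) :
    ∑ k, w k * (φ k ⬝ᵥ v k) = Fintype.card ι * lam⁻¹ := by
  have h : ∀ i, ∑ k, w k * φ k i * v k i = lam⁻¹ := fun i => by
    simpa [Finset.sum_apply] using congrFun (hφ i) i
  simp only [dotProduct, Finset.mul_sum, ← mul_assoc]
  rw [Finset.sum_comm, Finset.sum_congr rfl fun i _ => h i]
  simp

lemma exists_dual_momentMap [Nonempty X] (hw : ∀ k, 0 ≤ w k) (hb : HasBumps L) (hlam : 0 < lam)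
    (hφ1 : ∀ k, weightedNorm w v (φ k) ≤ 1)
    (hφ : ∀ i, ∑ k, (w k * φ k i) • v k = Pi.single i lam⁻¹) {r : ℝ} (hr0 : 0 < r)
    (hr1 : r < 1) :
    ∃ f : ι → C(X, ℝ), (∀ i, momentMap w v L (f i) = Pi.single i 1) ∧
      ∀ t, weightedNorm w v (fun i => f i t) ≤ lam / r := by
  obtain ⟨ψ, hψ0, hψ1, -, hLψ, hLψ'⟩ := hb (Classical.arbitrary X) r hr0 hr1
  refine ⟨fun i => ∑ k, (lam / r * φ k i) • ψ k, fun i => ?_, fun t => ?_⟩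
  · ext j
    have hL : ∀ l, L l (∑ k, (lam / r * φ k i) • ψ k) = lam * φ l i := fun l => by
      simp only [map_sum, map_smul, smul_eq_mul]
      rw [Finset.sum_eq_single l (fun k _ hk => by rw [hLψ' k l hk, mul_zero]) (by simp), hLψ]
      field_simp
    have := congrFun (hφ i) j
    simp only [Finset.sum_apply, Pi.smul_apply, smul_eq_mul] at this
    simp only [momentMap_apply, hL]
    calc ∑ k, w k * (lam * φ k i) * v k j = lam * ∑ k, w k * φ k i * v k j := by
          rw [Finset.mul_sum]
          exact Finset.sum_congr rfl fun k _ => by ring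
      _ = _ := by
          rw [this]
          by_cases hij : j = i
          · subst hij; simp [hlam.ne']
          · simp [Pi.single_eq_of_ne hij]
  · have hc : 0 ≤ lam / r := by positivity
    calc weightedNorm w v (fun i => (∑ k, (lam / r * φ k i) • ψ k) t)
        ≤ ∑ k, w k * ∑ l, lam / r * ψ l t * |φ l ⬝ᵥ v k| := by
          refine Finset.sum_le_sum fun k _ => mul_le_mul_of_nonneg_left ?_ (hw k)
          have : (fun i => (∑ k, (lam / r * φ k i) • ψ k) t) ⬝ᵥ v k
              = ∑ l, lam / r * ψ l t * (φ l ⬝ᵥ v k) := by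
            simp only [dotProduct, ContinuousMap.sum_apply, ContinuousMap.smul_apply,
              smul_eq_mul, Finset.sum_mul, Finset.mul_sum]
            rw [Finset.sum_comm]
            exact Finset.sum_congr rfl fun l _ => Finset.sum_congr rfl fun i _ => by ring
          rw [this]
          refine (Finset.abs_sum_le_sum_abs _ _).trans_eq (Finset.sum_congr rfl fun l _ => ?_)
          rw [abs_mul, abs_of_nonneg (mul_nonneg hc (hψ0 l t))]
      _ = ∑ l, lam / r * ψ l t * weightedNorm w v (φ l) := by
          simp only [weightedNorm, Finset.mul_sum]
          rw [Finset.sum_comm]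
          exact Finset.sum_congr rfl fun l _ => Finset.sum_congr rfl fun i _ => by ring
      _ ≤ ∑ l, lam / r * ψ l t := Finset.sum_le_sum fun l _ =>
          mul_le_of_le_one_right (mul_nonneg hc (hψ0 l t)) (hφ1 l)
      _ ≤ lam / r := by
          rw [← Finset.mul_sum]
          exact mul_le_of_le_one_right hc (hψ1 t)

lemma surjective_of_dual {f : ι → C(X, ℝ)}
    (hf : ∀ i, momentMap w v L (f i) = Pi.single i 1) :
    Function.Surjective (momentMap w v L) := fun y => by
  refine ⟨∑ i, y i • f i, ?_⟩
  ext j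
  simp [map_sum, map_smul, hf, Finset.sum_apply, Pi.single_apply]

lemma le_of_weightedNorm_le [Nonempty ι] (hw : ∀ k, 0 ≤ w k) (hL1 : ∀ k, L k 1 = 1)
    (hLmono : ∀ k x, (∀ t, 0 ≤ x t) → 0 ≤ L k x) (hlam : 0 < lam)
    (hφ : ∀ i, ∑ k, (w k * φ k i) • v k = Pi.single i lam⁻¹)
    (hdual : ∀ a k, a ⬝ᵥ v k ≤ (φ k ⬝ᵥ v k) * weightedNorm w v a)
    (hpos : ∀ k, 0 ≤ φ k ⬝ᵥ v k)
    {f : ι → C(X, ℝ)} (hf : ∀ i, momentMap w v L (f i) = Pi.single i 1)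
    {c : ℝ} (hc : ∀ t, weightedNorm w v (fun i => f i t) ≤ c) :
    lam ≤ c ∧ (c = lam → ∀ k, 0 < w k →
      L k ((lam * (φ k ⬝ᵥ v k)) • 1 - ∑ i, v k i • f i) = 0) := by
  have hn : (0 : ℝ) < Fintype.card ι := by exact_mod_cast Fintype.card_pos
  have hval : ∀ k t, (∑ i, v k i • f i : C(X, ℝ)) t = (fun i => f i t) ⬝ᵥ v k := fun k t => by
    simp only [ContinuousMap.sum_apply, ContinuousMap.smul_apply, smul_eq_mul, dotProduct]
    exact Finset.sum_congr rfl fun i _ => mul_comm _ _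
  have hnonneg : ∀ k, 0 ≤ L k ((c * (φ k ⬝ᵥ v k)) • 1 - ∑ i, v k i • f i) := by
    refine fun k => hLmono k _ fun t => ?_
    rw [ContinuousMap.sub_apply, hval, sub_nonneg]
    simp only [ContinuousMap.smul_apply, ContinuousMap.one_apply, smul_eq_mul, mul_one]
    calc _ ≤ _ := hdual _ k
      _ ≤ (φ k ⬝ᵥ v k) * c := mul_le_mul_of_nonneg_left (hc t) (hpos k)
      _ = _ := mul_comm _ _
  have hsum : ∑ k, w k * L k ((c * (φ k ⬝ᵥ v k)) • 1 - ∑ i, v k i • f i)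
      = (c * lam⁻¹ - 1) * Fintype.card ι := by
    have : ∀ k, w k * L k ((c * (φ k ⬝ᵥ v k)) • 1 - ∑ i, v k i • f i)
        = c * (w k * (φ k ⬝ᵥ v k)) - w k * L k (∑ i, v k i • f i) := fun k => by
      rw [map_sub, map_smul, hL1, smul_eq_mul]
      ring
    rw [Finset.sum_congr rfl fun k _ => this k, Finset.sum_sub_distrib, ← Finset.mul_sum,
      sum_mul_dotProduct_eq hφ, sum_mul_momentMap_trace hf]
    ring
  have hterm : ∀ k ∈ Finset.univ,
      0 ≤ w k * L k ((c * (φ k ⬝ᵥ v k)) • 1 - ∑ i, v k i • f i) := fun k _ =>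
    mul_nonneg (hw k) (hnonneg k)
  refine ⟨?_, fun hcl k hk => ?_⟩
  · have := Finset.sum_nonneg hterm
    rw [hsum] at this
    have h1 := nonneg_of_mul_nonneg_left this hn
    rw [sub_nonneg, ← div_eq_mul_inv, le_div_iff₀ hlam, one_mul] at h1
    exact h1
  · subst hcl
    rw [mul_inv_cancel₀ hlam.ne', sub_self, zero_mul] at hsum
    have := (Finset.sum_eq_zero_iff_of_nonneg hterm).1 hsum k (Finset.mem_univ k)
    exact (mul_eq_zero.1 this).resolve_left hk.ne'

end Moments

section Integration

variable {X : Type*} [TopologicalSpace X] [CompactSpace X] [MeasurableSpace X] [BorelSpace X]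

lemma ContinuousMap.integrable_of_compactSpace (ν : Measure X) [IsFiniteMeasure ν]
    (f : C(X, ℝ)) : Integrable f ν :=
  f.continuous.integrable_of_hasCompactSupport (HasCompactSupport.of_compactSpace f)

/-- Integration against a probability measure, as a continuous functional on `C(X, ℝ)`. -/
def integralFunctional (ν : Measure X) [IsProbabilityMeasure ν] : C(X, ℝ) →L[ℝ] ℝ :=
  LinearMap.mkContinuous
    { toFun := fun x => ∫ t, x t ∂ν
      map_add' := fun x y =>
        integral_add (x.integrable_of_compactSpace ν) (y.integrable_of_compactSpace ν)
      map_smul' := fun c x => integral_const_mul c _ } 1 fun x => by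
    simpa using norm_integral_le_of_norm_le_const (μ := ν)
      (Filter.Eventually.of_forall fun t => x.norm_coe_le_norm t)

lemma integralFunctional_apply (ν : Measure X) [IsProbabilityMeasure ν] (x : C(X, ℝ)) :
    integralFunctional ν x = ∫ t, x t ∂ν := rfl

lemma abs_integralFunctional_le (ν : Measure X) [IsProbabilityMeasure ν] (x : C(X, ℝ)) :
    |integralFunctional ν x| ≤ ‖x‖ := by
  simpa [integralFunctional_apply] using norm_integral_le_of_norm_le_const (μ := ν)
      (Filter.Eventually.of_forall fun t => x.norm_coe_le_norm t)

variable [T2Space X]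

lemma exists_continuousMap_integral_eq (ν : Measure X) [IsProbabilityMeasure ν] [ν.Regular]
    {U : Set X} (hU : IsOpen U) (hνU : ν Uᶜ = 0) {r : ℝ} (hr0 : 0 < r) (hr1 : r < 1) :
    ∃ ψ : C(X, ℝ), (∀ t, 0 ≤ ψ t) ∧ (∀ t, ψ t ≤ 1) ∧ (∀ t ∉ U, ψ t = 0) ∧ ∫ t, ψ t ∂ν = r := by
  have hνU1 : ν U = 1 := (prob_compl_eq_zero_iff hU.measurableSet).1 hνU
  obtain ⟨C, hCU, hC, hrC⟩ := hU.exists_lt_isCompact (μ := ν) (r := ENNReal.ofReal r) (by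
    rw [hνU1]
    exact ENNReal.ofReal_lt_one.2 hr1)
  obtain ⟨g, hg0, hg1, hg⟩ := exists_continuous_zero_one_of_isCompact' hC hU.isClosed_compl
    (Set.disjoint_compl_right_iff_subset.2 hCU)
  have hrg : r ≤ ∫ t, g t ∂ν := by
    have h1 : r ≤ ν.real C := (ENNReal.ofReal_le_iff_le_toReal (measure_ne_top _ _)).1 hrC.le
    refine h1.trans ?_
    rw [← integral_indicator_one hC.measurableSet]
    refine integral_mono ((integrable_const 1).indicator hC.measurableSet)
      (g.integrable_of_compactSpace ν) fun t => ?_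
    by_cases ht : t ∈ C
    · simp [ht, hg1 ht]
    · simp [ht, (hg t).1]
  have hpos : 0 < ∫ t, g t ∂ν := hr0.trans_le hrg
  refine ⟨(r / ∫ t, g t ∂ν) • g, fun t => ?_, fun t => ?_, fun t ht => ?_, ?_⟩
  · exact mul_nonneg (by positivity) (hg t).1
  · exact mul_le_one₀ ((div_le_one hpos).2 hrg) (hg t).1 (hg t).2
  · simp [hg0 ht]
  · simp only [ContinuousMap.smul_apply, smul_eq_mul]
    rw [integral_const_mul, div_mul_cancel₀ _ hpos.ne']

lemma hasBumps_integralFunctional {K : Type*} [Fintype K] (ν : K → Measure X)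
    [∀ k, IsProbabilityMeasure (ν k)] [∀ k, (ν k).Regular] [∀ k, NullSingletonClass (ν k)]
    {A : K → Set X} (hA : ∀ k, IsOpen (A k)) (hdisj : Pairwise (Function.onFun Disjoint A))
    (hνA : ∀ k, ν k (A k)ᶜ = 0) :
    HasBumps fun k => integralFunctional (ν k) := by
  intro t r hr0 hr1
  choose ψ hψ0 hψ1 hψA hψ using fun k => exists_continuousMap_integral_eq (ν k)
    (U := A k \ {t}) ((hA k).sdiff isClosed_singleton) (by
      rw [Set.compl_sdiff]
      exact measure_union_null (measure_singleton t) (hνA k)) hr0 hr1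
  refine ⟨ψ, hψ0, fun s => ?_, fun k => hψA k t (by simp), hψ, fun k l hkl => ?_⟩
  · by_cases h : ∃ k, s ∈ A k
    · obtain ⟨k, hk⟩ := h
      rw [Finset.sum_eq_single k (fun l _ hl => hψA l s fun hs =>
        Set.disjoint_left.1 (hdisj hl) hs.1 hk) (by simp)]
      exact hψ1 k s
    · push Not at h
      rw [Finset.sum_eq_zero fun k _ => hψA k s fun hs => h k hs.1]
      exact zero_le_one
  · rw [integralFunctional_apply]
    refine integral_eq_zero_of_ae ?_
    have : ∀ᵐ s ∂ν l, s ∈ A l := hνA l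
    filter_upwards [this] with s hs
    exact hψA k s fun hs' => Set.disjoint_left.1 (hdisj hkl) hs'.1 hs

end Integration

section UnitInterval

instance : (volume : Measure unitInterval).IsOpenPosMeasure where
  open_pos := by
    rintro _ ⟨V, hV, rfl⟩ ⟨x, hx⟩
    rw [unitInterval.volume_apply, Subtype.image_preimage_coe]
    have hcl : (x : ℝ) ∈ closure (Set.Ioo (0 : ℝ) 1) := by
      rw [closure_Ioo zero_ne_one]
      exact x.2
    have hne : (V ∩ Set.Ioo 0 1).Nonempty := mem_closure_iff.1 hcl V hV hx
    have hpos := (hV.inter isOpen_Ioo).measure_pos volume hne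
    refine (hpos.trans_le (measure_mono ?_)).ne'
    exact fun y hy => ⟨Set.Ioo_subset_Icc_self hy.2, hy.1⟩

lemma exists_nat_embedding_zero_one {K : Type*} [Fintype K] {k₀ k₁ : K} (h : k₀ ≠ k₁) :
    ∃ e : K → ℕ, Function.Injective e ∧ e k₀ = 0 ∧ e k₁ = 1 := by
  classical
  let e : K → ℕ := fun k => Fintype.equivFin K k
  have he : Function.Injective e := Fin.val_injective.comp (Fintype.equivFin K).injective
  have h01 : (Equiv.swap (e k₀) 0) (e k₁) ≠ 0 := fun h' => by
    have : (Equiv.swap (e k₀) 0) (e k₁) = (Equiv.swap (e k₀) 0) (e k₀) := by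
      rw [h', Equiv.swap_apply_left]
    exact h (he ((Equiv.injective _) this)).symm
  refine ⟨fun k => Equiv.swap (Equiv.swap (e k₀) 0 (e k₁)) 1 (Equiv.swap (e k₀) 0 (e k)),
    fun a b hab => he ((Equiv.injective _) ((Equiv.injective _) hab)), ?_, ?_⟩
  · simp only [Equiv.swap_apply_left]
    exact Equiv.swap_apply_of_ne_of_ne h01.symm zero_ne_one
  · simp

lemma exists_open_family {K : Type*} [Fintype K] {k₀ k₁ : K} (h : k₀ ≠ k₁) :
    ∃ A : K → Set unitInterval, (∀ k, IsOpen (A k)) ∧ (∀ k, (A k).Nonempty) ∧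
      Pairwise (Function.onFun Disjoint A) ∧ ∃ t, t ∈ closure (A k₀) ∧ t ∈ closure (A k₁) := by
  obtain ⟨e, he, he0, he1⟩ := exists_nat_embedding_zero_one h
  let u : ℕ → unitInterval := fun j => ⟨1 / ((j : ℝ) + 1), by positivity, by
    rw [div_le_one (by positivity)]
    linarith [j.cast_nonneg (α := ℝ)]⟩
  have hu : StrictAnti u := strictAnti_nat_of_succ_lt fun j => by
    rw [← Subtype.coe_lt_coe]
    exact one_div_lt_one_div_of_lt (by positivity) (by push_cast; linarith)
  have hlt : ∀ j, u (j + 1) < u j := fun j => hu j.lt_succ_self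
  refine ⟨fun k => Set.Ioo (u (e k + 1)) (u (e k)), fun k => isOpen_Ioo,
    fun k => Set.nonempty_Ioo.2 (hlt _), fun k l hkl => ?_, u 1, ?_, ?_⟩
  · exact hu.antitone.pairwise_disjoint_on_Ioo_succ (he.ne hkl)
  · simp only [he0]
    rw [closure_Ioo (hlt 0).ne]
    exact ⟨le_rfl, (hlt 0).le⟩
  · simp only [he1]
    rw [closure_Ioo (hlt 1).ne]
    exact ⟨(hlt 1).le, le_rfl⟩

theorem exists_subspace_projConst_not_attained {K ι : Type*} [Fintype K] [Fintype ι] [Nonempty ι]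
    [DecidableEq ι] {w : K → ℝ} {v φ : K → ι → ℝ} {lam : ℝ} (hw : ∀ k, 0 ≤ w k) (hlam : 0 < lam)
    (hφ1 : ∀ k, weightedNorm w v (φ k) ≤ 1)
    (hφ : ∀ i, ∑ k, (w k * φ k i) • v k = Pi.single i lam⁻¹)
    (hdual : ∀ a k, a ⬝ᵥ v k ≤ (φ k ⬝ᵥ v k) * weightedNorm w v a)
    (hpos : ∀ k, 0 ≤ φ k ⬝ᵥ v k) {k₀ k₁ : K} (hne : φ k₀ ≠ φ k₁)
    (hw₀ : 0 < w k₀) (hw₁ : 0 < w k₁)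
    (huniq : ∀ k, k = k₀ ∨ k = k₁ → ∀ a, weightedNorm w v a ≤ lam →
      a ⬝ᵥ v k = lam * (φ k ⬝ᵥ v k) → a = lam • φ k) :
    ∃ Y : Submodule ℝ C(unitInterval, ℝ),
      IsClosed (Y : Set C(unitInterval, ℝ)) ∧
      Module.finrank ℝ (C(unitInterval, ℝ) ⧸ Y) = Fintype.card ι ∧
      projConst (𝕜 := ℝ) (F := C(unitInterval, ℝ)) Y = 1 + lam ∧
      ¬∃ P : C(unitInterval, ℝ) →L[ℝ] C(unitInterval, ℝ),
        IsProjectionOnto (𝕜 := ℝ) (F := C(unitInterval, ℝ)) Y P ∧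
        ‖P‖ = projConst (𝕜 := ℝ) (F := C(unitInterval, ℝ)) Y := by
  obtain ⟨A, hA, hAne, hdisj, t₀, ht₀, ht₁⟩ :=
    exists_open_family (k₀ := k₀) (k₁ := k₁) fun h => hne (h ▸ rfl)
  have hvol : ∀ k, volume (A k) ≠ 0 := fun k => ((hA k).measure_pos volume (hAne k)).ne'
  let ν : K → Measure unitInterval := fun k => ProbabilityTheory.cond volume (A k)
  have hprob : ∀ k, IsProbabilityMeasure (ν k) := fun k =>
    ProbabilityTheory.cond_isProbabilityMeasure (hvol k)
  have hatom : ∀ k, NullSingletonClass (ν k) := fun k =>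
    ⟨fun x => ProbabilityTheory.cond_absolutelyContinuous (measure_singleton x)⟩
  have hνA : ∀ k, ν k (A k)ᶜ = 0 := fun k => by
    simp [ν, ProbabilityTheory.cond_apply (hA k).measurableSet]
  let L : K → C(unitInterval, ℝ) →L[ℝ] ℝ := fun k => integralFunctional (ν k)
  have hL : ∀ k x, |L k x| ≤ ‖x‖ := fun k x => abs_integralFunctional_le _ x
  have hL1 : ∀ k, L k 1 = 1 := fun k => by simp [L, integralFunctional_apply]
  have hLmono : ∀ k x, (∀ t, 0 ≤ x t) → 0 ≤ L k x := fun k x hx => integral_nonneg hx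
  have hLzero : ∀ k x, (∀ t, 0 ≤ x t) → L k x = 0 → ∀ t ∈ A k, x t = 0 := by
    intro k x hx h0
    have h1 := (integral_eq_zero_iff_of_nonneg hx (x.integrable_of_compactSpace (ν k))).1 h0
    have h2 : x =ᵐ[volume.restrict (A k)] (0 : unitInterval → ℝ) := by
      refine Measure.AbsolutelyContinuous.ae_le ?_ h1
      exact Measure.absolutelyContinuous_smul (ENNReal.inv_ne_zero.2 (measure_ne_top _ _))
    exact Measure.eqOn_open_of_ae_eq h2 (hA k) x.continuous.continuousOn continuousOn_const
  have hb : HasBumps L := hasBumps_integralFunctional ν hA hdisj hνA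
  obtain ⟨f₀, hf₀, -⟩ := exists_dual_momentMap hw hb hlam hφ1 hφ one_half_pos one_half_lt_one
  have hsurj := surjective_of_dual hf₀
  set T := momentMap w v L
  have hlower : ∀ P, IsProjectionOnto (LinearMap.ker T.toLinearMap) P → 1 + lam ≤ ‖P‖ := by
    intro P hP
    obtain ⟨f, hf, hPf⟩ := hP.exists_eq_sub_sum hsurj
    have hc : ∀ t, weightedNorm w v (fun i => f i t) ≤ ‖P‖ - 1 := fun t => by
      linarith [one_add_weightedNorm_le_norm hw hL1 hb hPf t]
    linarith [(le_of_weightedNorm_le hw hL1 hLmono hlam hφ hdual hpos hf hc).1]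
  have hupper : ∀ r : ℝ, 0 < r → r < 1 → ∃ P, IsProjectionOnto (LinearMap.ker T.toLinearMap) P ∧
      ‖P‖ ≤ 1 + lam / r := by
    intro r hr0 hr1
    obtain ⟨f, hf, hfn⟩ := exists_dual_momentMap hw hb hlam hφ1 hφ hr0 hr1
    exact exists_isProjectionOnto_ker_momentMap hw hL f hf (by positivity) hfn
  have hconst : projConst (LinearMap.ker T.toLinearMap) = 1 + lam := by
    unfold projConst
    apply le_antisymm
    · refine le_of_forall_gt_imp_ge_of_dense fun c hc => ?_
      have hc' : lam < c - 1 := by linarith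
      have hc0 : 0 < c - 1 := hlam.trans hc'
      obtain ⟨P, hP, hPn⟩ := hupper (lam / (c - 1)) (div_pos hlam hc0) ((div_lt_one hc0).2 hc')
      rw [div_div_cancel₀ hlam.ne'] at hPn
      refine le_trans (csInf_le ⟨1 + lam, ?_⟩ ⟨P, hP, rfl⟩) (hPn.trans_eq (by ring))
      rintro _ ⟨Q, hQ, rfl⟩
      exact hlower Q hQ
    · obtain ⟨P, hP, -⟩ := hupper (1 / 2) one_half_pos one_half_lt_one
      refine le_csInf ⟨_, P, hP, rfl⟩ ?_
      rintro _ ⟨Q, hQ, rfl⟩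
      exact hlower Q hQ
  refine ⟨LinearMap.ker T.toLinearMap, T.isClosed_ker, ?_, hconst, ?_⟩
  · rw [(T.toLinearMap.quotKerEquivOfSurjective hsurj).finrank_eq,
      Module.finrank_fintype_fun_eq_card]
  · rintro ⟨P, hP, hPn⟩
    rw [hconst] at hPn
    obtain ⟨f, hf, hPf⟩ := hP.exists_eq_sub_sum hsurj
    have hc : ∀ t, weightedNorm w v (fun i => f i t) ≤ lam := fun t => by
      linarith [one_add_weightedNorm_le_norm hw hL1 hb hPf t]
    have hzero := (le_of_weightedNorm_le hw hL1 hLmono hlam hφ hdual hpos hf hc).2 rfl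
    have hval : ∀ k t, ((lam * (φ k ⬝ᵥ v k)) • 1 - ∑ i, v k i • f i : C(unitInterval, ℝ)) t
        = lam * (φ k ⬝ᵥ v k) - (fun i => f i t) ⬝ᵥ v k := fun k t => by
      simp [ContinuousMap.sum_apply, dotProduct, mul_comm]
    have heq : ∀ k, k = k₀ ∨ k = k₁ → Set.EqOn (fun t i => f i t) (fun _ => lam • φ k) (A k) := by
      intro k hk t ht
      have hwk : 0 < w k := by rcases hk with rfl | rfl <;> assumption
      refine huniq k hk _ (hc t) ?_
      have := hLzero k _ (fun t => ?_) (hzero k hwk) t ht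
      · rw [hval] at this
        linarith
      · rw [hval, sub_nonneg, mul_comm lam]
        exact (hdual _ k).trans (mul_le_mul_of_nonneg_left (hc t) (hpos k))
    have hcont : Continuous fun t i => f i t := continuous_pi fun i => (f i).continuous
    have e₀ := (heq k₀ (Or.inl rfl)).closure hcont continuous_const ht₀
    have e₁ := (heq k₁ (Or.inr rfl)).closure hcont continuous_const ht₁
    exact hne (smul_right_injective _ hlam.ne' (e₀.symm.trans e₁))

end UnitInterval

section Rademacher

variable {ι : Type*}

/-- The real sign vector of an element of `{-1, 1}^ι`. -/
def signVec (ω : ι → ℤˣ) (i : ι) : ℝ := ((ω i : ℤ) : ℝ)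

lemma signVec_mul (ω η : ι → ℤˣ) : signVec (ω * η) = signVec ω * signVec η := by
  ext i
  simp [signVec]

lemma signVec_mul_self (ω : ι → ℤˣ) (i : ι) : signVec ω i * signVec ω i = 1 := by
  rcases Int.units_eq_one_or (ω i) with h | h <;> simp [signVec, h]

lemma abs_signVec (ω : ι → ℤˣ) (i : ι) : |signVec ω i| = 1 := by
  rcases Int.units_eq_one_or (ω i) with h | h <;> simp [signVec, h]

variable [Fintype ι]

lemma mul_dotProduct_signVec (a : ι → ℝ) (ω η : ι → ℤˣ) :
    (a * signVec ω) ⬝ᵥ signVec η = a ⬝ᵥ signVec (ω * η) := by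
  simp [signVec_mul, dotProduct, mul_assoc]

lemma dotProduct_signVec_le_sum_abs (a : ι → ℝ) (ω : ι → ℤˣ) :
    a ⬝ᵥ signVec ω ≤ ∑ i, |a i| :=
  Finset.sum_le_sum fun i _ => (le_abs_self _).trans_eq (by rw [abs_mul, abs_signVec, mul_one])

variable [DecidableEq ι]

/-- The unnormalised Rademacher norm `a ↦ ∑ ω, |⟨a, ω⟩|`. -/
def rademacherSum (a : ι → ℝ) : ℝ := ∑ ω : ι → ℤˣ, |a ⬝ᵥ signVec ω|

lemma rademacherSum_mul_signVec (a : ι → ℝ) (ω : ι → ℤˣ) :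
    rademacherSum (a * signVec ω) = rademacherSum a := by
  simp only [rademacherSum, mul_dotProduct_signVec]
  exact Equiv.sum_comp (Equiv.mulLeft ω) fun η => |a ⬝ᵥ signVec η|

lemma rademacherSum_signVec (ω : ι → ℤˣ) :
    rademacherSum (signVec ω) = rademacherSum (1 : ι → ℝ) := by
  rw [← rademacherSum_mul_signVec 1 ω, one_mul]

lemma sum_signVec_mul_signVec (i j : ι) :
    ∑ ω : ι → ℤˣ, signVec ω i * signVec ω j = if i = j then 2 ^ Fintype.card ι else 0 := by
  split_ifs with h
  · subst h
    simp [signVec_mul_self]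
  · have := Equiv.sum_comp (Equiv.mulLeft (Function.update (1 : ι → ℤˣ) i (-1)))
      fun ω => signVec ω i * signVec ω j
    simp only [Equiv.coe_mulLeft, signVec_mul] at this
    simp only [Pi.mul_apply, signVec, Function.update_self, Function.update_of_ne (Ne.symm h),
      Pi.one_apply, Units.val_neg, Units.val_one, Int.cast_neg, Int.cast_one, neg_mul, one_mul,
      Finset.sum_neg_distrib] at this
    simp only [signVec]
    linarith

lemma rademacherSum_single (i : ι) :
    rademacherSum (Pi.single i 1 : ι → ℝ) = 2 ^ Fintype.card ι := by
  simp [rademacherSum, abs_signVec]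

lemma two_pow_mul_le_rademacherSum (a : ι → ℝ) (i : ι) :
    2 ^ Fintype.card ι * a i ≤ rademacherSum a := by
  calc 2 ^ Fintype.card ι * a i
      = ∑ j, a j * ∑ ω : ι → ℤˣ, signVec ω i * signVec ω j := by
        simp [sum_signVec_mul_signVec, mul_comm]
    _ = ∑ ω : ι → ℤˣ, signVec ω i * (a ⬝ᵥ signVec ω) := by
        simp only [dotProduct, Finset.mul_sum]
        rw [Finset.sum_comm]
        exact Finset.sum_congr rfl fun ω _ => Finset.sum_congr rfl fun j _ => by ring
    _ ≤ rademacherSum a := Finset.sum_le_sum fun ω _ => by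
        refine (le_abs_self _).trans_eq ?_
        rw [abs_mul, abs_signVec, one_mul]

lemma sum_sign_mul_signVec_eq (i j : ι) :
    ∑ ω : ι → ℤˣ, (1 ⬝ᵥ signVec ω).sign * signVec ω i =
      ∑ ω : ι → ℤˣ, (1 ⬝ᵥ signVec ω).sign * signVec ω j := by
  rw [← (Equiv.arrowCongr (Equiv.swap i j) (Equiv.refl ℤˣ)).sum_comp]
  refine Finset.sum_congr rfl fun ω _ => ?_
  refine congrArg₂ _ (congrArg Real.sign ?_) ?_
  · simp only [one_dotProduct]
    exact (Equiv.swap i j).symm.sum_comp fun k => signVec ω k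
  · simp [signVec]

lemma rademacherSum_one_mul_sum (a : ι → ℝ) :
    rademacherSum (1 : ι → ℝ) * ∑ i, a i =
      Fintype.card ι * ∑ ω : ι → ℤˣ, (1 ⬝ᵥ signVec ω).sign * (a ⬝ᵥ signVec ω) := by
  have hc : ∀ j, rademacherSum (1 : ι → ℝ) =
      Fintype.card ι * ∑ ω : ι → ℤˣ, (1 ⬝ᵥ signVec ω).sign * signVec ω j := by
    intro j
    calc rademacherSum (1 : ι → ℝ)
        = ∑ ω : ι → ℤˣ, ∑ i, (1 ⬝ᵥ signVec ω).sign * signVec ω i := by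
          refine Finset.sum_congr rfl fun ω _ => ?_
          rw [← Finset.mul_sum, ← one_dotProduct]
          rcases lt_trichotomy (1 ⬝ᵥ signVec ω) 0 with h | h | h
          · rw [Real.sign_of_neg h, abs_of_neg h, neg_one_mul]
          · rw [h]; simp
          · rw [Real.sign_of_pos h, abs_of_pos h, one_mul]
      _ = _ := by
          rw [Finset.sum_comm, Finset.sum_congr rfl fun i _ => sum_sign_mul_signVec_eq i j]
          simp
  rw [Finset.mul_sum, Finset.sum_congr rfl fun j _ => by rw [hc j]]
  simp only [dotProduct, Finset.mul_sum, Finset.sum_mul]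
  rw [Finset.sum_comm]
  exact Finset.sum_congr rfl fun ω _ => Finset.sum_congr rfl fun i _ => by ring

lemma sign_mul_le_abs (x y : ℝ) : x.sign * y ≤ |y| := by
  rcases Real.sign_apply_eq x with h | h | h <;> rw [h] <;>
    linarith [abs_nonneg y, le_abs_self y, neg_abs_le y]

lemma rademacherSum_one_mul_dotProduct_le (a : ι → ℝ) (ω : ι → ℤˣ) :
    rademacherSum (1 : ι → ℝ) * (a ⬝ᵥ signVec ω) ≤ Fintype.card ι * rademacherSum a := by
  rw [← rademacherSum_mul_signVec a ω]
  change _ * ∑ i, (a * signVec ω) i ≤ _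
  rw [rademacherSum_one_mul_sum]
  exact mul_le_mul_of_nonneg_left (Finset.sum_le_sum fun η _ => sign_mul_le_abs _ _)
    (Nat.cast_nonneg _)

lemma eq_of_balanced_dotProduct_eq_zero (heven : Even (Fintype.card ι)) {a : ι → ℝ}
    (ha : ∀ ω : ι → ℤˣ, 1 ⬝ᵥ signVec ω = 0 → a ⬝ᵥ signVec ω = 0) (i j : ι) : a i = a j := by
  by_cases hij : i = j
  · rw [hij]
  obtain ⟨m, hm⟩ := heven
  have hdot : ∀ (b : ι → ℝ) (t : Finset ι),
      b ⬝ᵥ signVec (fun k => if k ∈ t then (1 : ℤˣ) else -1) = 2 * ∑ k ∈ t, b k - ∑ k, b k := by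
    intro b t
    have : ∑ k ∈ t, b k = ∑ k, if k ∈ t then b k else 0 := by simp
    rw [this, Finset.mul_sum, ← Finset.sum_sub_distrib]
    refine Finset.sum_congr rfl fun k _ => ?_
    by_cases hk : k ∈ t
    · simp [signVec, hk]; ring
    · simp [signVec, hk]
  have hcard : ∀ t : Finset ι, t.card = m → 2 * ∑ k ∈ t, a k = ∑ k, a k := by
    intro t ht
    have := ha (fun k => if k ∈ t then (1 : ℤˣ) else -1) (by
      rw [hdot]
      simp [ht, hm]
      ring)
    rw [hdot] at this
    linarith
  have h2 : 2 ≤ Fintype.card ι := by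
    have := Finset.card_le_univ ({i, j} : Finset ι)
    rwa [Finset.card_pair hij] at this
  obtain ⟨u, hu, huc⟩ := Finset.exists_subset_card_eq
    (s := (Finset.univ.erase i).erase j) (n := m - 1) (by
      rw [Finset.card_erase_of_mem (by simp [Ne.symm hij]),
        Finset.card_erase_of_mem (Finset.mem_univ _), Finset.card_univ]
      omega)
  have hi : i ∉ u := fun h => by simpa using hu h
  have hj : j ∉ u := fun h => by simpa using hu h
  have e1 := hcard (insert i u) (by rw [Finset.card_insert_of_notMem hi, huc]; omega)
  have e2 := hcard (insert j u) (by rw [Finset.card_insert_of_notMem hj, huc]; omega)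
  rw [Finset.sum_insert hi] at e1
  rw [Finset.sum_insert hj] at e2
  linarith

lemma mul_signVec_eq_of_rademacherSum_le [Nonempty ι] (heven : Even (Fintype.card ι))
    {a : ι → ℝ} {ω : ι → ℤˣ}
    (h : Fintype.card ι * rademacherSum a ≤ rademacherSum (1 : ι → ℝ) * (a ⬝ᵥ signVec ω))
    (i j : ι) : a i * signVec ω i = a j * signVec ω j := by
  rw [← rademacherSum_mul_signVec a ω] at h
  change _ ≤ _ * ∑ i, (a * signVec ω) i at h
  rw [rademacherSum_one_mul_sum] at h
  have hn : (0 : ℝ) < Fintype.card ι := by exact_mod_cast Fintype.card_pos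
  refine eq_of_balanced_dotProduct_eq_zero heven (a := a * signVec ω) (fun η hη => ?_) i j
  have h1 := le_of_mul_le_mul_left h hn
  have h2 := (Finset.sum_eq_sum_iff_of_le fun η _ => sign_mul_le_abs (1 ⬝ᵥ signVec η)
    ((a * signVec ω) ⬝ᵥ signVec η)).1 (le_antisymm (Finset.sum_le_sum fun η _ =>
      sign_mul_le_abs _ _) h1) η (Finset.mem_univ _)
  rw [hη, Real.sign_zero, zero_mul] at h2
  exact abs_eq_zero.1 h2.symm

end Rademacher

section Mixture

variable {ι : Type*} [Fintype ι] [DecidableEq ι]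

/-- Weights giving total mass `α` to the sign vectors and `1 - α` to each basis vector. -/
def mixtureWeight (ι : Type*) [Fintype ι] (α : ℝ) : (ι → ℤˣ) ⊕ ι → ℝ :=
  Sum.elim (fun _ => α / 2 ^ Fintype.card ι) fun _ => 1 - α

/-- The sign vectors together with the standard basis vectors. -/
def mixtureVec : (ι → ℤˣ) ⊕ ι → ι → ℝ :=
  Sum.elim signVec fun i => Pi.single i 1

lemma weightedNorm_mixture (α : ℝ) (a : ι → ℝ) :
    weightedNorm (mixtureWeight ι α) mixtureVec a =
      α * (rademacherSum a / 2 ^ Fintype.card ι) + (1 - α) * ∑ i, |a i| := by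
  simp only [weightedNorm, mixtureWeight, mixtureVec, Fintype.sum_sum_type, Sum.elim_inl,
    Sum.elim_inr, ← Finset.mul_sum, dotProduct_single, mul_one]
  rw [rademacherSum]
  ring

theorem exists_subspace_projConst_mixture [Nonempty ι] (heven : Even (Fintype.card ι))
    {α B lam : ℝ} (hα0 : 0 < α) (hα1 : α ≤ 1) (hB : 0 < B)
    (hBα : B = α * (rademacherSum (1 : ι → ℝ) / 2 ^ Fintype.card ι)
      + (1 - α) * Fintype.card ι)
    (hlam : lam⁻¹ = α / B + (1 - α)) :
    ∃ Y : Submodule ℝ C(unitInterval, ℝ),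
      IsClosed (Y : Set C(unitInterval, ℝ)) ∧
      Module.finrank ℝ (C(unitInterval, ℝ) ⧸ Y) = Fintype.card ι ∧
      projConst (𝕜 := ℝ) (F := C(unitInterval, ℝ)) Y = 1 + lam ∧
      ¬∃ P : C(unitInterval, ℝ) →L[ℝ] C(unitInterval, ℝ),
        IsProjectionOnto (𝕜 := ℝ) (F := C(unitInterval, ℝ)) Y P ∧
        ‖P‖ = projConst (𝕜 := ℝ) (F := C(unitInterval, ℝ)) Y := by
  set n : ℝ := (Fintype.card ι : ℝ) with hn
  set q : ℝ := 2 ^ Fintype.card ι with hq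
  have hq0 : 0 < q := by positivity
  have hn0 : 0 < n := by rw [hn]; exact_mod_cast Fintype.card_pos
  have hlam0 : 0 < lam := by
    rw [← inv_pos, hlam]
    have := div_pos hα0 hB
    linarith
  let φ : (ι → ℤˣ) ⊕ ι → ι → ℝ := Sum.elim (fun ω => B⁻¹ • signVec ω) fun i => Pi.single i 1
  have hφl : ∀ ω, φ (Sum.inl ω) ⬝ᵥ mixtureVec (Sum.inl ω) = B⁻¹ * n := fun ω => by
    have : signVec ω ⬝ᵥ signVec ω = n := by simp [dotProduct, signVec_mul_self, hn]
    simp only [φ, mixtureVec, Sum.elim_inl, smul_dotProduct, smul_eq_mul, this]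
  have hφr : ∀ i, φ (Sum.inr i) ⬝ᵥ mixtureVec (Sum.inr i) = 1 := fun i => by
    simp [φ, mixtureVec]
  have hrad : ∀ (a : ι → ℝ) (ω : ι → ℤˣ),
      rademacherSum (1 : ι → ℝ) / q * (a ⬝ᵥ signVec ω) ≤ n * (rademacherSum a / q) :=
    fun a ω => by
      rw [div_mul_eq_mul_div, mul_div_assoc']
      exact div_le_div_of_nonneg_right (rademacherSum_one_mul_dotProduct_le a ω) hq0.le
  refine exists_subspace_projConst_not_attained (w := mixtureWeight ι α) (v := mixtureVec) (φ := φ)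
    (k₀ := Sum.inl 1) (k₁ := Sum.inl (-1)) ?_ hlam0 ?_ ?_ ?_ ?_ ?_ ?_ ?_ ?_
  · rintro (ω | i)
    · exact div_nonneg hα0.le hq0.le
    · exact sub_nonneg.2 hα1
  · rintro (ω | i)
    · simp only [φ, Sum.elim_inl, weightedNorm_smul, weightedNorm_mixture, rademacherSum_signVec,
        abs_signVec]
      rw [abs_of_pos (inv_pos.2 hB)]
      simp only [Finset.sum_const, Finset.card_univ, nsmul_eq_mul, mul_one]
      rw [← hBα, inv_mul_cancel₀ hB.ne']
    · have : ∑ j, |(Pi.single i 1 : ι → ℝ) j| = 1 := by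
        rw [Finset.sum_eq_single i (fun j _ hj => by simp [hj]) (by simp)]
        simp
      simp only [φ, Sum.elim_inr, weightedNorm_mixture, rademacherSum_single, this]
      rw [div_self hq0.ne']
      linarith
  · intro i
    ext j
    simp only [Finset.sum_apply, Pi.smul_apply, smul_eq_mul, Fintype.sum_sum_type, φ, mixtureVec,
      mixtureWeight, Sum.elim_inl, Sum.elim_inr]
    have h1 : ∑ ω : ι → ℤˣ, α / q * (B⁻¹ * signVec ω i) * signVec ω j
        = α / q * B⁻¹ * ∑ ω : ι → ℤˣ, signVec ω i * signVec ω j := by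
      rw [Finset.mul_sum]
      exact Finset.sum_congr rfl fun ω _ => by ring
    rw [h1, sum_signVec_mul_signVec, hlam]
    by_cases hij : i = j
    · subst hij
      simp only [if_true, Pi.single_eq_same]
      rw [Finset.sum_eq_single i (fun k _ hk => by simp [Ne.symm hk]) (by simp), ← hq]
      simp only [Pi.single_eq_same, mul_one]
      field_simp
    · simp [Pi.single_apply, hij, Ne.symm hij]
  · rintro a (ω | i)
    · rw [hφl, weightedNorm_mixture]
      simp only [mixtureVec, Sum.elim_inl]
      have h1 := mul_le_mul_of_nonneg_left (hrad a ω) hα0.le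
      have h2 := mul_le_mul_of_nonneg_left (dotProduct_signVec_le_sum_abs a ω)
        (mul_nonneg (sub_nonneg.2 hα1) hn0.le)
      rw [mul_assoc, ← div_eq_inv_mul, le_div_iff₀ hB, hBα]
      linarith
    · rw [hφr, weightedNorm_mixture]
      simp only [mixtureVec, Sum.elim_inr, dotProduct_single, mul_one, one_mul]
      have h1 : a i ≤ rademacherSum a / q := by
        rw [le_div_iff₀ hq0, mul_comm]
        exact two_pow_mul_le_rademacherSum a i
      have h2 : a i ≤ ∑ j, |a j| := (le_abs_self _).trans
        (Finset.single_le_sum (f := fun j => |a j|) (fun j _ => abs_nonneg _) (Finset.mem_univ i))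
      have h3 := mul_le_mul_of_nonneg_left h1 hα0.le
      have h4 := mul_le_mul_of_nonneg_left h2 (sub_nonneg.2 hα1)
      linarith
  · rintro (ω | i)
    · rw [hφl]; positivity
    · rw [hφr]; exact zero_le_one
  · intro h
    have := congrFun h (Classical.arbitrary ι)
    simp only [φ, Sum.elim_inl, Pi.smul_apply, smul_eq_mul] at this
    have := mul_left_cancel₀ (inv_ne_zero hB.ne') this
    norm_num [signVec] at this
  · exact div_pos hα0 hq0
  · exact div_pos hα0 hq0
  · have : ∀ (ω : ι → ℤˣ) (a : ι → ℝ),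
        weightedNorm (mixtureWeight ι α) mixtureVec a ≤ lam →
        a ⬝ᵥ mixtureVec (Sum.inl ω) = lam * (φ (Sum.inl ω) ⬝ᵥ mixtureVec (Sum.inl ω)) →
        a = lam • φ (Sum.inl ω) := by
      intro ω a ha hx
      rw [hφl] at hx
      rw [weightedNorm_mixture] at ha
      simp only [mixtureVec, Sum.elim_inl] at hx
      have hBx : B * (a ⬝ᵥ signVec ω) = lam * n := by rw [hx]; field_simp
      have h2 := mul_le_mul_of_nonneg_left (dotProduct_signVec_le_sum_abs a ω)
        (mul_nonneg (sub_nonneg.2 hα1) hn0.le)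
      have h3 := mul_le_mul_of_nonneg_left ha hn0.le
      rw [hBα] at hBx
      have h4 : n * (rademacherSum a / q) ≤
          rademacherSum (1 : ι → ℝ) / q * (a ⬝ᵥ signVec ω) :=
        le_of_mul_le_mul_left (by linarith) hα0
      rw [div_mul_eq_mul_div, mul_div_assoc', div_le_div_iff_of_pos_right hq0] at h4
      have hconst := mul_signVec_eq_of_rademacherSum_le heven h4
      ext i
      have hsum : a ⬝ᵥ signVec ω = n * (a i * signVec ω i) := by
        rw [dotProduct, Finset.sum_congr rfl fun j _ => hconst j i]
        simp [hn]
      have h5 : a i * signVec ω i = lam * B⁻¹ := by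
        rw [hsum] at hx
        exact mul_left_cancel₀ hn0.ne' (by linarith)
      simp only [φ, Sum.elim_inl, Pi.smul_apply, smul_eq_mul]
      rw [← mul_assoc, ← h5, mul_assoc, signVec_mul_self, mul_one]
    rintro k (rfl | rfl)
    · exact this 1
    · exact this (-1)

lemma exists_mixture_parameter {n β l : ℝ} (hn : 0 < n) (hl : 1 < l) (hlβ : l ≤ β) :
    ∃ α, 0 < α ∧ α ≤ 1 ∧ 0 < α * β + (1 - α) * n ∧
      l⁻¹ = α / (α * β + (1 - α) * n) + (1 - α) := by
  have hβ : 0 < β := by linarith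
  have hpos : ∀ α ∈ Set.Icc (0 : ℝ) 1, 0 < α * β + (1 - α) * n := by
    rintro α ⟨h0, h1⟩
    rcases h0.eq_or_lt with rfl | h
    · simpa using hn
    · have := mul_pos h hβ
      have := mul_nonneg (sub_nonneg.2 h1) hn.le
      linarith
  have hcont : ContinuousOn (fun α : ℝ => α / (α * β + (1 - α) * n) + (1 - α)) (Set.Icc 0 1) :=
    (continuousOn_id.div (by fun_prop) fun α hα => (hpos α hα).ne').add (by fun_prop)
  obtain ⟨α, hα, h⟩ := intermediate_value_Icc' zero_le_one hcont (show l⁻¹ ∈ _ by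
    constructor
    · simpa using inv_anti₀ (by linarith) hlβ
    · simpa using inv_le_one_of_one_le₀ hl.le)
  refine ⟨α, hα.1.lt_of_ne ?_, hα.2, hpos α hα, h.symm⟩
  rintro rfl
  have := inv_lt_one_of_one_lt₀ hl
  simp at h
  linarith

lemma rademacherSum_one_eq_sum_piFinset (n : ℕ) :
    rademacherSum (1 : Fin n → ℝ) =
      ((∑ ω ∈ Fintype.piFinset fun _ : Fin n => ({-1, 1} : Finset ℤ), |∑ j, ω j| : ℤ) : ℝ) := by
  rw [rademacherSum, Int.cast_sum]
  refine Finset.sum_bij (fun ω _ i => (ω i : ℤ)) (fun ω _ => ?_) (fun ω _ η _ h => ?_)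
    (fun ω hω => ?_) fun ω _ => ?_
  · refine Fintype.mem_piFinset.2 fun i => ?_
    rcases Int.units_eq_one_or (ω i) with h | h <;> simp [h]
  · ext i
    exact congrFun h i
  · have : ∀ i, ∃ u : ℤˣ, (u : ℤ) = ω i := fun i => by
      have := Fintype.mem_piFinset.1 hω i
      rcases Finset.mem_insert.1 this with h | h
      · exact ⟨-1, by simp [h]⟩
      · exact ⟨1, by simp [Finset.mem_singleton.1 h]⟩
    choose u hu using this
    exact ⟨u, Finset.mem_univ _, funext hu⟩
  · simp [one_dotProduct, signVec]

end Mixture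

/-- Let `n ≥ 4` be even and `β_n = 2^{-n} Σ_{ω ∈ {-1,1}^n} |Σ_j ω_j|`. For every `Λ` with
`2 < Λ ≤ 1 + β_n` there is a codimension-`n` closed subspace `Y` of the real space
`C[0,1]` with `λ(Y, C[0,1]) = Λ` for which no minimal projection exists. -/
theorem exists_even_codim_subspace_projConst_not_attained
    (n : ℕ) (hn : 4 ≤ n) (heven : Even n)
    (Λ : ℝ) (h1 : 2 < Λ)
    (h2 : Λ ≤ 1 + ((∑ ω ∈ Fintype.piFinset fun _ : Fin n => ({-1, 1} : Finset ℤ),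
        |∑ j, ω j| : ℤ) : ℝ) / 2 ^ n) :
    ∃ Y : Submodule ℝ C(unitInterval, ℝ),
      IsClosed (Y : Set C(unitInterval, ℝ)) ∧
      Module.finrank ℝ (C(unitInterval, ℝ) ⧸ Y) = n ∧
      projConst (𝕜 := ℝ) (F := C(unitInterval, ℝ)) Y = Λ ∧
      ¬∃ P : C(unitInterval, ℝ) →L[ℝ] C(unitInterval, ℝ),
        IsProjectionOnto (𝕜 := ℝ) (F := C(unitInterval, ℝ)) Y P ∧
        ‖P‖ = projConst (𝕜 := ℝ) (F := C(unitInterval, ℝ)) Y := by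
  have hcast := rademacherSum_one_eq_sum_piFinset n
  rw [← hcast] at h2
  have hn0 : 0 < n := by omega
  obtain ⟨α, hα0, hα1, hB, hl⟩ := exists_mixture_parameter (n := (n : ℝ))
    (β := rademacherSum (1 : Fin n → ℝ) / 2 ^ n) (l := Λ - 1) (by exact_mod_cast hn0)
    (by linarith) (by linarith)
  have : Nonempty (Fin n) := ⟨⟨0, hn0⟩⟩
  have h := exists_subspace_projConst_mixture (ι := Fin n) (by simpa using heven) hα0 hα1 hB
    (by simp) hl
  simpa only [Fintype.card_fin, add_sub_cancel] using h
end
end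

section
/- For every real number Λ ∈ [2, ∞), there exists a closed subspace Y of finite codimension in the real Banach space C[0,1] such that λ(Y, C[0,1]) = Λ and the infimum defining λ(Y, C[0,1]) is not attained, i.e. there is no minimal projection from C[0,1] onto Y. -/
open MeasureTheory NormedSpace

noncomputable section

variable {𝕜 : Type*} [RCLike 𝕜] {F : Type*} [NormedAddCommGroup F] [NormedSpace 𝕜 F]

theorem exists_sylvester_hadamard (k : ℕ) :
    ∃ (ι : Type) (_ : Fintype ι) (_ : DecidableEq ι) (H : ι → ι → ℝ),
      Fintype.card ι = 2 ^ k ∧ (∀ i j, |H i j| = 1) ∧ (∀ i j, H i j = H j i) ∧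
      ∀ i j, ∑ l, H i l * H j l = if i = j then (2 : ℝ) ^ k else 0 := by
  induction k with
  | zero => exact ⟨Unit, inferInstance, inferInstance, fun _ _ => 1, by simp⟩
  | succ k ih =>
    obtain ⟨ι, _, _, H, hcard, habs, hsymm, horth⟩ := ih
    refine ⟨ι × Bool, inferInstance, inferInstance,
      fun p q => H p.1 q.1 * if p.2 && q.2 then -1 else 1, ?_, ?_, ?_, ?_⟩
    · simp [hcard, pow_succ]
    · rintro ⟨i, a⟩ ⟨j, b⟩
      cases a <;> cases b <;> simp [habs]
    · rintro ⟨i, a⟩ ⟨j, b⟩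
      simp [hsymm i j, Bool.and_comm]
    · rintro ⟨i, a⟩ ⟨j, b⟩
      have hsum : ∀ x, ∑ c : Bool, (H i x * if a && c then -1 else 1) *
          (H j x * if b && c then -1 else 1) = H i x * H j x * if a = b then 2 else 0 := fun x => by
        cases a <;> cases b <;> simp <;> ring
      simp only [Fintype.sum_prod_type, hsum, ← Finset.sum_mul, horth, Prod.mk.injEq]
      split_ifs <;> simp_all [pow_succ]

open unitInterval

/-- Half the difference of the means of `f` over `[m, m + w]` and `[m - w, m]`. -/
def oddMean (m w : ℝ) : C(I, ℝ) →L[ℝ] ℝ :=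
  LinearMap.mkContinuous
    { toFun := fun f => ∫ u in (0 : ℝ)..1,
        (f (Set.projIcc 0 1 zero_le_one (m + w * u)) -
          f (Set.projIcc 0 1 zero_le_one (m - w * u))) / 2
      map_add' := fun f g => by
        rw [← intervalIntegral.integral_add]
        · congr 1; ext u; simp only [ContinuousMap.add_apply]; ring
        · exact Continuous.intervalIntegrable (by fun_prop) _ _
        · exact Continuous.intervalIntegrable (by fun_prop) _ _
      map_smul' := fun c f => by
        rw [RingHom.id_apply, smul_eq_mul, ← intervalIntegral.integral_const_mul]
        congr 1; ext u; simp only [ContinuousMap.smul_apply, smul_eq_mul]; ring }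
    1 (fun f => by
      have := intervalIntegral.norm_integral_le_of_norm_le_const (a := 0) (b := 1) (C := ‖f‖)
        (f := fun u : ℝ => (f (Set.projIcc 0 1 zero_le_one (m + w * u)) -
          f (Set.projIcc 0 1 zero_le_one (m - w * u))) / 2) (fun u _ => by
            have h1 := f.norm_coe_le_norm (Set.projIcc 0 1 zero_le_one (m + w * u))
            have h2 := f.norm_coe_le_norm (Set.projIcc 0 1 zero_le_one (m - w * u))
            rw [Real.norm_eq_abs, abs_le] at *
            constructor <;> linarith [h1.1, h1.2, h2.1, h2.2])
      simpa using this)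

theorem oddMean_apply (m w : ℝ) (f : C(I, ℝ)) :
    oddMean m w f = ∫ u in (0 : ℝ)..1,
        (f (Set.projIcc 0 1 zero_le_one (m + w * u)) -
          f (Set.projIcc 0 1 zero_le_one (m - w * u))) / 2 := rfl

theorem abs_oddMean_le (m w : ℝ) (f : C(I, ℝ)) : |oddMean m w f| ≤ ‖f‖ := by
  have h : ‖oddMean m w f‖ ≤ 1 * ‖f‖ :=
    (oddMean m w).le_of_opNorm_le (LinearMap.mkContinuous_norm_le _ zero_le_one _) f
  simpa using h

theorem oddMean_lt (m w : ℝ) {g : C(I, ℝ)} {M : ℝ} (hM : 0 < M) (hg : ∀ t, |g t| ≤ M) :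
    oddMean m w g < M := by
  have h : ∫ u in (0 : ℝ)..1, (g (Set.projIcc 0 1 zero_le_one (m + w * u)) -
          g (Set.projIcc 0 1 zero_le_one (m - w * u))) / 2 < ∫ _ in (0 : ℝ)..1, M := by
    refine intervalIntegral.integral_lt_integral_of_continuousOn_of_le_of_exists_lt zero_lt_one
      (Continuous.continuousOn (by fun_prop)) continuousOn_const (fun u _ => ?_)
      ⟨0, by simp, by simpa using hM⟩
    have h1 := abs_le.1 (hg (Set.projIcc 0 1 zero_le_one (m + w * u)))
    have h2 := abs_le.1 (hg (Set.projIcc 0 1 zero_le_one (m - w * u)))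
    linarith [h1.2, h2.1]
  simpa [oddMean_apply] using h

theorem tendsto_oddMean {m w : ℝ} (hw : 0 < w) (h0 : 0 ≤ m - w) (h1 : m + w ≤ 1) (t : I)
    {F : ℕ → C(I, ℝ)} {f : C(I, ℝ)} (hF : ∀ k x, |F k x| ≤ 1)
    (hlim : ∀ x, x ≠ t → Filter.Tendsto (fun k => F k x) Filter.atTop (nhds (f x))) :
    Filter.Tendsto (fun k => oddMean m w (F k)) Filter.atTop (nhds (oddMean m w f)) := by
  simp only [oddMean_apply]
  refine intervalIntegral.tendsto_integral_filter_of_dominated_convergence (fun _ => 1) ?_ ?_ ?_ ?_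
  · exact Filter.Eventually.of_forall fun k =>
      Continuous.aestronglyMeasurable (by fun_prop)
  · refine Filter.Eventually.of_forall fun k => Filter.Eventually.of_forall fun u _ => ?_
    have h1 := abs_le.1 (hF k (Set.projIcc 0 1 zero_le_one (m + w * u)))
    have h2 := abs_le.1 (hF k (Set.projIcc 0 1 zero_le_one (m - w * u)))
    rw [Real.norm_eq_abs, abs_le]
    constructor <;> linarith [h1.1, h1.2, h2.1, h2.2]
  · simp
  · have hnull : ∀ᵐ u : ℝ, u ≠ (t - m) / w ∧ u ≠ (m - t) / w :=
      (MeasureTheory.Measure.ae_ne _ _).and (MeasureTheory.Measure.ae_ne _ _)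
    filter_upwards [hnull] with u ⟨hu1, hu2⟩ hu
    rw [Set.uIoc_of_le zero_le_one] at hu
    have hwu : w * u ≤ w := by nlinarith [hu.2]
    have hwu0 : 0 < w * u := mul_pos hw hu.1
    refine ((hlim _ fun h => hu1 ?_).sub (hlim _ fun h => hu2 ?_)).div_const 2
    · rw [Set.projIcc_of_mem zero_le_one ⟨by linarith, by linarith⟩] at h
      rw [← h]; field_simp; ring
    · rw [Set.projIcc_of_mem zero_le_one ⟨by linarith, by linarith⟩] at h
      rw [← h]; field_simp; ring

/-- A continuous odd profile around `m`, supported in `[m - 2 w, m + 2 w]`, which converges to the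
sign of `x - m` on `[m - w, m + w]` as `k → ∞`. -/
def oddTooth (m w k : ℝ) : C(I, ℝ) where
  toFun x := max (-1) (min 1 (k * ((x - m) / w))) * max 0 (min 1 (2 - |(x - m) / w|))
  continuous_toFun := by fun_prop

theorem abs_oddTooth_le (m w k : ℝ) (x : I) : |oddTooth m w k x| ≤ 1 := by
  have h1 : |max (-1) (min 1 (k * ((x - m) / w)))| ≤ 1 :=
    abs_le.2 ⟨le_max_left _ _, max_le (by norm_num) (min_le_left _ _)⟩
  have h2 : |max 0 (min 1 (2 - |((x : ℝ) - m) / w|))| ≤ 1 := by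
    rw [abs_of_nonneg (le_max_left _ _)]
    exact max_le zero_le_one (min_le_left _ _)
  calc _ = _ := abs_mul _ _
    _ ≤ 1 * 1 := mul_le_mul h1 h2 (abs_nonneg _) zero_le_one
    _ = 1 := one_mul 1

theorem oddTooth_eq_zero {m w k : ℝ} (hw : 0 < w) {x : I} (hx : 2 * w ≤ |(x : ℝ) - m|) :
    oddTooth m w k x = 0 := by
  have h : min 1 (2 - |((x : ℝ) - m) / w|) ≤ 0 := by
    refine (min_le_right _ _).trans ?_
    rw [abs_div, abs_of_pos hw, sub_nonpos, le_div_iff₀ hw]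
    exact hx
  change _ * max 0 (min 1 (2 - |((x : ℝ) - m) / w|)) = 0
  rw [max_eq_left h, mul_zero]

theorem oddMean_oddTooth_self {m w k : ℝ} (hw : 0 < w) (h0 : 0 ≤ m - w) (h1 : m + w ≤ 1)
    (hk : 0 ≤ k) :
    oddMean m w (oddTooth m w k) = ∫ u in (0 : ℝ)..1, min 1 (k * u) := by
  rw [oddMean_apply]
  refine intervalIntegral.integral_congr fun u hu => ?_
  rw [Set.uIcc_of_le zero_le_one] at hu
  have hwu : w * u ≤ w := by nlinarith [hu.2]
  have hwu0 : 0 ≤ w * u := mul_nonneg hw.le hu.1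
  have hku : 0 ≤ k * u := mul_nonneg hk hu.1
  have e1 : (m + w * u - m) / w = u := by field_simp; ring
  have e2 : (m - w * u - m) / w = -u := by field_simp; ring
  have h2u : min 1 (2 - u) = 1 := min_eq_left (by linarith [hu.2])
  simp only [Set.projIcc_of_mem (zero_le_one' ℝ) (x := m + w * u) ⟨by linarith, by linarith⟩,
    Set.projIcc_of_mem (zero_le_one' ℝ) (x := m - w * u) ⟨by linarith, by linarith⟩, oddTooth,
    ContinuousMap.coe_mk, e1, e2, abs_neg, abs_of_nonneg hu.1, h2u]
  rw [max_eq_right (a := -1) (le_min (by norm_num) (by linarith)),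
    min_eq_right (a := 1) (b := k * -u) (by linarith), mul_neg, max_neg_neg,
    max_eq_right zero_le_one]
  ring

theorem oddMean_oddTooth_of_ne {m m' w k : ℝ} (hw : 0 < w) (h0 : 0 ≤ m - w) (h1 : m + w ≤ 1)
    (hm : 4 * w ≤ |m - m'|) : oddMean m w (oddTooth m' w k) = 0 := by
  rw [oddMean_apply]
  refine intervalIntegral.integral_zero_ae (Filter.Eventually.of_forall fun u hu => ?_)
  rw [Set.uIoc_of_le zero_le_one] at hu
  have hwu : w * u ≤ w := by nlinarith [hu.2]
  have hwu0 : 0 < w * u := mul_pos hw hu.1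
  have a1 : |m - m'| ≤ |m + w * u - m'| + w := by
    refine (abs_sub_le m (m + w * u) m').trans ?_
    rw [sub_add_cancel_left, abs_neg, abs_of_pos hwu0]
    linarith
  have a2 : |m - m'| ≤ |m - w * u - m'| + w := by
    refine (abs_sub_le m (m - w * u) m').trans ?_
    rw [sub_sub_cancel, abs_of_pos hwu0]
    linarith
  rw [Set.projIcc_of_mem (zero_le_one' ℝ) (x := m + w * u) ⟨by linarith, by linarith⟩,
    Set.projIcc_of_mem (zero_le_one' ℝ) (x := m - w * u) ⟨by linarith, by linarith⟩,
    oddTooth_eq_zero hw (by simp only; linarith), oddTooth_eq_zero hw (by simp only; linarith)]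
  norm_num

theorem one_sub_le_integral_min_one_mul (k : ℕ) :
    1 - 1 / ((k : ℝ) + 1) ≤ ∫ u in (0 : ℝ)..1, min 1 (k * u) := by
  have h : ∫ u in (0 : ℝ)..1, (1 - (1 - u) ^ k) ≤ ∫ u in (0 : ℝ)..1, min 1 (k * u) := by
    refine intervalIntegral.integral_mono_on zero_le_one
      (Continuous.intervalIntegrable (by fun_prop) _ _)
      (Continuous.intervalIntegrable (by fun_prop) _ _) fun u hu => le_min ?_ ?_
    · linarith [pow_nonneg (sub_nonneg.2 hu.2) k]
    · have := one_add_mul_le_pow (a := -u) (by linarith [hu.2]) k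
      rw [← sub_eq_add_neg] at this
      linarith
  refine le_trans (le_of_eq ?_) h
  rw [intervalIntegral.integral_sub (by simp)
    (Continuous.intervalIntegrable (by fun_prop) _ _),
    intervalIntegral.integral_comp_sub_left (fun u => u ^ k)]
  simp

/-- Disjointly supported non-atomic norm-one functionals on `C[0,1]`, none of which attains its
norm. -/
structure IsDisjointNonattaining {ι : Type} [Fintype ι] [DecidableEq ι]
    (ρ : ι → C(I, ℝ) →L[ℝ] ℝ) : Prop where
  abs_le : ∀ c f, |ρ c f| ≤ ‖f‖
  lt : ∀ c (g : C(I, ℝ)) (M : ℝ), 0 < M → (∀ t, |g t| ≤ M) → ρ c g < M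
  exists_teeth : ∀ δ : ℝ, 0 < δ → ∃ κ : ℝ, 1 - δ < κ ∧ ∃ θ : ι → C(I, ℝ),
    (∀ t, ∑ c, |θ c t| ≤ 1) ∧ ∀ c d, ρ c (θ d) = if c = d then κ else 0
  exists_prescribed : ∀ (t : I) (f : C(I, ℝ)) (τ δ : ℝ), (∀ x, |f x| ≤ 1) → |τ| ≤ 1 → 0 < δ →
    ∃ f' : C(I, ℝ), (∀ x, |f' x| ≤ 1) ∧ f' t = τ ∧ ∀ c, |ρ c f' - ρ c f| < δ

theorem exists_prescribed_value {ι : Type} [Finite ι] {m : ι → ℝ} {w : ℝ} (hw : 0 < w)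
    (h0 : ∀ c, 0 ≤ m c - w) (h1 : ∀ c, m c + w ≤ 1) (t : I) (f : C(I, ℝ)) {τ δ : ℝ}
    (hf : ∀ x, |f x| ≤ 1) (hτ : |τ| ≤ 1) (hδ : 0 < δ) :
    ∃ f' : C(I, ℝ), (∀ x, |f' x| ≤ 1) ∧ f' t = τ ∧
      ∀ c, |oddMean (m c) w f' - oddMean (m c) w f| < δ := by
  have habs : ∀ x : I, |(x : ℝ) - t| ≤ 1 := fun x =>
    abs_le.2 ⟨by linarith [x.2.1, t.2.2], by linarith [x.2.2, t.2.1]⟩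
  let F : ℕ → C(I, ℝ) := fun k =>
    { toFun := fun x => (1 - (1 - |(x : ℝ) - t|) ^ k) * f x + (1 - |(x : ℝ) - t|) ^ k * τ
      continuous_toFun := by fun_prop }
  have hF : ∀ k x, |F k x| ≤ 1 := fun k x => by
    have hp0 : 0 ≤ (1 - |(x : ℝ) - t|) ^ k := pow_nonneg (sub_nonneg.2 (habs x)) k
    have hp1 : (1 - |(x : ℝ) - t|) ^ k ≤ 1 :=
      pow_le_one₀ (sub_nonneg.2 (habs x)) (by linarith [abs_nonneg ((x : ℝ) - t)])
    change |(1 - (1 - |(x : ℝ) - t|) ^ k) * f x + (1 - |(x : ℝ) - t|) ^ k * τ| ≤ 1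
    refine (abs_add_le _ _).trans ?_
    rw [abs_mul, abs_mul, abs_of_nonneg hp0, abs_of_nonneg (sub_nonneg.2 hp1)]
    nlinarith [hf x]
  have hlim : ∀ x, x ≠ t → Filter.Tendsto (fun k => F k x) Filter.atTop (nhds (f x)) := by
    intro x hx
    have hpos : 0 < |(x : ℝ) - t| := abs_pos.2 (sub_ne_zero.2 fun h => hx (Subtype.ext h))
    have hp := tendsto_pow_atTop_nhds_zero_of_lt_one (sub_nonneg.2 (habs x))
      (by linarith : 1 - |(x : ℝ) - t| < 1)
    have h := ((hp.const_sub 1).mul_const (f x)).add (hp.mul_const τ)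
    rw [sub_zero, one_mul, zero_mul, add_zero] at h
    exact h
  have hev : ∀ᶠ k in Filter.atTop, ∀ c, |oddMean (m c) w (F k) - oddMean (m c) w f| < δ :=
    Filter.eventually_all.2 fun c =>
      Metric.tendsto_nhds.1 (tendsto_oddMean hw (h0 c) (h1 c) t hF hlim) δ hδ
  obtain ⟨k, hk⟩ := hev.exists
  exact ⟨F k, hF k, by simp [F], hk⟩

theorem exists_isDisjointNonattaining (ι : Type) [Fintype ι] [DecidableEq ι] :
    ∃ ρ : ι → C(I, ℝ) →L[ℝ] ℝ, IsDisjointNonattaining ρ := by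
  set N : ℝ := Fintype.card ι + 1 with hN
  have hNpos : 0 < N := by positivity
  let m : ι → ℝ := fun c => ((Fintype.equivFin ι c : ℕ) + 1 / 2) / N
  let w : ℝ := 1 / (4 * N)
  have hw : 0 < w := by positivity
  have hNw : N * w = 1 / 4 := by simp only [w]; field_simp
  have hNm : ∀ c, N * m c = (Fintype.equivFin ι c : ℕ) + 1 / 2 := fun c => by
    simp only [m]; field_simp
  have h0 : ∀ c, 0 ≤ m c - w := fun c => by
    refine nonneg_of_mul_nonneg_right (a := N) ?_ hNpos
    rw [mul_sub, hNm, hNw]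
    linarith [Nat.cast_nonneg (α := ℝ) (Fintype.equivFin ι c : ℕ)]
  have h1 : ∀ c, m c + w ≤ 1 := fun c => by
    refine le_of_mul_le_mul_left (a := N) ?_ hNpos
    rw [mul_add, hNm, hNw]
    have : ((Fintype.equivFin ι c : ℕ) : ℝ) ≤ Fintype.card ι :=
      Nat.cast_le.2 (Fintype.equivFin ι c).2.le
    linarith
  have hm : ∀ c d, c ≠ d → 4 * w ≤ |m c - m d| := fun c d hcd => by
    refine le_of_mul_le_mul_left (a := N) ?_ hNpos
    rw [← abs_of_pos hNpos, ← abs_mul, abs_of_pos hNpos, mul_sub, hNm, hNm, mul_left_comm, hNw]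
    have hne : ((Fintype.equivFin ι c : ℕ) : ℤ) - (Fintype.equivFin ι d : ℕ) ≠ 0 := by
      rw [sub_ne_zero, Ne, Nat.cast_inj, ← Fin.ext_iff]
      exact fun h => hcd ((Fintype.equivFin ι).injective h)
    have := Int.one_le_abs hne
    have h' : (1 : ℝ) ≤ |((Fintype.equivFin ι c : ℕ) : ℝ) - (Fintype.equivFin ι d : ℕ)| := by
      exact_mod_cast this
    rw [add_sub_add_right_eq_sub]
    linarith
  refine ⟨fun c => oddMean (m c) w, fun c => abs_oddMean_le _ _, fun c g M => oddMean_lt _ _,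
    fun δ hδ => ?_, fun t f τ δ => exists_prescribed_value hw h0 h1 t f⟩
  obtain ⟨k, hk⟩ := exists_nat_one_div_lt hδ
  refine ⟨∫ u in (0 : ℝ)..1, min 1 (k * u), ?_, fun c => oddTooth (m c) w k, fun t => ?_,
    fun c d => ?_⟩
  · linarith [one_sub_le_integral_min_one_mul k]
  · by_cases h : ∃ c, |(t : ℝ) - m c| < 2 * w
    · obtain ⟨c, hc⟩ := h
      rw [Finset.sum_eq_single c]
      · exact abs_oddTooth_le _ _ _ _
      · intro d _ hd
        rw [oddTooth_eq_zero hw, abs_zero]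
        have := hm c d hd.symm
        have h' := abs_sub_le (m c) t (m d)
        rw [abs_sub_comm (m c) t] at h'
        linarith
      · simp
    · push Not at h
      rw [Finset.sum_eq_zero fun c _ => by rw [oddTooth_eq_zero hw (h c), abs_zero]]
      exact zero_le_one
  · split_ifs with h
    · subst h
      exact oddMean_oddTooth_self hw (h0 c) (h1 c) (Nat.cast_nonneg k)
    · exact oddMean_oddTooth_of_ne hw (h0 c) (h1 c) (hm c d h)

theorem IsDisjointNonattaining.exists_approx {ι : Type} [Fintype ι] [DecidableEq ι]
    {ρ : ι → C(I, ℝ) →L[ℝ] ℝ} (hρ : IsDisjointNonattaining ρ) (t : I) {τ : ℝ} (hτ : |τ| ≤ 1)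
    {ε : ι → ℝ} (hε : ∀ c, |ε c| ≤ 1) {δ : ℝ} (hδ : 0 < δ) :
    ∃ f : C(I, ℝ), (∀ x, |f x| ≤ 1) ∧ f t = τ ∧ ∀ c, |ρ c f - ε c| < δ := by
  obtain ⟨κ, hκ, θ, hθ, hρθ⟩ := hρ.exists_teeth (δ / 2) (half_pos hδ)
  have hκ1 : ∀ c : ι, κ < 1 := fun c => by
    have h := hρ.lt c (θ c) 1 one_pos fun t =>
      (Finset.single_le_sum (fun d _ => abs_nonneg (θ d t)) (Finset.mem_univ c)).trans (hθ t)
    rwa [hρθ, if_pos rfl] at h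
  have hbound : ∀ x, |(∑ c, ε c • θ c) x| ≤ 1 := fun x => by
    rw [ContinuousMap.sum_apply]
    refine (Finset.abs_sum_le_sum_abs _ _).trans ((Finset.sum_le_sum fun c _ => ?_).trans (hθ x))
    rw [ContinuousMap.smul_apply, smul_eq_mul, abs_mul]
    exact mul_le_of_le_one_left (abs_nonneg _) (hε c)
  obtain ⟨f, hf, hft, hfρ⟩ :=
    hρ.exists_prescribed t (∑ c, ε c • θ c) τ (δ / 2) hbound hτ (half_pos hδ)
  refine ⟨f, hf, hft, fun c => ?_⟩
  have hval : ρ c (∑ d, ε d • θ d) = ε c * κ := by simp [hρθ]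
  have h1 := hfρ c
  rw [hval] at h1
  have h2 : |ε c * κ - ε c| < δ / 2 := by
    have : ε c * κ - ε c = -(ε c * (1 - κ)) := by ring
    rw [this, abs_neg, abs_mul, abs_of_pos (sub_pos.2 (hκ1 c))]
    nlinarith [hε c, hκ1 c]
  linarith [abs_sub_le (ρ c f) (ε c * κ) (ε c)]

section HadamardFunctional

variable {ι : Type} [Fintype ι]

/-- The functionals obtained from `ρ` by the rows of the block matrix `[1, s H]`. -/
def hadamardFunctional (ρ : ι ⊕ ι → C(I, ℝ) →L[ℝ] ℝ) (H : ι → ι → ℝ) (s : ℝ) (i : ι) :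
    C(I, ℝ) →L[ℝ] ℝ :=
  ρ (Sum.inl i) + s • ∑ l, H i l • ρ (Sum.inr l)

theorem hadamardFunctional_apply (ρ : ι ⊕ ι → C(I, ℝ) →L[ℝ] ℝ) (H : ι → ι → ℝ) (s : ℝ) (i : ι)
    (f : C(I, ℝ)) :
    hadamardFunctional ρ H s i f = ρ (Sum.inl i) f + s * ∑ l, H i l * ρ (Sum.inr l) f := by
  simp [hadamardFunctional]

theorem sum_hadamardFunctional_mul (ρ : ι ⊕ ι → C(I, ℝ) →L[ℝ] ℝ) (H : ι → ι → ℝ) (s : ℝ)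
    (f : C(I, ℝ)) (a : ι → ℝ) :
    ∑ i, hadamardFunctional ρ H s i f * a i =
      ∑ i, ρ (Sum.inl i) f * a i + ∑ l, ρ (Sum.inr l) f * (s * ∑ i, a i * H i l) := by
  simp only [hadamardFunctional_apply, add_mul, Finset.sum_add_distrib, Finset.mul_sum,
    Finset.sum_mul]
  congr 1
  rw [Finset.sum_comm]
  exact Finset.sum_congr rfl fun _ _ => Finset.sum_congr rfl fun _ _ => by ring

/-- The common kernel of the functionals `hadamardFunctional ρ H s i`. -/
def hadamardKernel (ρ : ι ⊕ ι → C(I, ℝ) →L[ℝ] ℝ) (H : ι → ι → ℝ) (s : ℝ) :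
    Submodule ℝ C(I, ℝ) :=
  (ContinuousLinearMap.pi (hadamardFunctional ρ H s)).ker

theorem mem_hadamardKernel {ρ : ι ⊕ ι → C(I, ℝ) →L[ℝ] ℝ} {H : ι → ι → ℝ} {s : ℝ}
    {f : C(I, ℝ)} :
    f ∈ hadamardKernel ρ H s ↔ ∀ i, hadamardFunctional ρ H s i f = 0 := by
  simp [hadamardKernel, funext_iff]

variable [DecidableEq ι] {ρ : ι ⊕ ι → C(I, ℝ) →L[ℝ] ℝ} {H : ι → ι → ℝ} {s n v : ℝ}

theorem exists_dual_system (hρ : IsDisjointNonattaining ρ) (hs : 0 ≤ s) (hn : 0 < n)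
    (hv : 0 < v) (habs : ∀ i j, |H i j| = 1) (hsymm : ∀ i j, H i j = H j i)
    (hcard : (Fintype.card ι : ℝ) = n)
    (horth : ∀ i j, ∑ l, H i l * H j l = if i = j then n else 0)
    (hsv : v * (1 / (1 + s * n) + s / (1 + s)) = 1) {ε : ℝ} (hε : 0 < ε) :
    ∃ g : ι → C(I, ℝ),
      (∀ i j, hadamardFunctional ρ H s i (g j) = if i = j then 1 else 0) ∧
      ∀ t, ∑ i, |g i t| + s * ∑ l, |∑ i, g i t * H i l| ≤ v + ε := by
  obtain ⟨κ, hκ, θ, hθ, hρθ⟩ := hρ.exists_teeth (ε / (v + ε)) (by positivity)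
  have hκ' : v / (v + ε) < κ := by
    refine lt_of_eq_of_lt ?_ hκ
    field_simp
    ring
  have hκ0 : 0 < κ := lt_trans (by positivity) hκ'
  have hvκ : κ⁻¹ * v ≤ v + ε := by
    rw [div_lt_iff₀ (by positivity)] at hκ'
    rw [inv_mul_le_iff₀ hκ0]
    exact hκ'.le
  set a : ℝ := v / (1 + s * n) with ha
  set b : ℝ := v / (n * (1 + s)) with hb
  have ha0 : 0 ≤ a := by positivity
  have hb0 : 0 ≤ b := by positivity
  have hab : a + s * (b * n) = 1 := by
    rw [← hsv, ha, hb]; field_simp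
  have hav : a * (1 + s * n) = v := by rw [ha]; field_simp
  have hbv : b * n * (1 + s) = v := by rw [hb]; field_simp
  refine ⟨fun j => κ⁻¹ • (a • θ (Sum.inl j) + b • ∑ l, H j l • θ (Sum.inr l)),
    fun i j => ?_, fun t => ?_⟩
  · have e1 : ρ (Sum.inl i) (κ⁻¹ • (a • θ (Sum.inl j) + b • ∑ l, H j l • θ (Sum.inr l))) =
        if i = j then a else 0 := by
      simp [hρθ]
      split_ifs <;> field_simp
    have e2 : ∀ l, ρ (Sum.inr l) (κ⁻¹ • (a • θ (Sum.inl j) + b • ∑ l, H j l • θ (Sum.inr l))) =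
        b * H j l := fun l => by
      simp [hρθ]
      field_simp
    rw [hadamardFunctional_apply, e1]
    simp only [e2]
    have e3 : ∑ l, H i l * (b * H j l) = b * ∑ l, H i l * H j l := by
      rw [Finset.mul_sum]
      exact Finset.sum_congr rfl fun _ _ => by ring
    rw [e3, horth]
    split_ifs
    · exact hab
    · simp
  · have horth' : ∀ l l', ∑ i, H i l * H i l' = if l = l' then n else 0 := fun l l' => by
      rw [← horth]
      exact Finset.sum_congr rfl fun i _ => by rw [hsymm i l, hsymm i l']
    set A := ∑ i, |θ (Sum.inl i) t| with hA
    set B := ∑ l, |θ (Sum.inr l) t| with hB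
    have hAB : A + B ≤ 1 := by simpa [Fintype.sum_sum_type] using hθ t
    simp only [ContinuousMap.smul_apply, ContinuousMap.add_apply, ContinuousMap.sum_apply,
      smul_eq_mul]
    have hfirst : ∑ i, |κ⁻¹ * (a * θ (Sum.inl i) t + b * ∑ l, H i l * θ (Sum.inr l) t)| ≤
        κ⁻¹ * (a * A + b * n * B) := by
      have : ∀ i, |κ⁻¹ * (a * θ (Sum.inl i) t + b * ∑ l, H i l * θ (Sum.inr l) t)| ≤
          κ⁻¹ * (a * |θ (Sum.inl i) t| + b * B) := fun i => by
        rw [abs_mul, abs_of_pos (inv_pos.2 hκ0)]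
        gcongr
        refine (abs_add_le _ _).trans ?_
        rw [abs_mul, abs_mul, abs_of_nonneg ha0, abs_of_nonneg hb0]
        gcongr
        refine (Finset.abs_sum_le_sum_abs _ _).trans_eq ?_
        simp [abs_mul, habs, hB]
      refine (Finset.sum_le_sum fun i _ => this i).trans_eq ?_
      rw [← Finset.mul_sum, Finset.sum_add_distrib, ← Finset.mul_sum, Finset.sum_const,
        Finset.card_univ, nsmul_eq_mul, hcard]
      ring
    have hsecond : ∑ l, |∑ i, κ⁻¹ * (a * θ (Sum.inl i) t + b * ∑ l, H i l * θ (Sum.inr l) t) *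
        H i l| ≤ κ⁻¹ * (a * n * A + b * n * B) := by
      have : ∀ l, |∑ i, κ⁻¹ * (a * θ (Sum.inl i) t + b * ∑ l, H i l * θ (Sum.inr l) t) *
          H i l| ≤ κ⁻¹ * (a * A + b * n * |θ (Sum.inr l) t|) := fun l => by
        have h1 : ∑ i, κ⁻¹ * (a * θ (Sum.inl i) t + b * ∑ l, H i l * θ (Sum.inr l) t) *
            H i l = κ⁻¹ * (a * ∑ i, θ (Sum.inl i) t * H i l + b * n * θ (Sum.inr l) t) := by
          have h2 : ∑ i, (∑ l', H i l' * θ (Sum.inr l') t) * H i l = n * θ (Sum.inr l) t := by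
            simp only [Finset.sum_mul]
            rw [Finset.sum_comm]
            have h3 : ∀ l', ∑ i, H i l' * θ (Sum.inr l') t * H i l =
                (if l' = l then n else 0) * θ (Sum.inr l') t := fun l' => by
              rw [← horth', Finset.sum_mul]
              exact Finset.sum_congr rfl fun _ _ => by ring
            simp [h3]
          rw [mul_assoc b, ← h2]
          simp only [mul_add, Finset.mul_sum, add_mul, Finset.sum_add_distrib]
          congr 1
          · exact Finset.sum_congr rfl fun _ _ => by ring
          · refine Finset.sum_congr rfl fun _ _ => ?_
            simp only [Finset.sum_mul, Finset.mul_sum]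
            exact Finset.sum_congr rfl fun _ _ => by ring
        rw [h1, abs_mul, abs_of_pos (inv_pos.2 hκ0)]
        gcongr
        refine (abs_add_le _ _).trans ?_
        rw [abs_mul, abs_mul, abs_of_nonneg ha0, abs_of_nonneg (by positivity : 0 ≤ b * n)]
        gcongr
        refine (Finset.abs_sum_le_sum_abs _ _).trans_eq ?_
        simp [abs_mul, habs, hA]
      refine (Finset.sum_le_sum fun i _ => this i).trans_eq ?_
      rw [← Finset.mul_sum, Finset.sum_add_distrib, ← Finset.mul_sum, Finset.sum_const,
        ← Finset.mul_sum, ← hB, Finset.card_univ, nsmul_eq_mul, hcard]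
      ring
    calc _ ≤ κ⁻¹ * (a * A + b * n * B) + s * (κ⁻¹ * (a * n * A + b * n * B)) := by gcongr
      _ = κ⁻¹ * (a * (1 + s * n) * A + b * n * (1 + s) * B) := by ring
      _ = κ⁻¹ * v * (A + B) := by rw [hav, hbv]; ring
      _ ≤ κ⁻¹ * v := mul_le_of_le_one_right (by positivity) hAB
      _ ≤ v + ε := hvκ

theorem exists_projection_norm_le (hρ : IsDisjointNonattaining ρ) (hs : 0 ≤ s) {c : ℝ}
    (hc : 0 ≤ c) {g : ι → C(I, ℝ)}
    (hg : ∀ i j, hadamardFunctional ρ H s i (g j) = if i = j then 1 else 0)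
    (hgc : ∀ t, ∑ i, |g i t| + s * ∑ l, |∑ i, g i t * H i l| ≤ c) :
    ∃ P : C(I, ℝ) →L[ℝ] C(I, ℝ), IsProjectionOnto (hadamardKernel ρ H s) P ∧ ‖P‖ ≤ 1 + c := by
  refine ⟨ContinuousLinearMap.id ℝ _ - ∑ i, (hadamardFunctional ρ H s i).smulRight (g i),
    ⟨fun f => ?_, fun f hf => ?_⟩, ?_⟩
  · rw [mem_hadamardKernel]
    intro j
    simp [hg]
  · rw [mem_hadamardKernel] at hf
    simp [hf]
  · refine ContinuousLinearMap.opNorm_le_bound _ (by positivity) fun f => ?_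
    rw [ContinuousMap.norm_le _ (by positivity)]
    intro t
    have e : (ContinuousLinearMap.id ℝ C(I, ℝ) -
        ∑ i, (hadamardFunctional ρ H s i).smulRight (g i)) f t =
        f t - ∑ i, hadamardFunctional ρ H s i f * g i t := by
      simp [ContinuousMap.sum_apply]
    rw [e, sum_hadamardFunctional_mul]
    refine (norm_sub_le _ _).trans ?_
    rw [one_add_mul]
    refine add_le_add (f.norm_coe_le_norm t) ?_
    rw [mul_comm]
    refine le_trans ?_ (mul_le_mul_of_nonneg_left (hgc t) (norm_nonneg f))
    rw [Real.norm_eq_abs, mul_add]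
    refine (abs_add_le _ _).trans (add_le_add ?_ ?_)
    · rw [Finset.mul_sum]
      refine (Finset.abs_sum_le_sum_abs _ _).trans (Finset.sum_le_sum fun i _ => ?_)
      rw [abs_mul]
      exact mul_le_mul_of_nonneg_right (hρ.abs_le _ _) (abs_nonneg _)
    · rw [Finset.mul_sum, Finset.mul_sum]
      refine (Finset.abs_sum_le_sum_abs _ _).trans (Finset.sum_le_sum fun i _ => ?_)
      rw [abs_mul, abs_mul, abs_of_nonneg hs]
      exact mul_le_mul_of_nonneg_right (hρ.abs_le _ _) (by positivity)

theorem exists_dual_system_of_isProjectionOnto {P : C(I, ℝ) →L[ℝ] C(I, ℝ)}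
    (hP : IsProjectionOnto (hadamardKernel ρ H s) P) {e : ι → C(I, ℝ)}
    (he : ∀ i j, hadamardFunctional ρ H s i (e j) = if i = j then 1 else 0) :
    ∃ g : ι → C(I, ℝ),
      (∀ i j, hadamardFunctional ρ H s i (g j) = if i = j then 1 else 0) ∧
      ∀ f, P f = f - ∑ i, hadamardFunctional ρ H s i f • g i := by
  refine ⟨fun j => e j - P (e j), fun i j => ?_, fun f => ?_⟩
  · rw [map_sub, he, mem_hadamardKernel.1 (hP.1 (e j)) i, sub_zero]
  · have hmem : f - ∑ i, hadamardFunctional ρ H s i f • e i ∈ hadamardKernel ρ H s := by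
      rw [mem_hadamardKernel]
      intro j
      simp [he]
    have h := hP.2 _ hmem
    rw [map_sub, map_sum] at h
    simp only [map_smul] at h
    simp only [smul_sub, Finset.sum_sub_distrib]
    rw [sub_eq_iff_eq_add] at h
    rw [h]
    abel

theorem sum_mul_le_norm_sub_one (hρ : IsDisjointNonattaining ρ) {P : C(I, ℝ) →L[ℝ] C(I, ℝ)}
    {g : ι → C(I, ℝ)} (hPg : ∀ f, P f = f - ∑ i, hadamardFunctional ρ H s i f • g i)
    {x y : ι → ℝ} (hx : ∀ i, |x i| ≤ 1) (hy : ∀ l, |y l| ≤ 1) (t : I) :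
    ∑ i, x i * g i t + ∑ l, y l * (s * ∑ i, g i t * H i l) ≤ ‖P‖ - 1 := by
  let α : ι ⊕ ι → ℝ := Sum.elim (fun i => g i t) fun l => s * ∑ i, g i t * H i l
  let ε : ι ⊕ ι → ℝ := Sum.elim x y
  suffices h : ∑ c, ε c * α c ≤ ‖P‖ - 1 by simpa [α, ε, Fintype.sum_sum_type] using h
  refine le_of_forall_pos_le_add fun η hη => ?_
  have hS : 0 ≤ ∑ c, |α c| := Finset.sum_nonneg fun _ _ => abs_nonneg _
  obtain ⟨f, hf, hft, hfρ⟩ := hρ.exists_approx t (τ := -1) (by simp) (ε := ε)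
    (by rintro (i | l); exacts [hx i, hy l]) (δ := η / (∑ c, |α c| + 1)) (by positivity)
  have h1 : ∑ c, ρ c f * α c ≤ ‖P‖ - 1 := by
    have hval : P f t = -1 - ∑ c, ρ c f * α c := by
      rw [hPg, Fintype.sum_sum_type]
      simp only [α, Sum.elim_inl, Sum.elim_inr]
      rw [← sum_hadamardFunctional_mul]
      simp [ContinuousMap.sum_apply, hft]
    have hf1 : ‖f‖ ≤ 1 := (ContinuousMap.norm_le _ zero_le_one).2 hf
    have hle := ((P f).norm_coe_le_norm t).trans (P.le_of_opNorm_le_of_le le_rfl hf1)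
    rw [hval, Real.norm_eq_abs, abs_le] at hle
    linarith [hle.1]
  have h2 : ∑ c, ε c * α c ≤ ∑ c, ρ c f * α c + ∑ c, η / (∑ c, |α c| + 1) * |α c| := by
    rw [← Finset.sum_add_distrib]
    refine Finset.sum_le_sum fun c _ => ?_
    have h3 : (ε c - ρ c f) * α c ≤ η / (∑ c, |α c| + 1) * |α c| := by
      refine (le_abs_self _).trans ?_
      rw [abs_mul, abs_sub_comm]
      exact mul_le_mul_of_nonneg_right (hfρ c).le (abs_nonneg _)
    linarith
  have h4 : ∑ c, η / (∑ c, |α c| + 1) * |α c| ≤ η := by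
    rw [← Finset.mul_sum, div_mul_eq_mul_div, div_le_iff₀ (by positivity)]
    nlinarith
  linarith

theorem lt_norm_of_isProjectionOnto_s19 (hρ : IsDisjointNonattaining ρ) (hs : 0 ≤ s) (hn : 0 < n)
    (hv : 0 < v) (habs : ∀ i j, |H i j| = 1) (hsymm : ∀ i j, H i j = H j i)
    (hcard : (Fintype.card ι : ℝ) = n)
    (horth : ∀ i j, ∑ l, H i l * H j l = if i = j then n else 0)
    (hsv : v * (1 / (1 + s * n) + s / (1 + s)) = 1) {P : C(I, ℝ) →L[ℝ] C(I, ℝ)}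
    (hP : IsProjectionOnto (hadamardKernel ρ H s) P) : 1 + v < ‖P‖ := by
  obtain ⟨e, he, -⟩ := exists_dual_system hρ hs hn hv habs hsymm hcard horth hsv one_pos
  obtain ⟨g, hg, hPg⟩ := exists_dual_system_of_isProjectionOnto hP he
  set C := ‖P‖ - 1 with hC
  have hsn : 0 < 1 + s * n := by positivity
  have hs1 : 0 < 1 + s := by positivity
  have hfirst' : ∀ r : ℝ, |r| ≤ 1 → ∀ k t, r * g k t * (1 + s * n) ≤ C := fun r hr k t => by
    have h := sum_mul_le_norm_sub_one hρ hPg (x := fun i => if i = k then r else 0)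
      (y := fun l => r * H k l)
      (fun i => by split_ifs <;> simp [hr]) (fun l => by simp [abs_mul, habs, hr]) t
    refine le_trans (le_of_eq ?_) h
    have h1 : ∑ l, r * H k l * (s * ∑ i, g i t * H i l) = r * s * (n * g k t) := by
      have h2 : ∑ l, H k l * ∑ i, g i t * H i l = n * g k t := by
        simp only [Finset.mul_sum]
        rw [Finset.sum_comm]
        have h3 : ∀ i, ∑ l, H k l * (g i t * H i l) = (if k = i then n else 0) * g i t :=
          fun i => by
            rw [← horth, Finset.sum_mul]
            exact Finset.sum_congr rfl fun _ _ => by ring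
        simp [h3]
      rw [← h2, Finset.mul_sum]
      exact Finset.sum_congr rfl fun _ _ => by ring
    rw [h1]
    simp
    ring
  have hsecond' : ∀ r : ℝ, |r| ≤ 1 → ∀ l t, r * (∑ i, g i t * H i l) * (1 + s) ≤ C :=
    fun r hr l t => by
      have h := sum_mul_le_norm_sub_one hρ hPg (x := fun i => r * H i l)
        (y := fun l' => if l' = l then r else 0)
        (fun i => by simp [abs_mul, habs, hr]) (fun i => by split_ifs <;> simp [hr]) t
      refine le_trans (le_of_eq ?_) h
      have h1 : ∑ i, r * H i l * g i t = r * ∑ i, g i t * H i l := by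
        rw [Finset.mul_sum]
        exact Finset.sum_congr rfl fun _ _ => by ring
      rw [h1]
      simp
      ring
  have hfirst : ∀ k t, |g k t| ≤ C / (1 + s * n) := fun k t => by
    rw [le_div_iff₀ hsn, ← abs_of_pos hsn, ← abs_mul, abs_le']
    have h1 := hfirst' 1 (by simp) k t
    have h2 := hfirst' (-1) (by simp) k t
    constructor <;> linarith
  have hsecond : ∀ l t, |∑ i, g i t * H i l| ≤ C / (1 + s) := fun l t => by
    rw [le_div_iff₀ hs1, ← abs_of_pos hs1, ← abs_mul, abs_le']
    have h1 := hsecond' 1 (by simp) l t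
    have h2 := hsecond' (-1) (by simp) l t
    constructor <;> linarith
  have hne : Nonempty ι := by
    rw [← Fintype.card_pos_iff]
    exact_mod_cast hcard ▸ hn
  have hCpos : 0 < C := by
    by_contra hCn
    have hg0 : ∀ k, g k = 0 := fun k => by
      ext t
      have := (hfirst k t).trans (div_nonpos_of_nonpos_of_nonneg (not_lt.1 hCn) hsn.le)
      exact abs_nonpos_iff.1 this
    have h := hg hne.some hne.some
    rw [hg0] at h
    simp at h
  have hρ1 : ∀ k, ρ (Sum.inl k) (g k) < C / (1 + s * n) := fun k =>
    hρ.lt _ _ _ (by positivity) (hfirst k)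
  have hρ2 : ∀ l, ρ (Sum.inr l) (∑ i, H i l • g i) ≤ C / (1 + s) := fun l =>
    (hρ.lt _ _ _ (by positivity) fun t => by
      simpa [ContinuousMap.sum_apply, mul_comm] using hsecond l t).le
  have htrace : ∑ k, ρ (Sum.inl k) (g k) + s * ∑ l, ρ (Sum.inr l) (∑ i, H i l • g i) = n := by
    have h : ∑ k, hadamardFunctional ρ H s k (g k) = n := by simp [hg, hcard]
    rw [← h]
    simp only [hadamardFunctional_apply, Finset.sum_add_distrib, map_sum, map_smul, smul_eq_mul,
      Finset.mul_sum]
    rw [Finset.sum_comm]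
  have hlt : n < n * (C / (1 + s * n)) + s * (n * (C / (1 + s))) := by
    have h1 : ∑ k, ρ (Sum.inl k) (g k) < n * (C / (1 + s * n)) := by
      refine (Finset.sum_lt_sum_of_nonempty Finset.univ_nonempty fun k _ => hρ1 k).trans_eq ?_
      simp [hcard]
    have h2 : ∑ l, ρ (Sum.inr l) (∑ i, H i l • g i) ≤ n * (C / (1 + s)) := by
      refine (Finset.sum_le_sum fun l _ => hρ2 l).trans_eq ?_
      simp [hcard]
    calc n = _ := htrace.symm
      _ < _ := add_lt_add_of_lt_of_le h1 (mul_le_mul_of_nonneg_left h2 hs)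
  have hw : 0 < 1 / (1 + s * n) + s / (1 + s) := by positivity
  have hlt' : 1 < C * (1 / (1 + s * n) + s / (1 + s)) := by
    refine lt_of_mul_lt_mul_left (a := n) ?_ hn.le
    calc n * 1 = n := mul_one n
      _ < _ := hlt
      _ = _ := by ring
  have hvC : v < C := lt_of_mul_lt_mul_right (hsv.trans_lt hlt') hw.le
  linarith

end HadamardFunctional

/-- The values `v`, one less than the projection constants of the kernels of the rows of `[1, s H]`,
cover `[1, ∞)` as `s` and the order `2 ^ k` of `H` vary. -/
theorem exists_hadamard_parameter {v : ℝ} (hv : 1 ≤ v) :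
    ∃ (k : ℕ) (s : ℝ), 0 ≤ s ∧ v * (1 / (1 + s * 2 ^ k) + s / (1 + s)) = 1 := by
  obtain ⟨j, hj⟩ := pow_unbounded_of_one_lt (2 * v) (one_lt_two (α := ℝ))
  have hq : (0 : ℝ) < 2 ^ j := by positivity
  have hcont : ContinuousOn (fun s : ℝ => v * (1 / (1 + s * 2 ^ (2 * j)) + s / (1 + s)))
      (Set.Icc 0 (1 / 2 ^ j)) := by
    refine ContinuousOn.mul continuousOn_const (ContinuousOn.add
      (ContinuousOn.div (by fun_prop) (by fun_prop) fun s hs => ?_)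
      (ContinuousOn.div (by fun_prop) (by fun_prop) fun s hs => ?_)) <;>
    · have := hs.1
      positivity
  obtain ⟨s, hs, hsv⟩ := intermediate_value_Icc' (by positivity) hcont (show (1 : ℝ) ∈ _ by
    have hval : v * (1 / (1 + 1 / 2 ^ j * 2 ^ (2 * j)) + 1 / 2 ^ j / (1 + 1 / 2 ^ j)) =
        2 * v / (1 + 2 ^ j) := by
      rw [pow_mul']
      field_simp
      ring
    refine ⟨?_, by simpa using hv⟩
    rw [hval, div_le_one (by positivity)]
    linarith)
  exact ⟨2 * j, s, hs.1, hsv⟩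

/-- For every `Λ ∈ [2, ∞)` there is a finite-codimensional closed subspace `Y` of the real
space `C[0,1]` with `λ(Y, C[0,1]) = Λ` for which no minimal projection exists. -/
theorem exists_finite_codim_subspace_projConst_not_attained
    (Λ : ℝ) (hΛ : 2 ≤ Λ) :
    ∃ Y : Submodule ℝ C(unitInterval, ℝ),
      IsClosed (Y : Set C(unitInterval, ℝ)) ∧
      FiniteDimensional ℝ (C(unitInterval, ℝ) ⧸ Y) ∧
      projConst (𝕜 := ℝ) (F := C(unitInterval, ℝ)) Y = Λ ∧
      ¬∃ P : C(unitInterval, ℝ) →L[ℝ] C(unitInterval, ℝ),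
        IsProjectionOnto (𝕜 := ℝ) (F := C(unitInterval, ℝ)) Y P ∧
        ‖P‖ = projConst (𝕜 := ℝ) (F := C(unitInterval, ℝ)) Y := by
  have hv1 : 1 ≤ Λ - 1 := by linarith
  have hv : 0 < Λ - 1 := by linarith
  obtain ⟨k, s, hs, hsv⟩ := exists_hadamard_parameter hv1
  obtain ⟨ι, _, _, H, hcard, habs, hsymm, horth⟩ := exists_sylvester_hadamard k
  have hcard' : (Fintype.card ι : ℝ) = 2 ^ k := by exact_mod_cast hcard
  have hn : (0 : ℝ) < 2 ^ k := by positivity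
  obtain ⟨ρ, hρ⟩ := exists_isDisjointNonattaining (ι ⊕ ι)
  have hlt : ∀ P : C(I, ℝ) →L[ℝ] C(I, ℝ), IsProjectionOnto (hadamardKernel ρ H s) P → Λ < ‖P‖ :=
    fun P hP => by
      linarith [lt_norm_of_isProjectionOnto_s19 hρ hs hn hv habs hsymm hcard' horth hsv hP]
  have hle : ∀ ε > 0, ∃ P : C(I, ℝ) →L[ℝ] C(I, ℝ),
      IsProjectionOnto (hadamardKernel ρ H s) P ∧ ‖P‖ ≤ Λ + ε := fun ε hε => by
    obtain ⟨g, hg, hgc⟩ := exists_dual_system hρ hs hn hv habs hsymm hcard' horth hsv hε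
    obtain ⟨P, hP, hPn⟩ := exists_projection_norm_le hρ hs (by positivity) hg hgc
    exact ⟨P, hP, by linarith⟩
  have hconst : projConst (hadamardKernel ρ H s) = Λ := by
    refine csInf_eq_of_forall_ge_of_forall_gt_exists_lt ?_ ?_ ?_
    · obtain ⟨P, hP, -⟩ := hle 1 one_pos
      exact ⟨_, P, hP, rfl⟩
    · rintro _ ⟨P, hP, rfl⟩
      exact (hlt P hP).le
    · intro c hc
      obtain ⟨P, hP, hPn⟩ := hle ((c - Λ) / 2) (by linarith)
      exact ⟨_, ⟨P, hP, rfl⟩, by linarith⟩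
  refine ⟨hadamardKernel ρ H s, ContinuousLinearMap.isClosed_ker _, ?_, hconst, ?_⟩
  · exact (LinearMap.quotKerEquivRange
      (ContinuousLinearMap.pi (hadamardFunctional ρ H s)).toLinearMap).symm.finiteDimensional
  · rintro ⟨P, hP, hPn⟩
    rw [hconst] at hPn
    exact (hlt P hP).ne' hPn
end
end
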